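/- Let α = [a_0, a_1, a_2, …] be an irrational continued fraction whose partial quotients are all positive integers. If α is palindromic (i.e. 1-palindromic: infinitely many of its prefixes (a_0, …, a_i) satisfy [a_0, …, a_i] = [a_i, …, a_0]), then α is either transcendental or a quadratic irrational. -/

import Mathlib

/-- Value of a finite continued fraction `[a₀, a₁, …, a_i] = a₀ + 1/(a₁ + 1/(⋯ + 1/a_i))`. -/
noncomputable def cfVal : List ℕ → ℝ
  | [] => 0
  | [a] => (a : ℝ)
  | a :: b :: rest => (a : ℝ) + 1 / cfVal (b :: rest)

/-- `A` is an `m`-palindrome: `[A] = m·[Ã]`, where `Ã` is the reversal of `A`. -/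
def IsMPal (m : ℕ) (A : List ℕ) : Prop := cfVal A = (m : ℝ) * cfVal A.reverse

/-- The prefix `(a₀, …, a_i)` of an infinite sequence of partial quotients. -/
def cfPrefix (a : ℕ → ℕ) (i : ℕ) : List ℕ := (List.range (i + 1)).map a

/-- Continuant numerators, index-shifted: `contP a (k+1) = p_k`, `contP a 0 = p₋₁ = 1`. -/
def contP (a : ℕ → ℕ) : ℕ → ℤ
  | 0 => 1
  | 1 => (a 0 : ℤ)
  | (k+2) => (a (k+1) : ℤ) * contP a (k+1) + contP a k

/-- Continuant denominators, index-shifted: `contQ a (k+1) = q_k`, `contQ a 0 = q₋₁ = 0`. -/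
def contQ (a : ℕ → ℕ) : ℕ → ℤ
  | 0 => 0
  | 1 => 1
  | (k+2) => (a (k+1) : ℤ) * contQ a (k+1) + contQ a k

/-- Concatenation of `k` copies of the finite sequence `A`. -/
def listPow (A : List ℕ) (k : ℕ) : List ℕ := (List.replicate k A).flatten

/-- `x` is a quadratic irrational. -/
def IsQuadraticIrrational (x : ℝ) : Prop :=
  Irrational x ∧ ∃ a b c : ℤ, a ≠ 0 ∧ (a : ℝ) * x ^ 2 + (b : ℝ) * x + (c : ℝ) = 0

/-- `x` is a reduced quadratic irrational: `x > 1` and its algebraic (Galois) conjugate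
lies strictly between `-1` and `0`. -/
def IsReducedQuadIrr (x : ℝ) : Prop :=
  Irrational x ∧ 1 < x ∧
    ∃ a b c : ℤ, a ≠ 0 ∧ (a : ℝ) * x ^ 2 + (b : ℝ) * x + (c : ℝ) = 0 ∧
      ∀ y : ℝ, y ≠ x → (a : ℝ) * y ^ 2 + (b : ℝ) * y + (c : ℝ) = 0 → -1 < y ∧ y < 0

/-- `x` and `y` are equivalent: `x = (a + b·y)/(c + d·y)` for integers with `ad - bc = ±1`. -/
def RealEquiv (x y : ℝ) : Prop :=
  ∃ a b c d : ℤ, (a * d - b * c = 1 ∨ a * d - b * c = -1) ∧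
    ((c : ℝ) + (d : ℝ) * y ≠ 0) ∧ x = ((a : ℝ) + (b : ℝ) * y) / ((c : ℝ) + (d : ℝ) * y)

open Finset

/-- The value at `ω` of the monomial with exponent `a`. -/
noncomputable def expWt {σ : Type*} (ω : σ → ℝ) (a : σ →₀ ℕ) : ℝ := a.prod fun i k => ω i ^ k

section expWt
variable {σ : Type*} (ω : σ → ℝ)

lemma expWt_add (a b : σ →₀ ℕ) : expWt ω (a + b) = expWt ω a * expWt ω b := by
  classical
  exact Finsupp.prod_add_index' (fun _ => pow_zero _) fun _ _ _ => pow_add _ _ _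

@[simp] lemma expWt_zero : expWt ω 0 = 1 := by simp [expWt]

@[simp] lemma expWt_single (i : σ) (k : ℕ) : expWt ω (Finsupp.single i k) = ω i ^ k := by
  simp [expWt]

lemma expWt_nonneg {ω : σ → ℝ} (hω : ∀ i, 0 ≤ ω i) (a : σ →₀ ℕ) : 0 ≤ expWt ω a :=
  Finset.prod_nonneg fun i _ => pow_nonneg (hω i) _

lemma expWt_eq_prod [Fintype σ] (a : σ →₀ ℕ) : expWt ω a = ∏ i, ω i ^ a i :=
  Finsupp.prod_fintype _ _ fun _ => pow_zero _

end expWt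

section seminorm
variable {σ : Type*} {R : Type*} [CommRing R]

lemma RingSeminorm.sum_le' (ν : RingSeminorm R) {ι : Type*} (s : Finset ι) (f : ι → R) :
    ν (∑ i ∈ s, f i) ≤ ∑ i ∈ s, ν (f i) :=
  Finset.le_sum_of_subadditive ν (map_zero ν).le (map_add_le_add ν) s f

lemma RingSeminorm.prod_le' (ν : RingSeminorm R) (h1 : ν 1 ≤ 1) {ι : Type*} (s : Finset ι)
    (f : ι → R) : ν (∏ i ∈ s, f i) ≤ ∏ i ∈ s, ν (f i) := by
  classical
  induction s using Finset.induction_on with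
  | empty => simpa using h1
  | insert i s hi ih =>
    rw [prod_insert hi, prod_insert hi]
    exact (map_mul_le_mul ν _ _).trans (mul_le_mul_of_nonneg_left ih (apply_nonneg ν _))

lemma RingSeminorm.pow_le' (ν : RingSeminorm R) (h1 : ν 1 ≤ 1) (x : R) (n : ℕ) :
    ν (x ^ n) ≤ ν x ^ n := by
  simpa using ν.prod_le' h1 (Finset.range n) (fun _ => x)

lemma RingSeminorm.det_le (ν : RingSeminorm R) (h1 : ν 1 ≤ 1) {s : ℕ}
    (E : Matrix (Fin s) (Fin s) R) (B : Fin s → ℝ) (hE : ∀ i j, ν (E i j) ≤ B j) :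
    ν E.det ≤ s.factorial * ∏ j, B j := by
  rw [Matrix.det_apply]
  refine (ν.sum_le' _ _).trans ?_
  have : ∀ τ ∈ (Finset.univ : Finset (Equiv.Perm (Fin s))),
      ν (Equiv.Perm.sign τ • ∏ i, E (τ i) i) ≤ ∏ j, B j := by
    intro τ _
    have : ν (Equiv.Perm.sign τ • ∏ i, E (τ i) i) = ν (∏ i, E (τ i) i) := by
      rcases Int.units_eq_one_or (Equiv.Perm.sign τ) with h | h <;> simp [h]
    rw [this]
    exact (ν.prod_le' h1 _ _).trans (prod_le_prod (fun _ _ => apply_nonneg ν _) fun i _ => hE _ _)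
  refine (Finset.sum_le_card_nsmul _ _ _ this).trans ?_
  simp [Finset.card_univ, Fintype.card_perm]

/-- The weighted `ℓ¹` seminorm on multivariate polynomials. -/
noncomputable def mvNorm (ν : RingSeminorm R) (ω : σ → ℝ) (hω : ∀ i, 0 ≤ ω i) :
    RingSeminorm (MvPolynomial σ R) :=
  have key : ∀ (f : MvPolynomial σ R) (s : Finset (σ →₀ ℕ)), f.support ⊆ s →
      ∑ a ∈ f.support, ν (f.coeff a) * expWt ω a = ∑ a ∈ s, ν (f.coeff a) * expWt ω a := by
    intro f s hs
    refine Finset.sum_subset hs fun a _ ha => ?_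
    rw [MvPolynomial.notMem_support_iff.1 ha]; simp
  have addle : ∀ f g : MvPolynomial σ R,
      ∑ a ∈ (f + g).support, ν ((f + g).coeff a) * expWt ω a ≤
      ∑ a ∈ f.support, ν (f.coeff a) * expWt ω a + ∑ a ∈ g.support, ν (g.coeff a) * expWt ω a := by
    classical
    intro f g
    rw [key f _ (subset_union_left (s₂ := g.support)), key g _ (subset_union_right (s₁ := f.support)),
      key (f + g) _ MvPolynomial.support_add, ← sum_add_distrib]
    refine sum_le_sum fun a _ => ?_
    rw [← add_mul, MvPolynomial.coeff_add]
    exact mul_le_mul_of_nonneg_right (map_add_le_add ν _ _) (expWt_nonneg hω _)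
  have mono : ∀ a (c : R), ∑ b ∈ (MvPolynomial.monomial a c).support,
      ν ((MvPolynomial.monomial a c).coeff b) * expWt ω b = ν c * expWt ω a := by
    classical
    intro a c
    rw [key _ _ MvPolynomial.support_monomial_subset]
    simp
  { toFun := fun f => ∑ a ∈ f.support, ν (f.coeff a) * expWt ω a
    map_zero' := by simp
    add_le' := addle
    neg' := fun f => by simp
    mul_le' := fun f g => by
      have hfg : f * g = ∑ a ∈ f.support, ∑ b ∈ g.support,
          MvPolynomial.monomial (a + b) (f.coeff a * g.coeff b) := by
        conv_lhs => rw [f.as_sum, g.as_sum]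
        rw [Finset.sum_mul_sum]
        simp [MvPolynomial.monomial_mul]
      have h0 : ∑ a ∈ (0 : MvPolynomial σ R).support,
        ν ((0 : MvPolynomial σ R).coeff a) * expWt ω a ≤ 0 := by simp
      rw [hfg, Finset.sum_mul_sum]
      refine (Finset.le_sum_of_subadditive (fun f : MvPolynomial σ R =>
        ∑ a ∈ f.support, ν (f.coeff a) * expWt ω a) h0 addle _ _).trans ?_
      refine sum_le_sum fun a _ => ?_
      refine (Finset.le_sum_of_subadditive (fun f : MvPolynomial σ R =>
        ∑ a ∈ f.support, ν (f.coeff a) * expWt ω a) h0 addle _ _).trans ?_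
      refine sum_le_sum fun b _ => ?_
      simp only [mono]
      rw [expWt_add]
      calc _ ≤ ν (f.coeff a) * ν (g.coeff b) * (expWt ω a * expWt ω b) :=
            mul_le_mul_of_nonneg_right (map_mul_le_mul ν _ _)
              (mul_nonneg (expWt_nonneg hω _) (expWt_nonneg hω _))
        _ = _ := by ring }

section mvNorm
variable (ν : RingSeminorm R) (ω : σ → ℝ) (hω : ∀ i, 0 ≤ ω i)

lemma mvNorm_apply (f : MvPolynomial σ R) :
    mvNorm ν ω hω f = ∑ a ∈ f.support, ν (f.coeff a) * expWt ω a := rfl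

lemma mvNorm_eq_sum (f : MvPolynomial σ R) (s : Finset (σ →₀ ℕ)) (hs : f.support ⊆ s) :
    mvNorm ν ω hω f = ∑ a ∈ s, ν (f.coeff a) * expWt ω a := by
  refine Finset.sum_subset hs fun a _ ha => ?_
  rw [MvPolynomial.notMem_support_iff.1 ha]; simp

lemma mvNorm_monomial (a : σ →₀ ℕ) (c : R) :
    mvNorm ν ω hω (MvPolynomial.monomial a c) = ν c * expWt ω a := by
  classical
  rw [mvNorm_eq_sum _ _ _ _ _ MvPolynomial.support_monomial_subset]
  simp

lemma mvNorm_C (c : R) : mvNorm ν ω hω (MvPolynomial.C c) = ν c := by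
  simpa using mvNorm_monomial ν ω hω 0 c

lemma mvNorm_one : mvNorm ν ω hω 1 = ν 1 := mvNorm_C ν ω hω 1

lemma mvNorm_X (i : σ) : mvNorm ν ω hω (MvPolynomial.X i) = ν 1 * ω i := by
  rw [MvPolynomial.X, mvNorm_monomial]; simp

lemma coeff_le_mvNorm (f : MvPolynomial σ R) (a : σ →₀ ℕ) :
    ν (f.coeff a) * expWt ω a ≤ mvNorm ν ω hω f := by
  by_cases ha : a ∈ f.support
  · exact single_le_sum (f := fun a => ν (f.coeff a) * expWt ω a)
      (fun b _ => mul_nonneg (apply_nonneg ν _) (expWt_nonneg hω _)) ha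
  · rw [MvPolynomial.notMem_support_iff.1 ha]; simp

/-- A seminorm of a substitution is bounded by the norm of the polynomial. -/
lemma RingSeminorm.eval₂_le {S : Type*} [CommRing S] (μ : RingSeminorm S) (h1 : μ 1 ≤ 1)
    (φ : R →+* S) (x : σ → S) (f : MvPolynomial σ R) :
    μ (MvPolynomial.eval₂ φ x f) ≤
      ∑ a ∈ f.support, μ (φ (f.coeff a)) * expWt (fun i => μ (x i)) a := by
  rw [MvPolynomial.eval₂_eq]
  refine (μ.sum_le' _ _).trans (sum_le_sum fun a _ => ?_)
  refine (map_mul_le_mul μ _ _).trans (mul_le_mul_of_nonneg_left ?_ (apply_nonneg μ _))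
  refine (μ.prod_le' h1 _ _).trans (prod_le_prod (fun _ _ => apply_nonneg μ _) fun i _ => ?_)
  exact μ.pow_le' h1 _ _

end mvNorm

end seminorm

lemma coeff_prod_sum_of_natDegree_le {R ι : Type*} [CommRing R] (s : Finset ι)
    (f : ι → Polynomial R) (d : ι → ℕ) (h : ∀ i ∈ s, (f i).natDegree ≤ d i) :
    (∏ i ∈ s, f i).coeff (∑ i ∈ s, d i) = ∏ i ∈ s, (f i).coeff (d i) := by
  classical
  induction s using Finset.induction_on with
  | empty => simp
  | insert i s hi ih =>
    rw [prod_insert hi, sum_insert hi, prod_insert hi, Polynomial.coeff_mul_add_eq_of_natDegree_le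
      (h i (mem_insert_self _ _)), ih fun j hj => h j (mem_insert_of_mem hj)]
    exact (Polynomial.natDegree_prod_le _ _).trans
      (sum_le_sum fun j hj => h j (mem_insert_of_mem hj))

lemma det_choose_ne_zero {s : ℕ} (d : Fin s → ℕ) (hd : Function.Injective d) :
    (Matrix.of fun i l : Fin s => ((d l).choose i : ℚ)).det ≠ 0 := by
  have h1 := Matrix.det_eval_matrixOfPolynomials_eq_det_vandermonde (fun l => (d l : ℚ))
    (fun i : Fin s => descPochhammer ℚ i) (fun i => descPochhammer_natDegree ℚ i)
    (fun i => monic_descPochhammer ℚ i)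
  have h2 : (Matrix.vandermonde fun l => (d l : ℚ)).det ≠ 0 :=
    Matrix.det_vandermonde_ne_zero_iff.2 (Nat.cast_injective.comp hd)
  rw [h1] at h2
  have h3 : (Matrix.of fun i j : Fin s => (descPochhammer ℚ j).eval (d i : ℚ)) =
      Matrix.of fun i j : Fin s => ((fun j : Fin s => ((j : ℕ).factorial : ℚ)) j) *
        (Matrix.of fun i l : Fin s => ((d l).choose i : ℚ)).transpose i j := by
    ext i j
    simp only [Matrix.of_apply, Matrix.transpose_apply]
    rw [descPochhammer_eval_eq_descFactorial, Nat.descFactorial_eq_factorial_mul_choose]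
    push_cast; rfl
  rw [h3, Matrix.det_mul_row, Matrix.det_transpose] at h2
  exact right_ne_zero_of_mul h2

/-- The Wronskian matrix built from Hasse derivatives. -/
noncomputable def wronskMat {R : Type*} [CommRing R] {s : ℕ} (g : Fin s → Polynomial R) :
    Matrix (Fin s) (Fin s) (Polynomial R) :=
  Matrix.of fun i l => Polynomial.hasseDeriv i (g l)

lemma wronskMat_det_ne_zero_of_natDegree_injective {s : ℕ} (g : Fin s → Polynomial ℚ)
    (h0 : ∀ l, g l ≠ 0) (hd : Function.Injective fun l => (g l).natDegree) :
    (wronskMat g).det ≠ 0 := by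
  intro hdet
  have h1 := Matrix.det_mul_column (fun i : Fin s => (Polynomial.X : Polynomial ℚ) ^ (i : ℕ))
    (wronskMat g)
  rw [hdet, mul_zero] at h1
  have hentry : ∀ i l : Fin s, ((Polynomial.X : Polynomial ℚ) ^ (i : ℕ) *
      Polynomial.hasseDeriv i (g l)).natDegree ≤ (g l).natDegree ∧
      ((Polynomial.X : Polynomial ℚ) ^ (i : ℕ) * Polynomial.hasseDeriv i (g l)).coeff
        (g l).natDegree = ((g l).natDegree.choose i : ℚ) * (g l).leadingCoeff := by
    intro i l
    rcases lt_or_ge (g l).natDegree i with h | h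
    · rw [Polynomial.hasseDeriv_eq_zero_of_lt_natDegree _ _ h, Nat.choose_eq_zero_of_lt h]
      simp
    · constructor
      · refine Polynomial.natDegree_mul_le.trans ?_
        have := Polynomial.natDegree_hasseDeriv_le (g l) i
        simp only [Polynomial.natDegree_X_pow]
        omega
      · rw [Polynomial.coeff_X_pow_mul', if_pos h, Polynomial.hasseDeriv_coeff,
          Nat.sub_add_cancel h]
        rfl
  have h2 : (Matrix.of fun i l : Fin s => (Polynomial.X : Polynomial ℚ) ^ (i : ℕ) *
      wronskMat g i l).det.coeff (∑ l, (g l).natDegree) =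
      (Matrix.of fun i l : Fin s => (g l).leadingCoeff *
        (Matrix.of fun i l : Fin s => ((g l).natDegree.choose i : ℚ)) i l).det := by
    rw [Matrix.det_apply, Matrix.det_apply, Polynomial.finsetSum_coeff]
    refine sum_congr rfl fun τ _ => ?_
    rw [Polynomial.coeff_smul]
    congr 1
    rw [coeff_prod_sum_of_natDegree_le]
    · refine prod_congr rfl fun l _ => ?_
      simp only [Matrix.of_apply, wronskMat]
      rw [(hentry _ _).2, mul_comm]
    · intro l _
      exact (hentry _ _).1
  rw [h1, Polynomial.coeff_zero, Matrix.det_mul_row] at h2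
  refine mul_ne_zero (prod_ne_zero_iff.2 fun l _ => ?_) (det_choose_ne_zero _ hd) h2.symm
  simpa using h0 l

theorem wronskMat_det_ne_zero {s : ℕ} (g : Fin s → Polynomial ℚ) (hg : LinearIndependent ℚ g) :
    (wronskMat g).det ≠ 0 := by
  induction hn : ∑ l, (g l).natDegree using Nat.strong_induction_on generalizing g with
  | _ n ih =>
    subst hn
    by_cases hd : Function.Injective fun l => (g l).natDegree
    · exact wronskMat_det_ne_zero_of_natDegree_injective g (fun l => hg.ne_zero l) hd
    · simp only [Function.Injective, not_forall] at hd
      obtain ⟨i, j, hij, hne⟩ := hd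
      set c : ℚ := -((g i).leadingCoeff / (g j).leadingCoeff) with hc
      have hlj : (g j).leadingCoeff ≠ 0 := by simpa using hg.ne_zero j
      have hli : (g i).leadingCoeff ≠ 0 := by simpa using hg.ne_zero i
      set p : Polynomial ℚ := g i + c • g j with hp
      have hg' : LinearIndependent ℚ (Function.update g i p) := by
        rw [Fintype.linearIndependent_iff] at hg ⊢
        intro e he
        have h1 : ∑ l, e l • Function.update g i p l =
            ∑ l, (e + Pi.single j (e i * c) : Fin s → ℚ) l • g l := by
          simp only [Pi.add_apply, add_smul, sum_add_distrib]
          rw [← Finset.add_sum_erase _ _ (mem_univ i), ← Finset.add_sum_erase _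
            (fun l => e l • g l) (mem_univ i)]
          have : ∑ x ∈ univ.erase i, e x • Function.update g i p x
              = ∑ x ∈ univ.erase i, e x • g x :=
            sum_congr rfl fun x hx => by rw [Function.update_of_ne (ne_of_mem_erase hx)]
          rw [this]
          simp only [Function.update_self, hp, smul_add, smul_smul, Pi.single_apply, ite_smul,
            zero_smul, sum_ite_eq', mem_univ, if_true]
          abel
        rw [h1] at he
        have h2 := hg _ he
        have hi : e i = 0 := by
          have := h2 i
          simpa [Pi.single_apply, hne] using this
        intro l
        have := h2 l
        simpa [hi] using this
      have hp0 : p ≠ 0 := by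
        have := hg'.ne_zero i
        simpa using this
      have hdeg : p.natDegree < (g i).natDegree := by
        have hle : p.natDegree ≤ (g i).natDegree := by
          refine (Polynomial.natDegree_add_le _ _).trans (max_le le_rfl ?_)
          exact (Polynomial.natDegree_smul_le _ _).trans hij.ge
        refine lt_of_le_of_ne hle fun h => hp0 ?_
        rw [← Polynomial.leadingCoeff_eq_zero, Polynomial.leadingCoeff, h, hp,
          Polynomial.coeff_add, Polynomial.coeff_smul]
        have hij' : (g i).natDegree = (g j).natDegree := hij
        nth_rewrite 2 [hij']
        rw [Polynomial.coeff_natDegree, Polynomial.coeff_natDegree, hc]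
        simp only [smul_eq_mul]
        field_simp
        ring
      have hsum : ∑ l, (Function.update g i p l).natDegree < ∑ l, (g l).natDegree := by
        refine sum_lt_sum (fun l _ => ?_) ⟨i, mem_univ i, by simpa using hdeg⟩
        rcases eq_or_ne l i with rfl | h
        · simpa using hdeg.le
        · rw [Function.update_of_ne h]
      have := ih _ hsum _ hg' rfl
      have heq : wronskMat (Function.update g i p) =
          (wronskMat g).updateCol i fun k => wronskMat g k i + (Polynomial.C c) • wronskMat g k j := by
        ext1 k l
        rcases eq_or_ne l i with rfl | h
        · simp [wronskMat, hp, ← Polynomial.smul_eq_C_mul]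
        · simp [wronskMat, h]
      rwa [heq, Matrix.det_updateCol_add_smul_self _ hne] at this

section mvHasse
variable {σ : Type*} {R : Type*} [CommRing R]

/-- The Taylor expansion `f(x + y)` as a polynomial in `y` with coefficients polynomials in `x`. -/
noncomputable def mvTaylor : MvPolynomial σ R →ₐ[R] MvPolynomial σ (MvPolynomial σ R) :=
  MvPolynomial.aeval fun i => MvPolynomial.C (MvPolynomial.X i) + MvPolynomial.X i

/-- The Hasse derivative with respect to a multi-index. -/
noncomputable def mvHasse (α : σ →₀ ℕ) : MvPolynomial σ R →ₗ[R] MvPolynomial σ R where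
  toFun f := (mvTaylor f).coeff α
  map_add' f g := by simp
  map_smul' c f := by simp

lemma mvHasse_apply (α : σ →₀ ℕ) (f : MvPolynomial σ R) :
    mvHasse α f = (mvTaylor f).coeff α := rfl

lemma expWt_two_mul (ω : σ → ℝ) (a : σ →₀ ℕ) :
    expWt (fun i => 2 * ω i) a = 2 ^ a.degree * expWt ω a := by
  simp only [expWt, Finsupp.prod, mul_pow, prod_mul_distrib, prod_pow_eq_pow_sum]
  rfl

lemma expWt_mono {ω ω' : σ → ℝ} (h0 : ∀ i, 0 ≤ ω i) (h : ∀ i, ω i ≤ ω' i) (a : σ →₀ ℕ) :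
    expWt ω a ≤ expWt ω' a :=
  prod_le_prod (fun i _ => pow_nonneg (h0 i) _) fun i _ => pow_le_pow_left₀ (h0 i) (h i) _

lemma mvNorm_mvHasse_le (ν : RingSeminorm R) (h1 : ν 1 ≤ 1) (ω : σ → ℝ) (hω : ∀ i, 0 ≤ ω i)
    (α : σ →₀ ℕ) (f : MvPolynomial σ R) (d : ℕ) (hd : ∀ a ∈ f.support, a.degree ≤ d) :
    mvNorm ν ω hω (mvHasse α f) * expWt ω α ≤ 2 ^ d * mvNorm ν ω hω f := by
  set μ := mvNorm (mvNorm ν ω hω) ω hω with hμ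
  have hμ1 : μ 1 ≤ 1 := by rw [hμ, mvNorm_one, mvNorm_one]; exact h1
  refine (coeff_le_mvNorm (mvNorm ν ω hω) ω hω _ _).trans ?_
  have h2 := RingSeminorm.eval₂_le μ hμ1 (algebraMap R (MvPolynomial σ (MvPolynomial σ R)))
    (fun i => MvPolynomial.C (MvPolynomial.X i) + MvPolynomial.X i) f
  rw [← MvPolynomial.aeval_def] at h2
  refine h2.trans ?_
  rw [mvNorm_apply, mul_sum]
  refine sum_le_sum fun a ha => ?_
  have h3 : μ (algebraMap R (MvPolynomial σ (MvPolynomial σ R)) (f.coeff a)) = ν (f.coeff a) := by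
    rw [IsScalarTower.algebraMap_apply R (MvPolynomial σ R), MvPolynomial.algebraMap_eq,
      MvPolynomial.algebraMap_eq, hμ, mvNorm_C, mvNorm_C]
  have h4 : expWt (fun i => μ (MvPolynomial.C (MvPolynomial.X i) + MvPolynomial.X i)) a ≤
      2 ^ d * expWt ω a := by
    have : expWt (fun i => μ (MvPolynomial.C (MvPolynomial.X i) + MvPolynomial.X i)) a ≤
      expWt (fun i => 2 * ω i) a := by
      refine expWt_mono (fun i => apply_nonneg μ _) (fun i => ?_) a
      refine (map_add_le_add μ _ _).trans ?_
      rw [hμ, mvNorm_C, mvNorm_X, mvNorm_X, mvNorm_one]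
      have := mul_le_mul_of_nonneg_right h1 (hω i)
      linarith
    refine this.trans ?_
    rw [expWt_two_mul]
    exact mul_le_mul_of_nonneg_right (pow_le_pow_right₀ (by norm_num) (hd a ha))
      (expWt_nonneg hω a)
  rw [h3]
  calc _ ≤ ν (f.coeff a) * (2 ^ d * expWt ω a) :=
        mul_le_mul_of_nonneg_left h4 (apply_nonneg ν _)
    _ = _ := by ring

lemma mvTaylor_comp {S : Type*} [CommRing S] (φ : R →+* S) (f : MvPolynomial σ R) (ξ : σ → S) :
    MvPolynomial.map (MvPolynomial.eval₂Hom (MvPolynomial.C.comp φ)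
      fun i => MvPolynomial.X i + MvPolynomial.C (ξ i)) (mvTaylor f) =
    mvTaylor (MvPolynomial.eval₂Hom (MvPolynomial.C.comp φ)
      (fun i => MvPolynomial.X i + MvPolynomial.C (ξ i)) f) := by
  set sh := MvPolynomial.eval₂Hom (MvPolynomial.C.comp φ)
      fun i => MvPolynomial.X i + MvPolynomial.C (ξ i) with hsh
  change (((MvPolynomial.map sh).comp (mvTaylor (σ := σ) (R := R)).toRingHom) f) =
    ((mvTaylor (σ := σ) (R := S)).toRingHom.comp sh) f
  congr 1
  refine MvPolynomial.ringHom_ext (fun r => ?_) fun i => ?_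
  · simp [mvTaylor, hsh, IsScalarTower.algebraMap_apply R (MvPolynomial σ R),
      IsScalarTower.algebraMap_apply S (MvPolynomial σ S), MvPolynomial.algebraMap_eq]
  · simp [mvTaylor, hsh, 
      IsScalarTower.algebraMap_apply S (MvPolynomial σ S), MvPolynomial.algebraMap_eq]
    ring

/-- Translation by `ξ`, after a change of coefficients. -/
noncomputable def mvShift {S : Type*} [CommRing S] (φ : R →+* S) (ξ : σ → S) :
    MvPolynomial σ R →+* MvPolynomial σ S :=
  MvPolynomial.eval₂Hom (MvPolynomial.C.comp φ) fun i => MvPolynomial.X i + MvPolynomial.C (ξ i)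

lemma mvShift_mvHasse {S : Type*} [CommRing S] (φ : R →+* S) (ξ : σ → S) (α : σ →₀ ℕ)
    (f : MvPolynomial σ R) : mvShift φ ξ (mvHasse α f) = mvHasse α (mvShift φ ξ f) := by
  rw [mvHasse_apply, mvHasse_apply, mvShift, ← mvTaylor_comp, MvPolynomial.coeff_map]

lemma map_mvHasse {S : Type*} [CommRing S] (φ : R →+* S) (α : σ →₀ ℕ)
    (f : MvPolynomial σ R) :
    MvPolynomial.map φ (mvHasse α f) = mvHasse α (MvPolynomial.map φ f) := by
  have := mvShift_mvHasse φ (0 : σ → S) α f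
  have h : mvShift φ (0 : σ → S) = MvPolynomial.map φ := by
    refine MvPolynomial.ringHom_ext (fun r => ?_) fun i => ?_ <;> simp [mvShift]
  rwa [h] at this

lemma support_mvHasse_monomial (a : σ →₀ ℕ) :
    ∀ (α : σ →₀ ℕ), ∀ b ∈ (mvHasse α (MvPolynomial.monomial a (1 : R))).support, b ≤ a := by
  classical
  have hmul : ∀ a a' : σ →₀ ℕ,
      (∀ (α : σ →₀ ℕ), ∀ b ∈ (mvHasse α (MvPolynomial.monomial a (1 : R))).support, b ≤ a) →
      (∀ (α : σ →₀ ℕ), ∀ b ∈ (mvHasse α (MvPolynomial.monomial a' (1 : R))).support, b ≤ a') →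
      (∀ (α : σ →₀ ℕ), ∀ b ∈ (mvHasse α (MvPolynomial.monomial (a + a') (1 : R))).support,
        b ≤ a + a') := by
    intro a a' ha ha' α b hb
    have : MvPolynomial.monomial (a + a') (1 : R) =
        MvPolynomial.monomial a 1 * MvPolynomial.monomial a' 1 := by simp
    rw [this, mvHasse_apply, map_mul, MvPolynomial.coeff_mul] at hb
    obtain ⟨x, -, hx⟩ := mem_biUnion.1 (MvPolynomial.support_sum hb)
    obtain ⟨c, hc, c', hc', rfl⟩ := mem_add.1 (MvPolynomial.support_mul _ _ hx)
    exact add_le_add (ha _ c hc) (ha' _ c' hc')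
  have hzero : ∀ (α : σ →₀ ℕ), ∀ b ∈ (mvHasse α (MvPolynomial.monomial (0 : σ →₀ ℕ)
      (1 : R))).support, b ≤ 0 := by
    intro α b hb
    rw [mvHasse_apply, ← MvPolynomial.C_apply, map_one, map_one, MvPolynomial.coeff_one] at hb
    split_ifs at hb
    · have := MvPolynomial.support_monomial_subset (R := R) (s := (0 : σ →₀ ℕ)) (a := 1) hb
      simp only [mem_singleton] at this
      exact this.le
    · simp at hb
  induction a using Finsupp.induction_linear with
  | zero => exact hzero
  | add f g hf hg => exact hmul _ _ hf hg
  | single i k =>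
    induction k with
    | zero => simpa using hzero
    | succ k ih =>
      rw [Finsupp.single_add]
      refine hmul _ _ ih ?_
      intro α b hb
      rw [mvHasse_apply] at hb
      change b ∈ ((mvTaylor (MvPolynomial.X i : MvPolynomial σ R)).coeff α).support at hb
      simp only [mvTaylor, MvPolynomial.aeval_X, MvPolynomial.coeff_add, MvPolynomial.coeff_C,
        MvPolynomial.coeff_X] at hb
      rcases mem_union.1 (MvPolynomial.support_add hb) with h | h
      · split_ifs at h
        · have := MvPolynomial.support_monomial_subset h
          simp only [mem_singleton] at this
          exact this.le
        · simp at h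
      · split_ifs at h
        · have := MvPolynomial.support_monomial_subset (R := R) (s := (0 : σ →₀ ℕ)) (a := 1) h
          simp only [mem_singleton] at this
          rw [this]; exact zero_le
        · simp at h

lemma exists_le_of_mem_support_mvHasse (α : σ →₀ ℕ) (f : MvPolynomial σ R) (b : σ →₀ ℕ)
    (hb : b ∈ (mvHasse α f).support) : ∃ a ∈ f.support, b ≤ a := by
  classical
  rw [f.as_sum, map_sum] at hb
  obtain ⟨a, ha, hx⟩ := mem_biUnion.1 (MvPolynomial.support_sum hb)
  refine ⟨a, ha, ?_⟩
  have : MvPolynomial.monomial a (f.coeff a) = f.coeff a • MvPolynomial.monomial a 1 := by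
    rw [MvPolynomial.smul_monomial, smul_eq_mul, mul_one]
  rw [this, map_smul] at hx
  exact support_mvHasse_monomial a α b (MvPolynomial.support_smul hx)

end mvHasse

section Wronskian
variable {n : ℕ}

/-- The Kronecker substitution `X_h ↦ X ^ (N ^ h)`. -/
noncomputable def kron (n N : ℕ) : MvPolynomial (Fin n) ℚ →ₐ[ℚ] Polynomial ℚ :=
  MvPolynomial.aeval fun h => Polynomial.X ^ (N ^ (h : ℕ))

lemma kron_monomial (N : ℕ) (a : Fin n →₀ ℕ) (c : ℚ) :
    kron n N (MvPolynomial.monomial a c) = Polynomial.monomial (∑ h, a h * N ^ (h : ℕ)) c := by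
  rw [kron, MvPolynomial.aeval_monomial, Finsupp.prod_fintype _ _ fun _ => pow_zero _]
  simp only [← pow_mul, prod_pow_eq_pow_sum]
  rw [← Polynomial.C_mul_X_pow_eq_monomial]
  simp only [mul_comm]
  rfl

lemma kron_injOn {N : ℕ} (F : MvPolynomial (Fin n) ℚ) (hF : ∀ a ∈ F.support, ∀ h, a h < N)
    (h0 : kron n N F = 0) : F = 0 := by
  classical
  by_contra hne
  obtain ⟨a, ha⟩ := MvPolynomial.support_nonempty.2 hne
  have h1 : (kron n N F).coeff (∑ h, a h * N ^ (h : ℕ)) = F.coeff a := by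
    conv_lhs => rw [F.as_sum]
    rw [map_sum, Polynomial.finsetSum_coeff]
    simp only [kron_monomial, Polynomial.coeff_monomial]
    rw [Finset.sum_eq_single_of_mem a ha, if_pos rfl]
    intro b hb hba
    refine if_neg fun heq => hba ?_
    have := @finFunctionFinEquiv_apply N n (fun h => ⟨a h, hF a ha h⟩)
    have h2 := @finFunctionFinEquiv_apply N n (fun h => ⟨b h, hF b hb h⟩)
    have h3 : (fun h => (⟨a h, hF a ha h⟩ : Fin N)) = fun h => ⟨b h, hF b hb h⟩ := by
      apply finFunctionFinEquiv.injective
      apply Fin.ext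
      rw [this, h2]
      simpa using heq.symm
    ext h
    simpa using (congrArg Fin.val (congrFun h3 h)).symm
  rw [h0] at h1
  exact MvPolynomial.mem_support_iff.1 ha (by simpa using h1.symm)

open Polynomial in
lemma hasseDeriv_eq_coeff (f : ℚ[X]) (i : ℕ) :
    (taylor (X : ℚ[X]) (f.map C)).coeff i = hasseDeriv i f := by
  rw [taylor_coeff]
  have : hasseDeriv i (f.map (C : ℚ →+* ℚ[X])) = (hasseDeriv i f).map C := by
    ext1 k
    simp [hasseDeriv_coeff]
  rw [this, eval_map, eval₂_C_X]

open Polynomial in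
/-- The increment of the Kronecker curve. -/
noncomputable def kronInc (n N : ℕ) (h : Fin n) : ℚ[X][X] :=
  (X + C (X : ℚ[X])) ^ (N ^ (h : ℕ)) - C ((X : ℚ[X]) ^ (N ^ (h : ℕ)))

open Polynomial in
lemma hasseDeriv_kron (N : ℕ) (F : MvPolynomial (Fin n) ℚ) (S : Finset (Fin n →₀ ℕ))
    (hS : (mvTaylor F).support ⊆ S) (i : ℕ) :
    hasseDeriv i (kron n N F) =
      ∑ α ∈ S, (∏ h : Fin n, kronInc n N h ^ α h).coeff i * kron n N (mvHasse α F) := by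
  rw [← hasseDeriv_eq_coeff]
  have h1 : taylor (X : ℚ[X]) ((kron n N F).map C) =
      MvPolynomial.eval₂ ((C : ℚ[X] →+* ℚ[X][X]).comp (kron n N).toRingHom) (kronInc n N)
        (mvTaylor F) := by
    have : ((taylorAlgHom (X : ℚ[X])).toRingHom.comp
        (mapRingHom (C : ℚ →+* ℚ[X]))).comp (kron n N).toRingHom =
        (MvPolynomial.eval₂Hom ((C : ℚ[X] →+* ℚ[X][X]).comp (kron n N).toRingHom)
          (kronInc n N)).comp
          (mvTaylor (σ := Fin n) (R := ℚ)).toRingHom := by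
      refine MvPolynomial.ringHom_ext (fun r => ?_) fun h => ?_
      · simp [kron, mvTaylor, IsScalarTower.algebraMap_apply ℚ (MvPolynomial (Fin n) ℚ)
          (MvPolynomial (Fin n) (MvPolynomial (Fin n) ℚ)), MvPolynomial.algebraMap_eq]
      · simp [kron, mvTaylor, kronInc, taylor_apply]
    exact congrArg (fun φ => φ F) this
  rw [h1, MvPolynomial.eval₂_eq', finsetSum_coeff]
  rw [sum_subset hS]
  · refine sum_congr rfl fun α _ => ?_
    rw [RingHom.comp_apply, coeff_C_mul, mul_comm]
    rfl
  · intro α _ hα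
    rw [MvPolynomial.notMem_support_iff.1 hα]
    simp

open Polynomial in
lemma coeff_prod_eq_zero_of_lt (N : ℕ) (α : Fin n →₀ ℕ) (i : ℕ) (hi : i < α.degree) :
    (∏ h : Fin n, kronInc n N h ^ α h).coeff i = 0 := by
  have h1 : ∀ h : Fin n, (X : ℚ[X][X]) ∣ kronInc n N h := by
    intro h
    rw [kronInc, C_pow]
    have := sub_dvd_pow_sub_pow ((X : ℚ[X][X]) + C (X : ℚ[X])) (C (X : ℚ[X])) (N ^ (h : ℕ))
    simpa using this
  have h2 : (X : ℚ[X][X]) ^ α.degree ∣ ∏ h : Fin n, kronInc n N h ^ α h := by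
    rw [Finsupp.degree_eq_sum, ← prod_pow_eq_pow_sum]
    exact prod_dvd_prod_of_dvd _ _ fun h _ => pow_dvd_pow_of_dvd (h1 h) _
  obtain ⟨z, hz⟩ := h2
  rw [hz, coeff_X_pow_mul', if_neg (by omega)]

/-- Generalised Wronskians detect linear independence. -/
theorem exists_mvHasse_det_ne_zero {s : ℕ} (F : Fin s → MvPolynomial (Fin n) ℚ)
    (hF : LinearIndependent ℚ F) :
    ∃ α : Fin s → (Fin n →₀ ℕ), (∀ i, (α i).degree ≤ i) ∧
      (Matrix.of fun i l => mvHasse (α i) (F l)).det ≠ 0 := by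
  classical
  set N : ℕ := 1 + ∑ l, (F l).totalDegree with hN
  have hbd : ∀ l, ∀ a ∈ (F l).support, ∀ h, a h < N := by
    intro l a ha h
    have h1 : a h ≤ (F l).totalDegree :=
      (Finsupp.le_degree h a).trans (MvPolynomial.le_totalDegree ha)
    have h2 : (F l).totalDegree ≤ ∑ l, (F l).totalDegree :=
      single_le_sum (f := fun l => (F l).totalDegree) (fun _ _ => Nat.zero_le _) (mem_univ l)
    omega
  have hind : LinearIndependent ℚ fun l => kron n N (F l) := by
    rw [Fintype.linearIndependent_iff] at hF ⊢
    intro c hc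
    refine hF c (kron_injOn _ ?_ ?_ (N := N))
    · intro a ha h
      obtain ⟨l, -, hl⟩ := mem_biUnion.1 (MvPolynomial.support_sum ha)
      exact hbd l a (MvPolynomial.support_smul hl) h
    · simpa using hc
  have hW := wronskMat_det_ne_zero _ hind
  set S : Finset (Fin n →₀ ℕ) := univ.biUnion fun l => (mvTaylor (F l)).support with hSdef
  set c : ℕ → (Fin n →₀ ℕ) → Polynomial ℚ := fun i α =>
    (∏ h : Fin n, kronInc n N h ^ α h).coeff i with hc
  have hrow : wronskMat (fun l => kron n N (F l)) = Matrix.of fun i : Fin s =>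
      ∑ α ∈ S, c i α • fun l => kron n N (mvHasse α (F l)) := by
    ext1 i l
    simp only [wronskMat, Matrix.of_apply, Finset.sum_apply, Pi.smul_apply, smul_eq_mul]
    exact hasseDeriv_kron N (F l) S (subset_biUnion_of_mem (fun l => (mvTaylor (F l)).support)
      (mem_univ l)) i
  have hexp : (wronskMat fun l => kron n N (F l)).det = ∑ r ∈ Fintype.piFinset fun _ : Fin s => S,
      (∏ i : Fin s, c i (r i)) * (Matrix.of fun i l => kron n N (mvHasse (r i) (F l))).det := by
    rw [hrow]
    refine ((Matrix.detRowAlternating (R := Polynomial ℚ)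
      (n := Fin s)).toMultilinearMap.map_sum_finset _ _).trans ?_
    refine sum_congr rfl fun r _ => ?_
    exact (Matrix.detRowAlternating (R := Polynomial ℚ)
      (n := Fin s)).toMultilinearMap.map_smul_univ _ _
  rw [hexp] at hW
  obtain ⟨r, -, hr⟩ := exists_ne_zero_of_sum_ne_zero hW
  refine ⟨r, fun i => ?_, fun h0 => ?_⟩
  · by_contra hlt
    exact prod_ne_zero_iff.1 (left_ne_zero_of_mul hr) i (mem_univ i)
      (coeff_prod_eq_zero_of_lt N (r i) i (not_le.1 hlt))
  · refine right_ne_zero_of_mul hr ?_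
    have := congrArg (kron n N) h0
    rw [map_zero, AlgHom.map_det] at this
    exact this
end Wronskian

/-- The absolute value on `ℤ` as a ring seminorm. -/
def intAbs : RingSeminorm ℤ where
  toFun x := |(x : ℝ)|
  map_zero' := by simp
  add_le' x y := by push_cast; exact abs_add_le _ _
  neg' x := by simp
  mul_le' x y := by push_cast; exact (abs_mul _ _).le

lemma intAbs_apply (x : ℤ) : intAbs x = |(x : ℝ)| := rfl

open Classical in
/-- The trivial absolute value on `ℚ` as a ring seminorm. -/
noncomputable def trivAbs : RingSeminorm ℚ where
  toFun x := if x = 0 then 0 else 1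
  map_zero' := by simp
  add_le' x y := by
    by_cases hx : x = 0
    · simp [hx]
    · rw [if_neg hx]
      split_ifs <;> norm_num
  neg' x := by simp
  mul_le' x y := by
    by_cases hx : x = 0
    · simp [hx]
    · by_cases hy : y = 0 <;> simp [hx, hy]

lemma trivAbs_of_ne_zero {x : ℚ} (hx : x ≠ 0) : trivAbs x = 1 := if_neg hx

lemma trivAbs_le_one (x : ℚ) : trivAbs x ≤ 1 := by
  by_cases hx : x = 0
  · simp [hx]
  · exact (trivAbs_of_ne_zero hx).le

/-- The `ℓ¹` norm of an integer polynomial. -/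
noncomputable def lone {σ : Type*} (P : MvPolynomial σ ℤ) : ℝ :=
  mvNorm intAbs (fun _ => 1) (fun _ => zero_le_one) P

lemma expWt_one {σ : Type*} (a : σ →₀ ℕ) : expWt (fun _ => (1 : ℝ)) a = 1 := by simp [expWt]

lemma abs_coeff_le_lone {σ : Type*} (P : MvPolynomial σ ℤ) (a : σ →₀ ℕ) :
    |((P.coeff a : ℤ) : ℝ)| ≤ lone P := by
  have := coeff_le_mvNorm intAbs (fun _ : σ => (1 : ℝ)) (fun _ => zero_le_one) P a
  rwa [expWt_one, mul_one] at this

lemma one_le_lone {σ : Type*} (P : MvPolynomial σ ℤ) (hP : P ≠ 0) : 1 ≤ lone P := by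
  obtain ⟨a, ha⟩ := MvPolynomial.ne_zero_iff.1 hP
  refine le_trans ?_ (abs_coeff_le_lone P a)
  exact_mod_cast Int.one_le_abs ha

section split
variable {n : ℕ} {B : Type*} [CommRing B]

lemma coeff_rename_succ_mul_aeval (G : MvPolynomial (Fin n) B) (q : Polynomial B)
    (b : ℕ) (a : Fin n →₀ ℕ) :
    (MvPolynomial.rename Fin.succ G *
      Polynomial.aeval (MvPolynomial.X 0 : MvPolynomial (Fin (n + 1)) B) q).coeff (a.cons b) =
      G.coeff a * q.coeff b := by
  have h1 : MvPolynomial.finSuccEquiv B n (MvPolynomial.rename Fin.succ G) =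
      Polynomial.C G := by
    have : ((MvPolynomial.finSuccEquiv B n).toAlgHom.comp
        (MvPolynomial.rename Fin.succ)).toRingHom =
        (Polynomial.C : MvPolynomial (Fin n) B →+* _) := by
      refine MvPolynomial.ringHom_ext (fun r => ?_) fun i => ?_
      · simp
      · simp [MvPolynomial.finSuccEquiv_X_succ]
    exact congrArg (fun φ => φ G) this
  have h2 : MvPolynomial.finSuccEquiv B n
      (Polynomial.aeval (MvPolynomial.X 0 : MvPolynomial (Fin (n + 1)) B) q) =
      q.map MvPolynomial.C := by
    have : (MvPolynomial.finSuccEquiv B n).toAlgHom.comp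
        (Polynomial.aeval (MvPolynomial.X 0 : MvPolynomial (Fin (n + 1)) B)) =
        Polynomial.mapAlgHom (Algebra.ofId B (MvPolynomial (Fin n) B)) := by
      refine Polynomial.algHom_ext ?_
      simp [MvPolynomial.finSuccEquiv_X_zero]
    exact congrArg (fun φ => φ q) this
  rw [← MvPolynomial.finSuccEquiv_coeff_coeff, map_mul, h1, h2, Polynomial.coeff_C_mul,
    Polynomial.coeff_map, mul_comm, MvPolynomial.coeff_C_mul, mul_comm]

end split

lemma den_pow_le_abs_leadingCoeff (V : Polynomial ℤ) (hV : V ≠ 0) (ξ : ℚ) :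
    ∃ b, (Polynomial.taylor ξ (V.map (Int.castRingHom ℚ))).coeff b ≠ 0 ∧
      (ξ.den : ℤ) ^ b ≤ |V.leadingCoeff| := by
  set Vq := V.map (Int.castRingHom ℚ) with hVq
  have hVq0 : Vq ≠ 0 := (Polynomial.map_ne_zero_iff Int.cast_injective).2 hV
  refine ⟨(Polynomial.taylor ξ Vq).natTrailingDegree, ?_, ?_⟩
  · have : (Polynomial.taylor ξ Vq).trailingCoeff ≠ 0 := by
      rw [Ne, Polynomial.trailingCoeff_eq_zero, Polynomial.taylor_eq_zero]
      exact hVq0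
    exact this
  · set b := (Polynomial.taylor ξ Vq).natTrailingDegree with hb
    have h1 : (Polynomial.X - Polynomial.C ξ) ^ b ∣ Vq := by
      have := Polynomial.rootMultiplicity_eq_natTrailingDegree (p := Vq) (t := ξ)
      rw [← Polynomial.taylor_apply, ← hb] at this
      rw [← this]
      exact Polynomial.pow_rootMultiplicity_dvd _ _
    set L : Polynomial ℤ := Polynomial.C (ξ.den : ℤ) * Polynomial.X - Polynomial.C ξ.num with hL
    have hden : (ξ.den : ℤ) ≠ 0 := by exact_mod_cast ξ.den_nz
    have hLprim : L.IsPrimitive := by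
      rw [Polynomial.isPrimitive_iff_isUnit_of_C_dvd]
      intro r hr
      rw [Polynomial.C_dvd_iff_dvd_coeff] at hr
      have h0 := hr 0
      have h1 := hr 1
      simp only [hL, Polynomial.coeff_sub, Polynomial.coeff_C_mul, Polynomial.coeff_X_one,
        Polynomial.coeff_X_zero, Polynomial.coeff_C_zero, mul_zero, zero_sub, dvd_neg, mul_one,
        Polynomial.coeff_C_succ, sub_zero] at h0 h1
      exact (Rat.isCoprime_num_den ξ).isUnit_of_dvd' h0 h1
    have hLlead : L.leadingCoeff = ξ.den := by
      have hdeg : L.natDegree = 1 := by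
        rw [hL, sub_eq_add_neg, ← Polynomial.C_neg]
        exact Polynomial.natDegree_linear hden
      rw [Polynomial.leadingCoeff, hdeg]
      simp only [hL, Polynomial.coeff_sub, Polynomial.coeff_C_mul, Polynomial.coeff_X_one,
        mul_one, Polynomial.coeff_C_succ, sub_zero]
    have hLb : (L ^ b).IsPrimitive := by
      clear_value b
      clear hb h1
      induction b with
      | zero => simp
      | succ b ih => rw [pow_succ]; exact ih.mul hLprim
    have hdvd : L ^ b ∣ V := by
      rw [Polynomial.IsPrimitive.Int.dvd_iff_map_cast_dvd_map_cast _ _ hLb]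
      have h2 : (L ^ b).map (Int.castRingHom ℚ) =
          Polynomial.C ((ξ.den : ℚ) ^ b) * (Polynomial.X - Polynomial.C ξ) ^ b := by
        rw [Polynomial.map_pow, Polynomial.C_pow, ← mul_pow]
        congr 1
        simp only [hL, Polynomial.map_sub, Polynomial.map_mul, Polynomial.map_C, Polynomial.map_X,
          mul_sub, ← Polynomial.C_mul]
        congr 2
        have := Rat.mul_den_eq_num ξ
        simp only [eq_intCast]
        rw [← this, mul_comm]
      have hu : IsUnit (Polynomial.C ((ξ.den : ℚ) ^ b)) := by
        rw [Polynomial.isUnit_C]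
        exact (isUnit_iff_ne_zero.2 (pow_ne_zero _ (by exact_mod_cast ξ.den_nz)))
      rw [h2, hu.mul_left_dvd]
      exact h1
    have h4 : (ξ.den : ℤ) ^ b ∣ V.leadingCoeff := by
      have h5 := Polynomial.leadingCoeff_dvd_leadingCoeff hdvd
      rwa [Polynomial.leadingCoeff_pow, hLlead] at h5
    exact Int.le_of_dvd (abs_pos.2 (by simpa using hV)) ((dvd_abs _ _).2 h4)

lemma mvHasse_rename_succ_mul_aeval {n : ℕ} (F : MvPolynomial (Fin n) ℚ) (g : Polynomial ℚ)
    (j : ℕ) (α : Fin n →₀ ℕ) :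
    mvHasse (α.cons j) (MvPolynomial.rename Fin.succ F *
      Polynomial.aeval (MvPolynomial.X 0 : MvPolynomial (Fin (n + 1)) ℚ) g) =
    MvPolynomial.rename Fin.succ (mvHasse α F) *
      Polynomial.aeval (MvPolynomial.X 0 : MvPolynomial (Fin (n + 1)) ℚ)
        (Polynomial.hasseDeriv j g) := by
  have h1 : mvTaylor (MvPolynomial.rename Fin.succ F : MvPolynomial (Fin (n + 1)) ℚ) =
      MvPolynomial.rename Fin.succ (MvPolynomial.map
        (MvPolynomial.rename (R := ℚ) (Fin.succ : Fin n → Fin (n + 1))).toRingHom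
          (mvTaylor F)) := by
    have : (mvTaylor (σ := Fin (n + 1)) (R := ℚ)).toRingHom.comp
        (MvPolynomial.rename (Fin.succ : Fin n → Fin (n + 1))).toRingHom =
        ((MvPolynomial.rename (R := MvPolynomial (Fin (n + 1)) ℚ)
          (Fin.succ : Fin n → Fin (n + 1))).toRingHom.comp (MvPolynomial.map
        (MvPolynomial.rename (R := ℚ) (Fin.succ : Fin n → Fin (n + 1))).toRingHom)).comp
          (mvTaylor (σ := Fin n) (R := ℚ)).toRingHom := by
      refine MvPolynomial.ringHom_ext (fun r => ?_) fun i => ?_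
      · simp [mvTaylor, IsScalarTower.algebraMap_apply ℚ (MvPolynomial (Fin n) ℚ)
          (MvPolynomial (Fin n) (MvPolynomial (Fin n) ℚ)),
          IsScalarTower.algebraMap_apply ℚ (MvPolynomial (Fin (n + 1)) ℚ)
          (MvPolynomial (Fin (n + 1)) (MvPolynomial (Fin (n + 1)) ℚ)),
          MvPolynomial.algebraMap_eq]
      · simp [mvTaylor]
    exact congrArg (fun φ => φ F) this
  have h2 : mvTaylor (Polynomial.aeval (MvPolynomial.X 0 : MvPolynomial (Fin (n + 1)) ℚ) g) =
      Polynomial.aeval (MvPolynomial.X 0 :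
        MvPolynomial (Fin (n + 1)) (MvPolynomial (Fin (n + 1)) ℚ))
        (Polynomial.taylor (MvPolynomial.X 0 : MvPolynomial (Fin (n + 1)) ℚ)
          (g.map MvPolynomial.C)) := by
    have : (mvTaylor (σ := Fin (n + 1)) (R := ℚ)).toRingHom.comp
        (Polynomial.aeval (R := ℚ) (MvPolynomial.X 0 : MvPolynomial (Fin (n + 1)) ℚ)).toRingHom =
        ((Polynomial.aeval (R := MvPolynomial (Fin (n + 1)) ℚ) (MvPolynomial.X 0 :
        MvPolynomial (Fin (n + 1)) (MvPolynomial (Fin (n + 1)) ℚ))).toRingHom.comp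
          (Polynomial.taylorAlgHom
            (MvPolynomial.X 0 : MvPolynomial (Fin (n + 1)) ℚ)).toRingHom).comp
          (Polynomial.mapRingHom MvPolynomial.C) := by
      refine Polynomial.ringHom_ext (fun r => ?_) ?_
      · simp [IsScalarTower.algebraMap_apply ℚ (MvPolynomial (Fin (n + 1)) ℚ)
          (MvPolynomial (Fin (n + 1)) (MvPolynomial (Fin (n + 1)) ℚ)),
          MvPolynomial.algebraMap_eq, mvTaylor]
      · simp [mvTaylor, MvPolynomial.algebraMap_eq, add_comm]
    simpa using congrArg (fun φ => φ g) this
  rw [mvHasse_apply, map_mul, h1, h2, coeff_rename_succ_mul_aeval, Polynomial.taylor_coeff,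
    MvPolynomial.coeff_map]
  congr 1
  have : Polynomial.hasseDeriv j (g.map (MvPolynomial.C : ℚ →+* MvPolynomial (Fin (n + 1)) ℚ)) =
      (Polynomial.hasseDeriv j g).map MvPolynomial.C := by
    ext1 k
    simp [Polynomial.hasseDeriv_coeff]
  rw [this, Polynomial.eval_map, Polynomial.aeval_def, MvPolynomial.algebraMap_eq]

lemma exists_split_decomposition {n : ℕ} (P : MvPolynomial (Fin (n + 1)) ℚ) (hP : P ≠ 0) (r : ℕ)
    (hr : ∀ a ∈ P.support, a 0 ≤ r) :
    ∃ (s : ℕ) (F : Fin s → MvPolynomial (Fin n) ℚ) (g : Fin s → Polynomial ℚ),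
      0 < s ∧ s ≤ r + 1 ∧ LinearIndependent ℚ F ∧ LinearIndependent ℚ g ∧
      P = ∑ l, MvPolynomial.rename Fin.succ (F l) *
        Polynomial.aeval (MvPolynomial.X 0 : MvPolynomial (Fin (n + 1)) ℚ) (g l) := by
  classical
  set f : Fin (r + 1) → MvPolynomial (Fin n) ℚ :=
    fun k => (MvPolynomial.finSuccEquiv ℚ n P).coeff k with hf
  set V : Submodule ℚ (MvPolynomial (Fin n) ℚ) := Submodule.span ℚ (Set.range f) with hV
  have : FiniteDimensional ℚ V := FiniteDimensional.span_of_finite ℚ (Set.finite_range f)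
  have hfV : ∀ k, f k ∈ V := fun k => Submodule.subset_span ⟨k, rfl⟩
  set b := Module.finBasis ℚ V with hb
  set F : Fin (Module.finrank ℚ V) → MvPolynomial (Fin n) ℚ := fun l => (b l : _) with hF
  set g : Fin (Module.finrank ℚ V) → Polynomial ℚ :=
    fun l => ∑ k : Fin (r + 1), Polynomial.monomial (k : ℕ) (b.repr ⟨f k, hfV k⟩ l) with hg
  have hgc : ∀ l (k : Fin (r + 1)), (g l).coeff k = b.repr ⟨f k, hfV k⟩ l := by
    intro l k
    simp only [hg, Polynomial.finsetSum_coeff, Polynomial.coeff_monomial]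
    rw [Finset.sum_eq_single_of_mem k (mem_univ k), if_pos rfl]
    intro k' _ hk'
    exact if_neg fun h => hk' (Fin.ext h)
  have hgc0 : ∀ l (k : ℕ), r < k → (g l).coeff k = 0 := by
    intro l k hk
    simp only [hg, Polynomial.finsetSum_coeff, Polynomial.coeff_monomial]
    refine sum_eq_zero fun k' _ => if_neg ?_
    have := k'.2
    omega
  have hfF : ∀ k, f k = ∑ l, b.repr ⟨f k, hfV k⟩ l • F l := by
    intro k
    have := congrArg Subtype.val (b.sum_repr ⟨f k, hfV k⟩)
    rw [AddSubmonoidClass.coe_finsetSum] at this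
    exact this.symm
  have hdecomp : P = ∑ l, MvPolynomial.rename Fin.succ (F l) *
        Polynomial.aeval (MvPolynomial.X 0 : MvPolynomial (Fin (n + 1)) ℚ) (g l) := by
    ext1 c
    obtain ⟨k, a, rfl⟩ : ∃ k a, c = Finsupp.cons k a := ⟨c 0, c.tail, (Finsupp.cons_tail c).symm⟩
    simp only [MvPolynomial.coeff_sum, coeff_rename_succ_mul_aeval]
    rcases lt_or_ge r k with hk | hk
    · simp only [hgc0 _ k hk, mul_zero, sum_const_zero]
      refine MvPolynomial.notMem_support_iff.1 fun h => ?_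
      have := hr _ h
      simp only [Finsupp.cons_zero] at this
      omega
    · rw [← MvPolynomial.finSuccEquiv_coeff_coeff]
      have := hfF ⟨k, Nat.lt_succ_of_le hk⟩
      simp only [hf] at this
      rw [this, MvPolynomial.coeff_sum]
      refine sum_congr rfl fun l _ => ?_
      have := hgc l ⟨k, Nat.lt_succ_of_le hk⟩
      simp only at this
      rw [this, MvPolynomial.coeff_smul, smul_eq_mul, mul_comm]
  refine ⟨Module.finrank ℚ V, F, g, ?_, ?_, ?_, ?_, hdecomp⟩
  · rw [Nat.pos_iff_ne_zero]
    intro h0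
    refine hP (hdecomp.trans ?_)
    have : IsEmpty (Fin (Module.finrank ℚ V)) := by rw [h0]; infer_instance
    simp
  · have := finrank_range_le_card (R := ℚ) f
    rw [Fintype.card_fin] at this
    exact this
  · exact b.linearIndependent.map' V.subtype (Submodule.ker_subtype V)
  · rw [Fintype.linearIndependent_iff]
    intro c hc
    have h1 : ∀ k : Fin (r + 1), ∑ l, c l * b.repr ⟨f k, hfV k⟩ l = 0 := by
      intro k
      have := congrArg (fun p => p.coeff (k : ℕ)) hc
      simpa [Polynomial.finsetSum_coeff, hgc] using this
    set φ : V →ₗ[ℚ] ℚ := b.constr ℚ c with hφ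
    have h2 : ∀ v : V, φ v = ∑ l, c l * b.repr v l := by
      intro v
      rw [hφ, Module.Basis.constr_apply_fintype]
      exact sum_congr rfl fun l _ => by simp [mul_comm]
    have h3 : ∀ v (hv : v ∈ V), φ ⟨v, hv⟩ = 0 := by
      intro v hv
      induction hv using Submodule.span_induction with
      | mem x hx =>
        obtain ⟨k, rfl⟩ := hx
        rw [h2]; exact h1 k
      | zero => exact map_zero φ
      | add x y hx hy ihx ihy =>
        have : (⟨x + y, Submodule.add_mem _ hx hy⟩ : V) = ⟨x, hx⟩ + ⟨y, hy⟩ := rfl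
        rw [this, map_add, ihx, ihy, add_zero]
      | smul t x hx ih =>
        have : (⟨t • x, Submodule.smul_mem _ t hx⟩ : V) = t • ⟨x, hx⟩ := rfl
        rw [this, map_smul, ih, smul_zero]
    intro l
    have h4 := h3 (b l : _) (b l).2
    have h5 : φ (b l) = c l := by rw [hφ, Module.Basis.constr_basis]
    rw [← h5]; exact h4

noncomputable def hasseMat {n s : ℕ} (α : Fin s → (Fin n →₀ ℕ))
    (P : MvPolynomial (Fin (n + 1)) ℤ) : Matrix (Fin s) (Fin s) (MvPolynomial (Fin (n + 1)) ℤ) :=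
  Matrix.of fun i j => mvHasse ((α i).cons (j : ℕ)) P

lemma exists_hasseMat_factor {n : ℕ} (P : MvPolynomial (Fin (n + 1)) ℤ) (hP : P ≠ 0) (r : ℕ)
    (hr : ∀ a ∈ P.support, a 0 ≤ r) :
    ∃ (s : ℕ) (α : Fin s → (Fin n →₀ ℕ)) (U : MvPolynomial (Fin n) ℚ) (V : Polynomial ℚ),
      0 < s ∧ s ≤ r + 1 ∧ (∀ i, (α i).degree ≤ i) ∧ U ≠ 0 ∧ V ≠ 0 ∧
      MvPolynomial.map (Int.castRingHom ℚ) (hasseMat α P).det =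
        MvPolynomial.rename Fin.succ U *
          Polynomial.aeval (MvPolynomial.X 0 : MvPolynomial (Fin (n + 1)) ℚ) V := by
  have hinj : Function.Injective (MvPolynomial.map (σ := Fin (n + 1)) (Int.castRingHom ℚ)) :=
    MvPolynomial.map_injective _ Int.cast_injective
  obtain ⟨s, F, g, hs, hsr, hF, hg, hPQ⟩ := exists_split_decomposition
    (MvPolynomial.map (Int.castRingHom ℚ) P) ((map_ne_zero_iff _ hinj).2 hP) r
    fun a ha => hr a (MvPolynomial.support_map_subset _ _ ha)
  obtain ⟨α, hα, hdet⟩ := exists_mvHasse_det_ne_zero F hF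
  refine ⟨s, α, _, _, hs, hsr, hα, hdet, wronskMat_det_ne_zero g hg, ?_⟩
  have h1 : (hasseMat α P).map (MvPolynomial.map (Int.castRingHom ℚ)) =
      ((Matrix.of fun i l => mvHasse (α i) (F l)).map
        (MvPolynomial.rename (R := ℚ) (Fin.succ : Fin n → Fin (n + 1)))) *
      ((wronskMat g).map
        (Polynomial.aeval (MvPolynomial.X 0 : MvPolynomial (Fin (n + 1)) ℚ))).transpose := by
    ext1 i j
    rw [Matrix.map_apply, hasseMat, Matrix.of_apply, map_mvHasse, hPQ, map_sum, Matrix.mul_apply]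
    refine sum_congr rfl fun l _ => ?_
    rw [mvHasse_rename_succ_mul_aeval]
    rfl
  rw [RingHom.map_det, RingHom.mapMatrix_apply, h1, Matrix.det_mul, Matrix.det_transpose]
  congr 1
  · exact (AlgHom.map_det _ _).symm
  · exact (AlgHom.map_det _ _).symm

lemma degreeOf_hasseMat_det_le {n s : ℕ} (α : Fin s → (Fin n →₀ ℕ))
    (P : MvPolynomial (Fin (n + 1)) ℤ) (r : Fin (n + 1) → ℕ)
    (hr : ∀ a ∈ P.support, ∀ i, a i ≤ r i) (i : Fin (n + 1)) :
    (hasseMat α P).det.degreeOf i ≤ s * r i := by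
  rw [Matrix.det_apply]
  refine (MvPolynomial.degreeOf_sum_le _ _ _).trans (Finset.sup_le fun τ _ => ?_)
  have h1 : ∀ f : MvPolynomial (Fin (n + 1)) ℤ,
      (Equiv.Perm.sign τ • f).degreeOf i = f.degreeOf i := by
    intro f
    rcases Int.units_eq_one_or (Equiv.Perm.sign τ) with h | h <;> rw [h]
    · simp
    · rw [Units.neg_smul, one_smul, MvPolynomial.degreeOf_neg]
  rw [h1]
  refine (MvPolynomial.degreeOf_prod_le _ _ _).trans ?_
  refine (Finset.sum_le_card_nsmul _ _ (r i) fun j _ => ?_).trans (by simp)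
  rw [MvPolynomial.degreeOf_le_iff]
  intro b hb
  obtain ⟨a, ha, hba⟩ := exists_le_of_mem_support_mvHasse _ _ _ hb
  exact (hba i).trans (hr a ha i)

lemma lone_hasseMat_det_le {n s : ℕ} (α : Fin s → (Fin n →₀ ℕ))
    (P : MvPolynomial (Fin (n + 1)) ℤ) (r : Fin (n + 1) → ℕ)
    (hr : ∀ a ∈ P.support, ∀ i, a i ≤ r i) :
    lone (hasseMat α P).det ≤ s.factorial * (2 ^ (∑ i, r i) * lone P) ^ s := by
  have h1 : intAbs 1 ≤ 1 := by simp [intAbs_apply]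
  refine (RingSeminorm.det_le (mvNorm intAbs (fun _ => 1) fun _ => zero_le_one)
    (by rw [mvNorm_one]; exact h1) _ (fun _ => 2 ^ (∑ i, r i) * lone P) fun i j => ?_).trans
    (by simp)
  have := mvNorm_mvHasse_le intAbs h1 (fun _ => 1) (fun _ => zero_le_one) ((α i).cons (j : ℕ)) P
    (∑ i, r i) fun a ha => by
      rw [Finsupp.degree_eq_sum]
      exact sum_le_sum fun i _ => hr a ha i
  rw [expWt_one, mul_one] at this
  exact this

lemma mvNorm_trivAbs_le_card {n : ℕ} (ω : Fin n → ℝ) (hω : ∀ i, 0 ≤ ω i)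
    (f : MvPolynomial (Fin n) ℚ) (B : ℝ) (hf : ∀ a ∈ f.support, expWt ω a ≤ B) :
    mvNorm trivAbs ω hω f ≤ f.support.card * B := by
  rw [mvNorm_apply, ← nsmul_eq_mul]
  refine Finset.sum_le_card_nsmul _ _ _ fun a ha => ?_
  rw [trivAbs_of_ne_zero (MvPolynomial.mem_support_iff.1 ha), one_mul]
  exact hf a ha

lemma expWt_exp {n : ℕ} (N : ℝ) (r : Fin n → ℕ) (a : Fin n →₀ ℕ) :
    expWt (fun i => Real.exp (-N / r i)) a = Real.exp (-N * ∑ i, (a i : ℝ) / r i) := by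
  rw [expWt_eq_prod, mul_sum, Real.exp_sum]
  refine prod_congr rfl fun i _ => ?_
  rw [← Real.exp_nat_mul]
  congr 1
  ring

/-- If every exponent in the support of `f` has weighted size at least `ε`, then the weighted norm
of a Hasse derivative of `f` decays at a rate governed by the order of the derivative. -/
lemma exists_mvNorm_mvHasse_exp_le {n : ℕ} (f : MvPolynomial (Fin n) ℚ) (r : Fin n → ℕ) (ε : ℝ)
    (hf : ∀ a ∈ f.support, ε ≤ ∑ i, (a i : ℝ) / r i) :
    ∃ C : ℝ, 1 ≤ C ∧ ∀ N : ℝ, 0 ≤ N → ∀ β : Fin n →₀ ℕ,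
      mvNorm trivAbs (fun i => Real.exp (-N / r i)) (fun _ => (Real.exp_pos _).le) (mvHasse β f) ≤
        C * Real.exp (-N * max 0 (ε - ∑ i, (β i : ℝ) / r i)) := by
  have h1 : trivAbs 1 ≤ 1 := trivAbs_le_one 1
  have key : ∀ N : ℝ, 0 ≤ N → ∀ β : Fin n →₀ ℕ,
      mvNorm trivAbs (fun i => Real.exp (-N / r i)) (fun _ => (Real.exp_pos _).le)
        (mvHasse β f) ≤ 2 ^ f.totalDegree * f.support.card *
          Real.exp (-N * (ε - ∑ i, (β i : ℝ) / r i)) := by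
    intro N hN β
    have h2 := mvNorm_mvHasse_le trivAbs h1 (fun i => Real.exp (-N / r i))
      (fun _ => (Real.exp_pos _).le) β f f.totalDegree fun a ha => by
        have := MvPolynomial.le_totalDegree ha
        rwa [Finsupp.degree_eq_sum, ← Finsupp.sum_fintype _ (fun _ x => x) fun _ => rfl]
    have h3 := mvNorm_trivAbs_le_card (fun i => Real.exp (-N / r i))
      (fun _ => (Real.exp_pos _).le) f (Real.exp (-N * ε)) fun a ha => by
        rw [expWt_exp]
        refine Real.exp_le_exp.2 ?_
        nlinarith [hf a ha]
    rw [expWt_exp] at h2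
    have h4 : Real.exp (-N * (ε - ∑ i, (β i : ℝ) / r i)) =
        Real.exp (-N * ε) / Real.exp (-N * ∑ i, (β i : ℝ) / r i) := by
      rw [← Real.exp_sub]; congr 1; ring
    rw [h4, ← mul_div_assoc, le_div_iff₀ (Real.exp_pos _)]
    refine h2.trans ?_
    rw [mul_assoc]
    gcongr
  refine ⟨max 1 (2 ^ f.totalDegree * f.support.card), le_max_left _ _, fun N hN β => ?_⟩
  rcases le_total 0 (ε - ∑ i, (β i : ℝ) / r i) with h | h
  · rw [max_eq_right h]
    exact (key N hN β).trans (by gcongr; exact le_max_right _ _)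
  · rw [max_eq_left h, mul_zero, Real.exp_zero, mul_one]
    have h5 := key 0 le_rfl β
    simp only [neg_zero, zero_div, zero_mul, Real.exp_zero, mul_one] at h5
    refine le_trans ?_ (h5.trans (le_max_right _ _))
    rw [mvNorm_apply, mvNorm_apply]
    refine sum_le_sum fun a _ => mul_le_mul_of_nonneg_left ?_ (apply_nonneg _ _)
    refine expWt_mono (fun _ => (Real.exp_pos _).le) (fun i => ?_) a
    rw [Real.exp_le_one_iff]
    exact div_nonpos_of_nonpos_of_nonneg (by linarith) (Nat.cast_nonneg _)

lemma le_of_forall_exp_le {C x y : ℝ}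
    (h : ∀ N : ℝ, 0 ≤ N → Real.exp (-N * y) ≤ C * Real.exp (-N * x)) : x ≤ y := by
  by_contra! hlt
  have hC : 0 < C := by
    have := h 0 le_rfl
    simp at this
    linarith
  have h1 := h (C / (x - y)) (div_nonneg hC.le (by linarith))
  have h2 : C * (x - y) / (x - y) + 1 ≤ Real.exp (C / (x - y) * (x - y)) := by
    rw [div_mul_eq_mul_div]; exact Real.add_one_le_exp _
  rw [mul_div_assoc, div_self (by linarith), mul_one] at h2
  have h3 : Real.exp (-(C / (x - y)) * y) = Real.exp (C / (x - y) * (x - y)) *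
      Real.exp (-(C / (x - y)) * x) := by
    rw [← Real.exp_add]; congr 1; ring
  rw [h3] at h1
  have := le_of_mul_le_mul_right h1 (Real.exp_pos _)
  linarith

lemma sum_max_sub_div_ge {s r : ℕ} (hr : 0 < r) (hsr : s ≤ r + 1) {ε : ℝ} (h0 : 0 < ε)
    (h1 : ε ≤ 1) :
    s * (ε ^ 2 / 32) ≤ ∑ j : Fin s, max 0 (ε / 2 - (j : ℕ) / r) := by
  have hr' : (0 : ℝ) < r := by exact_mod_cast hr
  have hs2 : (s : ℝ) ≤ 2 * r := by
    have : s ≤ 2 * r := by omega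
    exact_mod_cast this
  rw [Fin.sum_univ_eq_sum_range (fun j => max 0 (ε / 2 - (j : ℝ) / r))]
  set k := min s (⌊ε * r / 4⌋₊ + 1) with hk
  have hks : (s : ℝ) * (ε / 8) ≤ k := by
    rw [hk, Nat.cast_min, le_min_iff]
    constructor
    · have : (0 : ℝ) ≤ s := Nat.cast_nonneg _
      nlinarith
    · have := (Nat.lt_floor_add_one (ε * r / 4)).le
      push_cast
      nlinarith
  calc (s : ℝ) * (ε ^ 2 / 32) = (s * (ε / 8)) * (ε / 4) := by ring
    _ ≤ k * (ε / 4) := by gcongr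
    _ = ∑ j ∈ range k, ε / 4 := by simp
    _ ≤ ∑ j ∈ range k, max 0 (ε / 2 - (j : ℝ) / r) := by
      refine sum_le_sum fun j hj => le_max_of_le_right ?_
      have : j ≤ ⌊ε * r / 4⌋₊ := by
        have := mem_range.1 hj
        omega
      have h2 := (Nat.le_floor_iff (by positivity)).1 this
      have : (j : ℝ) / r ≤ ε / 4 := by
        rw [div_le_iff₀ hr']; linarith
      linarith
    _ ≤ _ := by
      refine sum_le_sum_of_subset_of_nonneg (range_subset_range.2 (min_le_left _ _)) ?_
      intro j _ _
      exact le_max_left _ _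

lemma sum_max_le_of_mem_support_mvShift_det {n s : ℕ} (P : MvPolynomial (Fin (n + 1)) ℤ)
    (ξ : Fin (n + 1) → ℚ) (r : Fin (n + 1) → ℕ) (hr0 : ∀ i, 0 < r i) {ε σ : ℝ}
    (hσ : ∀ i : Fin n, (r 0 : ℝ) ≤ σ * r i.succ) (hs : s ≤ r 0 + 1)
    (hf : ∀ a ∈ (mvShift (Int.castRingHom ℚ) ξ P).support, ε ≤ ∑ i, (a i : ℝ) / r i)
    (α : Fin s → (Fin n →₀ ℕ)) (hα : ∀ i, (α i).degree ≤ i) (hσ0 : 0 ≤ σ)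
    (c : Fin (n + 1) →₀ ℕ)
    (hc : c ∈ (mvShift (Int.castRingHom ℚ) ξ (hasseMat α P).det).support) :
    ∑ j : Fin s, max 0 (ε - σ - (j : ℕ) / r 0) ≤ ∑ i, (c i : ℝ) / r i := by
  obtain ⟨C, hC, hN⟩ := exists_mvNorm_mvHasse_exp_le _ r ε hf
  have hβ : ∀ i j : Fin s, ε - σ - (j : ℕ) / r 0 ≤
      ε - ∑ h, (((α i).cons (j : ℕ)) h : ℝ) / r h := by
    intro i j
    rw [Fin.sum_univ_succ]
    simp only [Finsupp.cons_zero, Finsupp.cons_succ]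
    have h1 : ∑ h : Fin n, ((α i) h : ℝ) / r h.succ ≤ ∑ h : Fin n, ((α i) h : ℝ) * (σ / r 0) := by
      refine sum_le_sum fun h _ => ?_
      rw [div_eq_mul_inv]
      refine mul_le_mul_of_nonneg_left ?_ (Nat.cast_nonneg _)
      have h2 : (0 : ℝ) < r 0 := by exact_mod_cast hr0 0
      have h3 : (0 : ℝ) < r h.succ := by exact_mod_cast hr0 h.succ
      rw [inv_le_iff_one_le_mul₀ h3, div_mul_eq_mul_div, one_le_div h2]
      exact hσ h
    have h4 : ∑ h : Fin n, ((α i) h : ℝ) ≤ r 0 := by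
      have h5 : ∑ h, (α i) h ≤ r 0 := by
        have := hα i
        rw [Finsupp.degree_eq_sum] at this
        have := i.2
        omega
      exact_mod_cast h5
    rw [← sum_mul] at h1
    have h2 : (0 : ℝ) < r 0 := by exact_mod_cast hr0 0
    have h6 : (∑ h : Fin n, ((α i) h : ℝ)) * (σ / r 0) ≤ r 0 * (σ / r 0) := by gcongr
    rw [mul_div_cancel₀ _ h2.ne'] at h6
    linarith
  refine le_of_forall_exp_le (C := s.factorial * C ^ s) fun N hN0 => ?_
  have hω : ∀ i, (0 : ℝ) ≤ Real.exp (-N / r i) := fun _ => (Real.exp_pos _).le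
  have h1 := coeff_le_mvNorm trivAbs (fun i => Real.exp (-N / r i)) hω
    (mvShift (Int.castRingHom ℚ) ξ (hasseMat α P).det) c
  rw [trivAbs_of_ne_zero (MvPolynomial.mem_support_iff.1 hc), one_mul, expWt_exp] at h1
  refine h1.trans ?_
  rw [RingHom.map_det]
  refine (RingSeminorm.det_le (mvNorm trivAbs _ hω) (by rw [mvNorm_one]; exact trivAbs_le_one 1)
    _ (fun j => C * Real.exp (-N * max 0 (ε - σ - (j : ℕ) / r 0))) fun i j => ?_).trans ?_
  · rw [RingHom.mapMatrix_apply, Matrix.map_apply, hasseMat, Matrix.of_apply, mvShift_mvHasse]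
    refine (hN N hN0 _).trans ?_
    refine mul_le_mul_of_nonneg_left (Real.exp_le_exp.2 ?_) (by linarith)
    have := max_le_max_left 0 (hβ i j)
    nlinarith
  · rw [prod_mul_distrib, ← Real.exp_sum, ← mul_sum]
    simp [mul_assoc]

lemma mvShift_split {n : ℕ} (ξ : Fin (n + 1) → ℚ) (U : MvPolynomial (Fin n) ℚ)
    (V : Polynomial ℚ) :
    mvShift (RingHom.id ℚ) ξ (MvPolynomial.rename Fin.succ U *
      Polynomial.aeval (MvPolynomial.X 0 : MvPolynomial (Fin (n + 1)) ℚ) V) =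
    MvPolynomial.rename Fin.succ (mvShift (RingHom.id ℚ) (fun i => ξ i.succ) U) *
      Polynomial.aeval (MvPolynomial.X 0 : MvPolynomial (Fin (n + 1)) ℚ)
        (Polynomial.taylor (ξ 0) V) := by
  rw [map_mul]
  congr 1
  · have : (mvShift (RingHom.id ℚ) ξ).comp
        (MvPolynomial.rename (R := ℚ) (Fin.succ : Fin n → Fin (n + 1))).toRingHom =
        (MvPolynomial.rename (R := ℚ) (Fin.succ : Fin n → Fin (n + 1))).toRingHom.comp
          (mvShift (RingHom.id ℚ) fun i => ξ i.succ) := by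
      refine MvPolynomial.ringHom_ext (fun r => ?_) fun i => ?_ <;> simp [mvShift]
    exact congrArg (fun φ => φ U) this
  · have : (mvShift (RingHom.id ℚ) ξ).comp
        (Polynomial.aeval (R := ℚ) (MvPolynomial.X 0 : MvPolynomial (Fin (n + 1)) ℚ)).toRingHom =
        (Polynomial.aeval (R := ℚ)
          (MvPolynomial.X 0 : MvPolynomial (Fin (n + 1)) ℚ)).toRingHom.comp
          (Polynomial.taylorAlgHom (ξ 0)).toRingHom := by
      refine Polynomial.ringHom_ext (fun r => ?_) ?_ <;>
        simp [mvShift, MvPolynomial.algebraMap_eq]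
    exact congrArg (fun φ => φ V) this

lemma mvShift_id_map {σ : Type*} (ξ : σ → ℚ) (P : MvPolynomial σ ℤ) :
    mvShift (RingHom.id ℚ) ξ (MvPolynomial.map (Int.castRingHom ℚ) P) =
      mvShift (Int.castRingHom ℚ) ξ P := by
  have : (mvShift (RingHom.id ℚ) ξ).comp (MvPolynomial.map (Int.castRingHom ℚ)) =
      mvShift (Int.castRingHom ℚ) ξ := by
    refine MvPolynomial.ringHom_ext (fun r => ?_) fun i => ?_ <;> simp [mvShift]
  exact congrArg (fun φ => φ P) this

/-- The coefficient of `X₀ ^ b` as a polynomial in the remaining variables. -/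
noncomputable def sliceHead {n : ℕ} (b : ℕ) (W : MvPolynomial (Fin (n + 1)) ℤ) :
    MvPolynomial (Fin n) ℤ := (MvPolynomial.finSuccEquiv ℤ n W).coeff b

lemma coeff_sliceHead {n : ℕ} (b : ℕ) (W : MvPolynomial (Fin (n + 1)) ℤ) (a : Fin n →₀ ℕ) :
    (sliceHead b W).coeff a = W.coeff (a.cons b) := MvPolynomial.finSuccEquiv_coeff_coeff _ _ _

lemma lone_le_of_coeff {σ τ : Type*} (P : MvPolynomial σ ℤ) (Q : MvPolynomial τ ℤ)
    (g : (σ →₀ ℕ) → (τ →₀ ℕ)) (hg : Function.Injective g)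
    (h : ∀ a ∈ P.support, P.coeff a = Q.coeff (g a)) : lone P ≤ lone Q := by
  classical
  unfold lone
  rw [mvNorm_apply, mvNorm_eq_sum intAbs (fun _ => 1) _ Q (Q.support ∪ P.support.image g)
    subset_union_left]
  simp only [expWt_one, mul_one]
  refine le_trans ?_ (sum_le_sum_of_subset_of_nonneg subset_union_right
    fun _ _ _ => apply_nonneg _ _)
  rw [sum_image hg.injOn]
  exact (sum_congr rfl fun a ha => by rw [h a ha]).le

lemma exists_sliceHead_index {n s : ℕ} (W : MvPolynomial (Fin (n + 1)) ℤ)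
    (U : MvPolynomial (Fin n) ℚ) (V : Polynomial ℚ) (hV : V ≠ 0) (hU : U ≠ 0)
    (hW : MvPolynomial.map (Int.castRingHom ℚ) W = MvPolynomial.rename Fin.succ U *
      Polynomial.aeval (MvPolynomial.X 0 : MvPolynomial (Fin (n + 1)) ℚ) V)
    (r : Fin (n + 1) → ℕ) (hd : ∀ c ∈ W.support, ∀ i, c i ≤ s * r i) :
    ∃ U' : MvPolynomial (Fin n) ℤ, U' ≠ 0 ∧ lone U' ≤ lone W ∧
      (∀ a ∈ U'.support, ∀ i, a i ≤ s * r i.succ) ∧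
      ∃ v : ℚ, v ≠ 0 ∧ MvPolynomial.map (Int.castRingHom ℚ) U' = MvPolynomial.C v * U := by
  obtain ⟨b, hb⟩ : ∃ b, V.coeff b ≠ 0 := by
    by_contra! h
    exact hV (Polynomial.ext fun i => by simpa using h i)
  have hmap : MvPolynomial.map (Int.castRingHom ℚ) (sliceHead b W) =
      MvPolynomial.C (V.coeff b) * U := by
    ext1 a
    rw [MvPolynomial.coeff_map, coeff_sliceHead, ← MvPolynomial.coeff_map, hW,
      coeff_rename_succ_mul_aeval, MvPolynomial.coeff_C_mul, mul_comm]
  refine ⟨sliceHead b W, ?_, ?_, ?_, _, hb, hmap⟩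
  · rintro h
    rw [h, map_zero] at hmap
    exact mul_ne_zero (by simpa using hb) hU hmap.symm
  · refine lone_le_of_coeff _ _ (fun a => a.cons b) (Finsupp.cons_right_injective b) fun a _ => ?_
    exact coeff_sliceHead _ _ _
  · intro a ha i
    rw [MvPolynomial.mem_support_iff, coeff_sliceHead, ← MvPolynomial.mem_support_iff] at ha
    simpa using hd _ ha i.succ

lemma exists_slice_order {n : ℕ} (W : MvPolynomial (Fin (n + 1)) ℤ)
    (U : MvPolynomial (Fin n) ℚ) (V : Polynomial ℚ) (hV : V ≠ 0) (hU : U ≠ 0)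
    (hW : MvPolynomial.map (Int.castRingHom ℚ) W = MvPolynomial.rename Fin.succ U *
      Polynomial.aeval (MvPolynomial.X 0 : MvPolynomial (Fin (n + 1)) ℚ) V) (ξ : ℚ) :
    ∃ b, (Polynomial.taylor ξ V).coeff b ≠ 0 ∧ (ξ.den : ℝ) ^ b ≤ lone W := by
  obtain ⟨a, ha⟩ := MvPolynomial.ne_zero_iff.1 hU
  set V' : Polynomial ℤ := ∑ k ∈ range (V.natDegree + 1), Polynomial.monomial k
    (W.coeff (a.cons k)) with hV'
  have hc : ∀ k, ((W.coeff (a.cons k) : ℤ) : ℚ) = U.coeff a * V.coeff k := by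
    intro k
    have := congrArg (fun p => MvPolynomial.coeff (a.cons k) p) hW
    simpa only [coeff_rename_succ_mul_aeval, MvPolynomial.coeff_map, eq_intCast] using this
  have hcoeff : ∀ k, V'.coeff k = W.coeff (a.cons k) := by
    intro k
    simp only [hV', Polynomial.finsetSum_coeff, Polynomial.coeff_monomial, sum_ite_eq', mem_range]
    split_ifs with h
    · rfl
    · have := hc k
      rw [Polynomial.coeff_eq_zero_of_natDegree_lt (by omega), mul_zero] at this
      exact_mod_cast this.symm
  have hmap : V'.map (Int.castRingHom ℚ) = Polynomial.C (U.coeff a) * V := by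
    ext1 k
    rw [Polynomial.coeff_map, hcoeff, Polynomial.coeff_C_mul, eq_intCast, hc]
  have hV0 : V' ≠ 0 := by
    rintro h
    rw [h, Polynomial.map_zero] at hmap
    exact mul_ne_zero (by simpa using ha) hV hmap.symm
  obtain ⟨b, hb, hle⟩ := den_pow_le_abs_leadingCoeff V' hV0 ξ
  refine ⟨b, ?_, ?_⟩
  · rw [hmap, Polynomial.taylor_mul, Polynomial.taylor_C, Polynomial.coeff_C_mul] at hb
    exact right_ne_zero_of_mul hb
  · have h2 := abs_coeff_le_lone W (a.cons V'.natDegree)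
    rw [← hcoeff, Polynomial.coeff_natDegree] at h2
    refine le_trans ?_ h2
    exact_mod_cast hle

/-- **Roth's lemma**: a nonzero integral polynomial of controlled size has small index at a point
whose coordinates are rationals with large denominators. -/
theorem roth_lemma (n : ℕ) : ∀ ε : ℝ, 0 < ε → ∃ σ : ℝ, 0 < σ ∧
    ∀ (r : Fin n → ℕ) (ξ : Fin n → ℚ) (R : ℝ) (P : MvPolynomial (Fin n) ℤ), P ≠ 0 →
      (∀ i, 0 < r i) → (∀ i j, i < j → (r i : ℝ) ≤ σ * r j) →
      (∀ i, R ≤ r i * Real.log (ξ i).den) → (∀ a ∈ P.support, ∀ i, a i ≤ r i) →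
      Real.log (lone P) + ∑ i, (r i : ℝ) ≤ σ * R →
      ∃ a ∈ (mvShift (Int.castRingHom ℚ) ξ P).support, ∑ i, (a i : ℝ) / r i < ε := by
  induction n with
  | zero =>
    intro ε hε
    refine ⟨1, one_pos, fun r ξ R P hP _ _ _ _ _ => ⟨0, ?_, by simpa using hε⟩⟩
    rw [MvPolynomial.mem_support_iff, MvPolynomial.eq_C_of_isEmpty P]
    simp only [mvShift, MvPolynomial.coe_eval₂Hom, MvPolynomial.eval₂_C, RingHom.comp_apply,
      MvPolynomial.coeff_C, if_true]
    intro h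
    apply hP
    rw [MvPolynomial.eq_C_of_isEmpty P]
    simp only [eq_intCast, Int.cast_eq_zero] at h
    rw [h, map_zero]
  | succ n ih =>
    intro ε₀ hε₀
    set ε := min ε₀ 1 with hεdef
    have hε : 0 < ε := lt_min hε₀ one_pos
    have hε1 : ε ≤ 1 := min_le_right _ _
    obtain ⟨σ', hσ', IH⟩ := ih (ε ^ 2 / 128) (by positivity)
    set σ := min (σ' / 3) (ε ^ 2 / 256) with hσdef
    have hσ : 0 < σ := lt_min (by positivity) (by positivity)
    have hσ1 : 3 * σ ≤ σ' := by
      have := min_le_left (σ' / 3) (ε ^ 2 / 256)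
      rw [← hσdef] at this
      linarith
    have hσ2 : σ ≤ ε ^ 2 / 256 := min_le_right _ _
    refine ⟨σ, hσ, fun r ξ R P hP hr hratio hR hdeg hlog => ?_⟩
    by_contra! hcon
    obtain ⟨s, α, U, V, hs, hsr, hα, hU, hV, hfac⟩ := exists_hasseMat_factor P hP (r 0)
      fun a ha => hdeg a ha 0
    set W := (hasseMat α P).det with hW
    have hs' : (0 : ℝ) < s := by exact_mod_cast hs
    have hr0 : (0 : ℝ) < r 0 := by exact_mod_cast hr 0
    have hP1 : 1 ≤ lone P := one_le_lone P hP
    have hP0 : 0 ≤ Real.log (lone P) := Real.log_nonneg hP1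
    have hr_sum : (r 0 : ℝ) ≤ ∑ i, (r i : ℝ) :=
      single_le_sum (f := fun i => (r i : ℝ)) (fun i _ => Nat.cast_nonneg _) (mem_univ 0)
    have hRpos : 0 < R := by
      by_contra! h
      nlinarith
    have hW0 : W ≠ 0 := by
      rintro h
      rw [h, map_zero] at hfac
      obtain ⟨a, ha⟩ := MvPolynomial.ne_zero_iff.1 hU
      obtain ⟨b, hb⟩ : ∃ b, V.coeff b ≠ 0 := by
        by_contra! h
        exact hV (Polynomial.ext fun i => by simpa using h i)
      have := congrArg (fun p => MvPolynomial.coeff (a.cons b) p) hfac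
      simp only [coeff_rename_succ_mul_aeval, MvPolynomial.coeff_zero] at this
      exact mul_ne_zero ha hb this.symm
    have hWlog : Real.log (lone W) ≤ 2 * s * (σ * R) := by
      have h1 := lone_hasseMat_det_le α P r hdeg
      rw [← hW] at h1
      have h2 : (s.factorial : ℝ) ≤ (s : ℝ) ^ s := by exact_mod_cast Nat.factorial_le_pow s
      have h3 : lone W ≤ (s * (2 ^ (∑ i, r i) * lone P)) ^ s := by
        rw [mul_pow]
        refine h1.trans ?_
        gcongr
      have h4 := Real.log_le_log (lt_of_lt_of_le one_pos (one_le_lone W hW0)) h3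
      rw [Real.log_pow, Real.log_mul hs'.ne' (by positivity), Real.log_mul (by positivity)
        (by positivity), Real.log_pow] at h4
      have h5 : Real.log s ≤ r 0 := by
        have := Real.log_le_sub_one_of_pos hs'
        have h6 : (s : ℝ) ≤ r 0 + 1 := by exact_mod_cast hsr
        linarith
      have h7 : ((∑ i, r i : ℕ) : ℝ) * Real.log 2 ≤ ∑ i, (r i : ℝ) := by
        push_cast
        have := Real.log_two_lt_d9
        have h8 : (0 : ℝ) ≤ ∑ i, (r i : ℝ) := sum_nonneg fun i _ => Nat.cast_nonneg _
        nlinarith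
      calc Real.log (lone W) ≤ _ := h4
        _ ≤ s * (2 * (σ * R)) := by
          refine mul_le_mul_of_nonneg_left ?_ hs'.le
          linarith
        _ = _ := by ring
    have hWdeg : ∀ c ∈ W.support, ∀ i, c i ≤ s * r i := by
      intro c hc i
      exact (MvPolynomial.degreeOf_le_iff.1 (degreeOf_hasseMat_det_le α P r hdeg i)) c hc
    obtain ⟨U', hU'0, hU'W, hU'd, v, hv, hvU⟩ := exists_sliceHead_index W U V hV hU hfac r hWdeg
    obtain ⟨a, ha, hasum⟩ := IH (fun i => s * r i.succ) (fun i => ξ i.succ) (s * R) U' hU'0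
      (fun i => Nat.mul_pos hs (hr _)) (fun i j hij => by
        have := hratio i.succ j.succ (Fin.succ_lt_succ_iff.2 hij)
        push_cast
        have h2 : (0 : ℝ) ≤ r j.succ := Nat.cast_nonneg _
        have h3 : σ ≤ σ' := by linarith
        calc (s : ℝ) * r i.succ ≤ s * (σ * r j.succ) := by gcongr
          _ ≤ s * (σ' * r j.succ) := by gcongr
          _ = _ := by ring) (fun i => by
        push_cast
        rw [mul_assoc]
        exact mul_le_mul_of_nonneg_left (hR i.succ) hs'.le) hU'd (by
        have h1 : Real.log (lone U') ≤ Real.log (lone W) :=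
          Real.log_le_log (lt_of_lt_of_le one_pos (one_le_lone U' hU'0)) hU'W
        have h2 : ∑ i : Fin n, ((s * r i.succ : ℕ) : ℝ) ≤ s * (σ * R) := by
          push_cast
          rw [← mul_sum]
          refine mul_le_mul_of_nonneg_left ?_ hs'.le
          rw [Fin.sum_univ_succ] at hlog
          linarith
        have h3 : 3 * s * (σ * R) ≤ σ' * (s * R) := by
          calc 3 * s * (σ * R) = (3 * σ) * (s * R) := by ring
            _ ≤ _ := by gcongr
        linarith)
    obtain ⟨b, hb, hbW⟩ := exists_slice_order W U V hV hU hfac (ξ 0)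
    have hb2 : (b : ℝ) / r 0 ≤ 2 * s * σ := by
      have h1 : (b : ℝ) * Real.log (ξ 0).den ≤ Real.log (lone W) := by
        rw [← Real.log_pow]
        exact Real.log_le_log (pow_pos (by exact_mod_cast (ξ 0).pos) _) hbW
      have h2 := hR 0
      have h3 : 0 < Real.log (ξ 0).den := by
        by_contra! h
        nlinarith
      rw [div_le_iff₀ hr0]
      refine le_of_mul_le_mul_right ?_ h3
      calc (b : ℝ) * Real.log (ξ 0).den ≤ 2 * s * (σ * R) := h1.trans hWlog
        _ ≤ 2 * s * (σ * (r 0 * Real.log (ξ 0).den)) := by gcongr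
        _ = _ := by ring
    have ha' : (mvShift (RingHom.id ℚ) (fun i => ξ i.succ) U).coeff a ≠ 0 := by
      rw [MvPolynomial.mem_support_iff, ← mvShift_id_map, hvU, map_mul] at ha
      have : mvShift (RingHom.id ℚ) (fun i : Fin n => ξ i.succ) (MvPolynomial.C v) =
          MvPolynomial.C v := by simp [mvShift]
      rw [this, MvPolynomial.coeff_C_mul] at ha
      exact right_ne_zero_of_mul ha
    have hc : a.cons b ∈ (mvShift (Int.castRingHom ℚ) ξ (hasseMat α P).det).support := by
      rw [MvPolynomial.mem_support_iff, ← hW, ← mvShift_id_map, hfac, mvShift_split,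
        coeff_rename_succ_mul_aeval]
      exact mul_ne_zero ha' hb
    have hfin := sum_max_le_of_mem_support_mvShift_det P ξ r hr
      (fun i => hratio 0 i.succ (Fin.succ_pos i)) hsr
      (fun a ha => (min_le_left ε₀ 1).trans (hcon a ha)) α hα hσ.le _ hc
    have h1 := sum_max_sub_div_ge (hr 0) hsr hε hε1
    have h2 : ∑ j : Fin s, max 0 (ε / 2 - (j : ℕ) / (r 0 : ℝ)) ≤
        ∑ j : Fin s, max 0 (ε - σ - (j : ℕ) / (r 0 : ℝ)) := by
      refine sum_le_sum fun j _ => max_le_max_left 0 ?_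
      have : ε ^ 2 ≤ ε := by nlinarith
      linarith
    rw [Fin.sum_univ_succ] at hfin
    simp only [Finsupp.cons_zero, Finsupp.cons_succ] at hfin
    have h3 : ∑ i : Fin n, (a i : ℝ) / r i.succ < s * (ε ^ 2 / 128) := by
      have h4 : ∑ i : Fin n, (a i : ℝ) / r i.succ =
          s * ∑ i : Fin n, (a i : ℝ) / ((s * r i.succ : ℕ) : ℝ) := by
        rw [mul_sum]
        refine sum_congr rfl fun i _ => ?_
        push_cast
        rw [← mul_div_assoc, mul_div_mul_left _ _ hs'.ne']
      rw [h4]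
      exact mul_lt_mul_of_pos_left hasum hs'
    have h5 : 2 * s * σ ≤ 2 * s * (ε ^ 2 / 256) := by gcongr
    have h6 : 0 < s * ε ^ 2 := by positivity
    linarith

/-- Exponent vectors of monomials of degree `r` in three variables. -/
noncomputable def simplexExp (r : ℕ) : Finset (Fin 3 → ℕ) := Finset.piAntidiag univ r

lemma mem_simplexExp {r : ℕ} {j : Fin 3 → ℕ} : j ∈ simplexExp r ↔ ∑ k, j k = r := by
  simp [simplexExp]

lemma sum_simplexExp_apply (r : ℕ) (k : Fin 3) :
    ∑ j ∈ simplexExp r, (j k : ℝ) = (r : ℝ) / 3 * (simplexExp r).card := by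
  have h1 : ∀ k : Fin 3, ∑ j ∈ simplexExp r, (j k : ℝ) = ∑ j ∈ simplexExp r, (j 0 : ℝ) := by
    intro k
    refine Finset.sum_equiv ((Equiv.swap 0 k).arrowCongr (Equiv.refl ℕ)) (fun j => ?_)
      fun j _ => ?_
    · rw [mem_simplexExp, mem_simplexExp]
      have : ∑ i, ((Equiv.swap 0 k).arrowCongr (Equiv.refl ℕ)) j i = ∑ i, j i := by
        simp only [Equiv.arrowCongr_apply, Equiv.coe_refl, Function.comp_apply, id]
        exact Equiv.sum_comp (Equiv.swap 0 k).symm j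
      rw [this]
    · simp [Equiv.arrowCongr_apply]
  have h2 : ∑ k, ∑ j ∈ simplexExp r, (j k : ℝ) = r * (simplexExp r).card := by
    rw [sum_comm]
    calc ∑ j ∈ simplexExp r, ∑ k, (j k : ℝ) = ∑ j ∈ simplexExp r, (r : ℝ) :=
          sum_congr rfl fun j hj => by exact_mod_cast mem_simplexExp.1 hj
      _ = _ := by rw [sum_const, nsmul_eq_mul, mul_comm]
  simp only [h1, sum_const, card_univ, Fintype.card_fin, nsmul_eq_mul] at h2
  rw [h1]
  push_cast at h2
  linarith

lemma card_simplexExp_pos (r : ℕ) : 0 < (simplexExp r).card := by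
  refine card_pos.2 ⟨Pi.single 0 r, ?_⟩
  rw [mem_simplexExp]
  simp

lemma card_simplexExp_le (r : ℕ) : (simplexExp r).card ≤ 8 ^ r := by
  have h : simplexExp r ⊆ Fintype.piFinset fun _ : Fin 3 => range (r + 1) := by
    intro j hj
    rw [mem_simplexExp] at hj
    rw [Fintype.mem_piFinset]
    intro k
    have := single_le_sum (f := j) (fun _ _ => Nat.zero_le _) (mem_univ k)
    rw [mem_range]
    omega
  refine (card_le_card h).trans ?_
  simp only [Fintype.card_piFinset, card_range, prod_const, card_univ, Fintype.card_fin]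
  calc (r + 1) ^ 3 ≤ (2 ^ r) ^ 3 := Nat.pow_le_pow_left Nat.lt_two_pow_self 3
    _ = 8 ^ r := by rw [← pow_mul, mul_comm, pow_mul]; norm_num

lemma exp_le_one_add_add_sq {x : ℝ} (hx : |x| ≤ 1) : Real.exp x ≤ 1 + x + x ^ 2 := by
  have := Real.abs_exp_sub_one_sub_id_le hx
  have := abs_le.1 this
  linarith

lemma abs_sum_div_le {r : ℕ} (hr : 0 < r) {e : Fin 3 → ℝ} {B : ℝ} (he : ∀ k, |e k| ≤ B)
    {j : Fin 3 → ℕ} (hj : ∑ k, j k = r) : |∑ k, e k * (j k / r)| ≤ B := by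
  have hr' : (0 : ℝ) < r := by exact_mod_cast hr
  calc |∑ k, e k * ((j k : ℝ) / r)| ≤ ∑ k, |e k * ((j k : ℝ) / r)| := abs_sum_le_sum_abs _ _
    _ ≤ ∑ k, B * ((j k : ℝ) / r) := by
      refine sum_le_sum fun k _ => ?_
      rw [abs_mul, abs_of_nonneg (a := (j k : ℝ) / r) (by positivity)]
      exact mul_le_mul_of_nonneg_right (he k) (by positivity)
    _ = B := by
      rw [← mul_sum, ← sum_div]
      have : ∑ k, (j k : ℝ) = r := by exact_mod_cast hj
      rw [this, div_self hr'.ne', mul_one]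

lemma sum_exp_simplexExp_le {r : ℕ} (hr : 0 < r) {e : Fin 3 → ℝ} {η t : ℝ}
    (he : ∀ k, |e k| ≤ 2) (hη : ∑ k, e k ≤ -η) (ht : 0 ≤ t) (ht2 : 2 * t ≤ 1) :
    ∑ j ∈ simplexExp r, Real.exp (t * ∑ k, e k * (j k / r)) ≤
      (simplexExp r).card * Real.exp (-t * η / 3 + 4 * t ^ 2) := by
  have hr' : (0 : ℝ) < r := by exact_mod_cast hr
  have h1 : ∀ j ∈ simplexExp r, Real.exp (t * ∑ k, e k * (j k / r)) ≤
      (1 + 4 * t ^ 2) + t * ∑ k, e k * (j k / r) := by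
    intro j hj
    have h2 := abs_sum_div_le hr he (mem_simplexExp.1 hj)
    have h3 : |t * ∑ k, e k * ((j k : ℝ) / r)| ≤ 2 * t := by
      rw [abs_mul, abs_of_nonneg ht]; nlinarith
    have h4 := exp_le_one_add_add_sq (h3.trans ht2)
    have h5 : (t * ∑ k, e k * ((j k : ℝ) / r)) ^ 2 ≤ (2 * t) ^ 2 := sq_le_sq' (by
      have := abs_le.1 h3; linarith) (by have := abs_le.1 h3; linarith)
    linarith
  refine (sum_le_sum h1).trans ?_
  rw [sum_add_distrib, sum_const, nsmul_eq_mul, ← mul_sum, sum_comm]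
  have h6 : ∑ k, ∑ j ∈ simplexExp r, e k * ((j k : ℝ) / r) =
      (∑ k, e k) / 3 * (simplexExp r).card := by
    rw [sum_div, sum_mul]
    refine sum_congr rfl fun k _ => ?_
    rw [← mul_sum, ← sum_div, sum_simplexExp_apply]
    field_simp
  rw [h6]
  have h7 : (0 : ℝ) < (simplexExp r).card := by exact_mod_cast card_simplexExp_pos r
  have h8 := Real.add_one_le_exp (-t * η / 3 + 4 * t ^ 2)
  have h9 : t * (∑ k, e k) ≤ t * (-η) := mul_le_mul_of_nonneg_left hη ht
  calc _ = (simplexExp r).card * (1 + 4 * t ^ 2 + t * (∑ k, e k) / 3) := by ring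
    _ ≤ (simplexExp r).card * (-t * η / 3 + 4 * t ^ 2 + 1) :=
      mul_le_mul_of_nonneg_left (by linarith) h7.le
    _ ≤ _ := by gcongr

/-- Exponents of block homogeneous monomials of multidegree `r`. -/
noncomputable def blockExp {m : ℕ} (r : Fin m → ℕ) : Finset (Fin m → Fin 3 → ℕ) :=
  Fintype.piFinset fun h => simplexExp (r h)

lemma mem_blockExp {m : ℕ} {r : Fin m → ℕ} {j : Fin m → Fin 3 → ℕ} :
    j ∈ blockExp r ↔ ∀ h, ∑ k, j h k = r h := by
  simp [blockExp, mem_simplexExp]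

lemma card_blockExp_le {m : ℕ} (r : Fin m → ℕ) : (blockExp r).card ≤ 8 ^ ∑ h, r h := by
  rw [blockExp, Fintype.card_piFinset, ← prod_pow_eq_pow_sum]
  exact prod_le_prod' fun h _ => card_simplexExp_le _

lemma card_blockExp_pos {m : ℕ} (r : Fin m → ℕ) : 0 < (blockExp r).card := by
  rw [blockExp, Fintype.card_piFinset]
  exact prod_pos fun h _ => card_simplexExp_pos _

/-- The weighted size of a block exponent. -/
noncomputable def blockWt {m : ℕ} (r : Fin m → ℕ) (e : Fin m → Fin 3 → ℝ)
    (j : Fin m → Fin 3 → ℕ) : ℝ := ∑ h, ∑ k, e h k * (j h k / r h)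

lemma card_blockWt_gt_le {m : ℕ} {r : Fin m → ℕ} (hr : ∀ h, 0 < r h) {e : Fin m → Fin 3 → ℝ}
    {η : ℝ} (hη0 : 0 < η) (hη1 : η ≤ 1) (he : ∀ h k, |e h k| ≤ 2) (hη : ∀ h, ∑ k, e h k ≤ -η) :
    ((((blockExp r).filter fun j => -(m * η / 6) < blockWt r e j).card : ℕ) : ℝ) ≤
      (blockExp r).card * Real.exp (-(m * η ^ 2 / 576)) := by
  set t := η / 48 with ht
  have ht0 : 0 ≤ t := by positivity
  calc ((((blockExp r).filter fun j => -(m * η / 6) < blockWt r e j).card : ℕ) : ℝ)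
      = ∑ j ∈ (blockExp r).filter fun j => -(m * η / 6) < blockWt r e j, (1 : ℝ) := by simp
    _ ≤ ∑ j ∈ (blockExp r).filter fun j => -(m * η / 6) < blockWt r e j,
        Real.exp (t * (blockWt r e j + m * η / 6)) := by
      refine sum_le_sum fun j hj => Real.one_le_exp ?_
      have := (mem_filter.1 hj).2
      exact mul_nonneg ht0 (by linarith)
    _ ≤ ∑ j ∈ blockExp r, Real.exp (t * (blockWt r e j + m * η / 6)) :=
      sum_le_sum_of_subset_of_nonneg (filter_subset _ _) fun _ _ _ => (Real.exp_pos _).le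
    _ = Real.exp (t * (m * η / 6)) * ∑ j ∈ blockExp r,
        ∏ h, Real.exp (t * ∑ k, e h k * (j h k / r h)) := by
      rw [mul_sum]
      refine sum_congr rfl fun j _ => ?_
      rw [← Real.exp_sum, ← Real.exp_add, blockWt, ← mul_sum]
      congr 1; ring
    _ = Real.exp (t * (m * η / 6)) * ∏ h, ∑ j ∈ simplexExp (r h),
        Real.exp (t * ∑ k, e h k * (j k / r h)) := by
      rw [blockExp, prod_univ_sum]
    _ ≤ Real.exp (t * (m * η / 6)) * ∏ h, ((simplexExp (r h)).card *
        Real.exp (-t * η / 3 + 4 * t ^ 2)) := by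
      refine mul_le_mul_of_nonneg_left (prod_le_prod
        (fun h _ => sum_nonneg fun _ _ => (Real.exp_pos _).le) fun h _ => ?_) (Real.exp_pos _).le
      exact sum_exp_simplexExp_le (hr h) (he h) (hη h) ht0 (by rw [ht]; linarith)
    _ = (blockExp r).card * Real.exp (-(m * η ^ 2 / 576)) := by
      rw [prod_mul_distrib, blockExp, Fintype.card_piFinset, prod_const, ← Real.exp_nat_mul,
        mul_left_comm, ← Real.exp_add]
      push_cast
      congr 2
      rw [card_univ, Fintype.card_fin, ht]
      ring

section
attribute [local instance] Matrix.linftyOpNormedRing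

/-- The operator seminorm of multiplication by an element, relative to an integral basis. -/
noncomputable def basisNorm {𝒪 : Type*} [CommRing 𝒪] {d : ℕ} (b : Module.Basis (Fin d) ℤ 𝒪) :
    RingSeminorm 𝒪 where
  toFun x := ‖Algebra.leftMulMatrix b x‖
  map_zero' := by simp
  add_le' x y := by rw [map_add]; exact norm_add_le _ _
  neg' x := by rw [map_neg, norm_neg]
  mul_le' x y := by rw [map_mul]; exact norm_mul_le _ _

lemma basisNorm_one_le {𝒪 : Type*} [CommRing 𝒪] {d : ℕ} (b : Module.Basis (Fin d) ℤ 𝒪) :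
    basisNorm b 1 ≤ 1 := by
  change ‖Algebra.leftMulMatrix b 1‖ ≤ 1
  rw [map_one, ← Matrix.diagonal_one, Matrix.linfty_opNorm_diagonal]
  exact (pi_norm_le_iff_of_nonneg zero_le_one).2 fun i => by simp

lemma abs_repr_le_basisNorm {𝒪 : Type*} [CommRing 𝒪] {d : ℕ} (b : Module.Basis (Fin d) ℤ 𝒪) :
    ∃ K : ℝ, 1 ≤ K ∧ ∀ x i, |((b.repr x i : ℤ) : ℝ)| ≤ K * basisNorm b x := by
  refine ⟨max 1 ‖(b.repr 1 : Fin d → ℤ)‖, le_max_left _ _, fun x i => ?_⟩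
  have h1 := Algebra.leftMulMatrix_mulVec_repr b x 1
  rw [mul_one] at h1
  calc |((b.repr x i : ℤ) : ℝ)| = ‖b.repr x i‖ := (Int.norm_eq_abs _).symm
    _ ≤ ‖(b.repr x : Fin d → ℤ)‖ := norm_le_pi_norm _ i
    _ ≤ ‖Algebra.leftMulMatrix b x‖ * ‖(b.repr 1 : Fin d → ℤ)‖ := by
      rw [← h1]
      exact Matrix.linfty_opNorm_mulVec _ _
    _ ≤ basisNorm b x * max 1 ‖(b.repr 1 : Fin d → ℤ)‖ :=
      mul_le_mul_of_nonneg_left (le_max_right _ _) (norm_nonneg _)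
    _ = _ := mul_comm _ _

end

lemma exists_order_of_isIntegral {β : ℝ} (hβ : IsIntegral ℤ β) :
    ∃ (𝒪 : Subalgebra ℤ ℝ) (_ : β ∈ 𝒪) (d : ℕ) (_ : Module.Basis (Fin d) ℤ 𝒪), 0 < d := by
  have : Module.Finite ℤ (Algebra.adjoin ℤ {β}) :=
    ⟨(Submodule.fg_top _).2 hβ.fg_adjoin_singleton⟩
  refine ⟨Algebra.adjoin ℤ {β}, Algebra.self_mem_adjoin_singleton ℤ β, _,
    Module.finBasis ℤ _, Module.finrank_pos⟩

lemma exists_abs_coe_le_basisNorm {𝒪 : Subalgebra ℤ ℝ} {d : ℕ} (b : Module.Basis (Fin d) ℤ 𝒪) :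
    ∃ K : ℝ, 1 ≤ K ∧ ∀ x : 𝒪, |(x : ℝ)| ≤ K * basisNorm b x := by
  obtain ⟨K, hK, h⟩ := abs_repr_le_basisNorm b
  have h0 : 0 ≤ ∑ i, |(b i : ℝ)| := sum_nonneg fun _ _ => abs_nonneg _
  refine ⟨1 + K * ∑ i, |(b i : ℝ)|, by nlinarith, fun x => ?_⟩
  have h1 : (x : ℝ) = ∑ i, ((b.repr x i : ℤ) : ℝ) * (b i : ℝ) := by
    have := congrArg (fun y : 𝒪 => (y : ℝ)) (b.sum_repr x)
    simp only [AddSubmonoidClass.coe_finsetSum, zsmul_eq_mul] at this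
    exact this.symm
  have h2 : 0 ≤ basisNorm b x := apply_nonneg _ _
  calc |(x : ℝ)| ≤ ∑ i, |((b.repr x i : ℤ) : ℝ) * (b i : ℝ)| := by
        rw [h1]; exact abs_sum_le_sum_abs _ _
    _ ≤ ∑ i, K * basisNorm b x * |(b i : ℝ)| := by
      refine sum_le_sum fun i _ => ?_
      rw [abs_mul]
      exact mul_le_mul_of_nonneg_right (h x i) (abs_nonneg _)
    _ = (K * ∑ i, |(b i : ℝ)|) * basisNorm b x := by rw [← mul_sum]; ring
    _ ≤ _ := by nlinarith

lemma RingSeminorm.intCast_le {R : Type*} [CommRing R] (ν : RingSeminorm R) (h1 : ν 1 ≤ 1)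
    (n : ℤ) : ν (n : R) ≤ |(n : ℝ)| := by
  have hnat : ∀ k : ℕ, ν (k : R) ≤ k := by
    intro k
    induction k with
    | zero => simp
    | succ k ih =>
      push_cast
      exact (map_add_le_add ν _ _).trans (add_le_add ih h1)
  rcases Int.eq_nat_or_neg n with ⟨k, rfl | rfl⟩
  · simpa using hnat k
  · simpa using hnat k

section
attribute [local instance] Matrix.seminormedAddCommGroup

/-- Siegel's lemma for systems with coefficients in an order, with at most half as many
coordinate equations as unknowns. -/
lemma exists_int_solution_of_basis {𝒪 : Type*} [CommRing 𝒪] {d : ℕ}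
    (b : Module.Basis (Fin d) ℤ 𝒪) {K : ℝ} (hK : 1 ≤ K)
    (hb : ∀ x i, |((b.repr x i : ℤ) : ℝ)| ≤ K * basisNorm b x)
    {ι κ : Type*} [Fintype ι] [Fintype κ] [Nonempty ι] (L : κ → ι → 𝒪) {B : ℝ} (hB : 1 ≤ B)
    (hL : ∀ k c, basisNorm b (L k c) ≤ B)
    (hcard : 2 * (d * Fintype.card κ) ≤ Fintype.card ι) :
    ∃ t : ι → ℤ, t ≠ 0 ∧ (∀ k, ∑ c, (t c : 𝒪) * L k c = 0) ∧
      ∀ c, |(t c : ℝ)| ≤ Fintype.card ι * (K * B) := by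
  have hι : 0 < Fintype.card ι := Fintype.card_pos
  have hι' : (1 : ℝ) ≤ Fintype.card ι := by exact_mod_cast hι
  have hKB : 1 ≤ K * B := one_le_mul_of_one_le_of_one_le hK hB
  set A : Matrix (κ × Fin d) ι ℤ := Matrix.of fun x c => b.repr (L x.1 c) x.2 with hA
  obtain ⟨t, ht0, htA, ht⟩ : ∃ t : ι → ℤ, t ≠ 0 ∧ A.mulVec t = 0 ∧
      ∀ c, |(t c : ℝ)| ≤ Fintype.card ι * (K * B) := by
    have hcκ : Fintype.card (κ × Fin d) = d * Fintype.card κ := by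
      rw [Fintype.card_prod, Fintype.card_fin, mul_comm]
    rcases Nat.eq_zero_or_pos (Fintype.card (κ × Fin d)) with h0 | hpos
    · have : IsEmpty (κ × Fin d) := Fintype.card_eq_zero_iff.1 h0
      refine ⟨fun _ => 1, fun h => ?_, Subsingleton.elim _ _, fun c => ?_⟩
      · exact one_ne_zero (congrFun h (Classical.arbitrary ι))
      · simpa using one_le_mul_of_one_le_of_one_le hι' hKB
    · obtain ⟨t, ht0, htA, ht⟩ := Int.Matrix.exists_ne_zero_int_vec_norm_le A (by omega) hpos
      refine ⟨t, ht0, htA, fun c => ?_⟩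
      have hAn : ‖A‖ ≤ K * B := by
        rw [Matrix.norm_le_iff (by linarith)]
        intro x c
        rw [Int.norm_eq_abs]
        exact (hb _ _).trans (mul_le_mul_of_nonneg_left (hL _ _) (by linarith))
      have h1 : (1 : ℝ) ≤ Fintype.card ι * max 1 ‖A‖ :=
        one_le_mul_of_one_le_of_one_le hι' (le_max_left _ _)
      have h2 : ((Fintype.card (κ × Fin d) : ℝ) /
          (Fintype.card ι - Fintype.card (κ × Fin d))) ≤ 1 := by
        have h3 : 2 * (Fintype.card (κ × Fin d) : ℝ) ≤ Fintype.card ι := by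
          rw [hcκ]; exact_mod_cast hcard
        have h4 : (0 : ℝ) < Fintype.card (κ × Fin d) := by exact_mod_cast hpos
        rw [div_le_one (by linarith)]
        linarith
      calc |(t c : ℝ)| = ‖t c‖ := (Int.norm_eq_abs _).symm
        _ ≤ ‖t‖ := norm_le_pi_norm t c
        _ ≤ _ := ht
        _ ≤ (Fintype.card ι * max 1 ‖A‖) ^ (1 : ℝ) :=
          Real.rpow_le_rpow_of_exponent_le h1 h2
        _ = Fintype.card ι * max 1 ‖A‖ := Real.rpow_one _
        _ ≤ Fintype.card ι * (K * B) := by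
          gcongr
          exact max_le hKB hAn
  refine ⟨t, ht0, fun k => ?_, ht⟩
  refine b.repr.injective (Finsupp.ext fun i => ?_)
  have h1 := congrFun htA (k, i)
  simp only [Matrix.mulVec, dotProduct, hA, Matrix.of_apply, Pi.zero_apply] at h1
  have h2 : ∀ c, ((t c : 𝒪) * L k c) = t c • L k c := fun c => by rw [zsmul_eq_mul]
  simp only [h2, map_sum, map_smul, map_zero, Finsupp.coe_finsetSum, Finset.sum_apply,
    Finsupp.smul_apply, smul_eq_mul, Finsupp.coe_zero, Pi.zero_apply]
  rw [← h1]
  exact sum_congr rfl fun c _ => mul_comm _ _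

end

/-- A block exponent as a finitely supported function. -/
noncomputable def blockFinsupp {m : ℕ} (j : Fin m → Fin 3 → ℕ) : Fin m × Fin 3 →₀ ℕ :=
  Finsupp.equivFunOnFinite.symm fun x => j x.1 x.2

@[simp] lemma blockFinsupp_apply {m : ℕ} (j : Fin m → Fin 3 → ℕ) (x : Fin m × Fin 3) :
    blockFinsupp j x = j x.1 x.2 := rfl

lemma blockFinsupp_injective {m : ℕ} : Function.Injective (blockFinsupp (m := m)) := by
  intro j j' h
  ext h' k
  exact DFunLike.congr_fun h (h', k)

lemma blockFinsupp_curry {m : ℕ} (c : Fin m × Fin 3 →₀ ℕ) :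
    blockFinsupp (fun h k => c (h, k)) = c := by
  ext x; rfl

/-- The substitution `T ↦ (T₀ - aβT₁ - β²T₂, a²T₁, a²T₂)` in each block. -/
noncomputable def blockSubst {R : Type*} [CommRing R] (m : ℕ) (a β : R) (x : Fin m × Fin 3) :
    MvPolynomial (Fin m × Fin 3) R :=
  if x.2 = 0 then MvPolynomial.X (x.1, 0) - MvPolynomial.C (a * β) * MvPolynomial.X (x.1, 1) -
    MvPolynomial.C (β ^ 2) * MvPolynomial.X (x.1, 2)
  else MvPolynomial.C (a ^ 2) * MvPolynomial.X x

/-- Weights recording the multidegree. -/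
def blockWeight (m : ℕ) (x : Fin m × Fin 3) : Fin m → ℕ := Pi.single x.1 1

lemma weight_blockWeight {m : ℕ} (c : Fin m × Fin 3 →₀ ℕ) (h : Fin m) :
    Finsupp.weight (blockWeight m) c h = ∑ k, c (h, k) := by
  rw [Finsupp.weight_apply, Finsupp.sum_fintype _ _ (by simp), Finset.sum_apply,
    Fintype.sum_prod_type, Finset.sum_eq_single h]
  · simp [blockWeight]
  · intro b _ hb
    simp [blockWeight, hb.symm]
  · simp

lemma blockSubst_isWeightedHomogeneous {R : Type*} [CommRing R] (m : ℕ) (a β : R)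
    (x : Fin m × Fin 3) :
    (blockSubst m a β x).IsWeightedHomogeneous (blockWeight m) (blockWeight m x) := by
  have hX : ∀ k : Fin 3, (MvPolynomial.X (x.1, k) :
      MvPolynomial (Fin m × Fin 3) R).IsWeightedHomogeneous (blockWeight m) (blockWeight m x) :=
    fun k => MvPolynomial.isWeightedHomogeneous_X R (blockWeight m) (x.1, k)
  unfold blockSubst
  split_ifs
  · exact ((hX 0).sub ((hX 1).C_mul _)).sub ((hX 2).C_mul _)
  · exact (hX x.2).C_mul _

lemma mvNorm_blockSubst_le {R : Type*} [CommRing R] (ν : RingSeminorm R) (h1 : ν 1 ≤ 1)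
    (m : ℕ) (a β : R) (x : Fin m × Fin 3) :
    mvNorm ν (fun _ => 1) (fun _ => zero_le_one) (blockSubst m a β x) ≤
      1 + ν (a * β) + ν (β ^ 2) + ν (a ^ 2) := by
  have hX : ∀ y : Fin m × Fin 3, mvNorm ν (fun _ => 1) (fun _ => zero_le_one)
      (MvPolynomial.X y : MvPolynomial (Fin m × Fin 3) R) ≤ 1 := by
    intro y
    rw [mvNorm_X, mul_one]; exact h1
  have hCX : ∀ (c : R) (y : Fin m × Fin 3), mvNorm ν (fun _ => 1) (fun _ => zero_le_one)
      (MvPolynomial.C c * MvPolynomial.X y : MvPolynomial (Fin m × Fin 3) R) ≤ ν c := by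
    intro c y
    refine (map_mul_le_mul _ _ _).trans ?_
    rw [mvNorm_C]
    exact mul_le_of_le_one_right (apply_nonneg _ _) (hX y)
  have := apply_nonneg ν (a * β)
  have := apply_nonneg ν (β ^ 2)
  have := apply_nonneg ν (a ^ 2)
  unfold blockSubst
  split_ifs
  · refine (map_sub_le_add _ _ _).trans ?_
    refine (add_le_add (map_sub_le_add _ _ _) le_rfl).trans ?_
    linarith [hX (x.1, 0), hCX (a * β) (x.1, 1), hCX (β ^ 2) (x.1, 2)]
  · linarith [hCX (a ^ 2) x]

lemma RingSeminorm.map_le_of_le {R S σ : Type*} [CommRing R] [CommRing S] (ν : RingSeminorm R)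
    (μ : RingSeminorm S) (φ : R →+* S) {K : ℝ} (hφ : ∀ x, μ (φ x) ≤ K * ν x) (ω : σ → ℝ)
    (hω : ∀ i, 0 ≤ ω i) (f : MvPolynomial σ R) :
    mvNorm μ ω hω (MvPolynomial.map φ f) ≤ K * mvNorm ν ω hω f := by
  rw [mvNorm_eq_sum μ ω hω _ f.support (MvPolynomial.support_map_subset _ _), mvNorm_apply,
    mul_sum]
  refine sum_le_sum fun a _ => ?_
  rw [MvPolynomial.coeff_map, ← mul_assoc]
  exact mul_le_mul_of_nonneg_right (hφ _) (expWt_nonneg hω a)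

/-- Substituting a linear combination that diagonalises the linear forms
`Y₀ + αY₁ + α²Y₂`, `Y₁`, `Y₂`. -/
lemma aeval_blockSubst {𝒪 : Subalgebra ℤ ℝ} {m : ℕ} (a β : 𝒪) {α : ℝ} (hβ : (β : ℝ) = a * α)
    {A : Type} [CommRing A] [Algebra ℝ A] (Y : Fin m × Fin 3 → A)
    (P : MvPolynomial (Fin m × Fin 3) ℤ) :
    MvPolynomial.aeval (fun x => algebraMap ℝ A (a ^ 2) * Y x) P =
      MvPolynomial.aeval (fun x => if x.2 = 0 then algebraMap ℝ A (a ^ 2) *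
          (Y (x.1, 0) + algebraMap ℝ A α * Y (x.1, 1) + algebraMap ℝ A (α ^ 2) * Y (x.1, 2))
          else Y x)
        (MvPolynomial.map (algebraMap 𝒪 ℝ)
          (MvPolynomial.aeval (blockSubst m a β) P)) := by
  have : (MvPolynomial.aeval (R := ℤ) (fun x => algebraMap ℝ A (a ^ 2) * Y x)).toRingHom =
      ((MvPolynomial.aeval (R := ℝ) (fun x : Fin m × Fin 3 =>
        if x.2 = 0 then algebraMap ℝ A (a ^ 2) *
          (Y (x.1, 0) + algebraMap ℝ A α * Y (x.1, 1) + algebraMap ℝ A (α ^ 2) * Y (x.1, 2))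
          else Y x)).toRingHom.comp (MvPolynomial.map (algebraMap 𝒪 ℝ))).comp
      (MvPolynomial.aeval (R := ℤ) (blockSubst m a β)).toRingHom := by
    refine MvPolynomial.ringHom_ext (fun r => by simp) fun x => ?_
    obtain ⟨h, k⟩ := x
    have hco : ∀ z : 𝒪, algebraMap 𝒪 ℝ z = (z : ℝ) := fun _ => rfl
    fin_cases k
    · simp [blockSubst, hco, hβ]
      ring
    · simp [blockSubst, hco]
    · simp [blockSubst, hco]
  exact congrArg (fun φ => φ P) this

theorem exists_auxiliary_polynomial {α : ℝ} (hα : IsAlgebraic ℚ α) {η : ℝ} (hη0 : 0 < η)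
    (hη1 : η ≤ 1) :
    ∃ (a : ℤ) (m : ℕ) (C : ℝ), a ≠ 0 ∧ 0 < m ∧ 1 ≤ C ∧
      ∀ (r : Fin m → ℕ) (e : Fin m → Fin 3 → ℝ), (∀ h, 0 < r h) → (∀ h k, |e h k| ≤ 2) →
        (∀ h, ∑ k, e h k ≤ -η) →
        ∃ (P : MvPolynomial (Fin m × Fin 3) ℤ) (Q : MvPolynomial (Fin m × Fin 3) ℝ), P ≠ 0 ∧
          (∀ c ∈ P.support, ∀ h, ∑ k, c (h, k) = r h) ∧
          lone P ≤ C ^ ∑ h, r h ∧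
          mvNorm (normRingSeminorm ℝ) (fun _ => 1) (fun _ => zero_le_one) Q ≤ C ^ ∑ h, r h ∧
          (∀ c ∈ Q.support, (∀ h, ∑ k, c (h, k) = r h) ∧
            blockWt r e (fun h k => c (h, k)) ≤ -(m * η / 6)) ∧
          ∀ (A : Type) [CommRing A] [Algebra ℝ A] (Y : Fin m × Fin 3 → A),
            MvPolynomial.aeval (fun x => algebraMap ℝ A ((a : ℝ) ^ 2) * Y x) P =
            MvPolynomial.aeval (fun x => if x.2 = 0 then algebraMap ℝ A ((a : ℝ) ^ 2) *
              (Y (x.1, 0) + algebraMap ℝ A α * Y (x.1, 1) + algebraMap ℝ A (α ^ 2) * Y (x.1, 2))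
              else Y x) Q := by
  classical
  obtain ⟨a, ha0, haα⟩ : ∃ a : ℤ, a ≠ 0 ∧ IsIntegral ℤ (a • α) := by
    have h1 : IsAlgebraic ℤ α := (IsFractionRing.isAlgebraic_iff ℤ ℚ ℝ).2 hα
    obtain ⟨a, ha, h⟩ := h1.exists_integral_multiple
    exact ⟨a, ha, h⟩
  obtain ⟨𝒪, hβ𝒪, d, b, hd⟩ := exists_order_of_isIntegral haα
  obtain ⟨K, hK, hKb⟩ := abs_repr_le_basisNorm b
  obtain ⟨K', hK', hKb'⟩ := exists_abs_coe_le_basisNorm b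
  obtain ⟨m, hm0, hm⟩ : ∃ m : ℕ, 0 < m ∧ Real.exp (-(m * η ^ 2 / 576)) ≤ 1 / (2 * d) := by
    have hd' : (0 : ℝ) < d := by exact_mod_cast hd
    obtain ⟨m, hm⟩ := exists_nat_gt (max 1 (2 * d * 576 / η ^ 2))
    have h1 := (le_max_left _ _).trans_lt hm
    have h2 := (le_max_right _ _).trans_lt hm
    refine ⟨m, by exact_mod_cast (zero_lt_one.trans h1), ?_⟩
    rw [Real.exp_neg, ← one_div]
    refine one_div_le_one_div_of_le (by positivity) ?_
    have h3 : 2 * (d : ℝ) ≤ m * η ^ 2 / 576 := by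
      rw [div_lt_iff₀ (by positivity)] at h2
      rw [le_div_iff₀ (by norm_num)]
      linarith
    linarith [Real.add_one_le_exp (m * η ^ 2 / 576 : ℝ)]
  set β : 𝒪 := ⟨a • α, hβ𝒪⟩ with hβ
  set ν := basisNorm b with hν
  have hν1 : ν 1 ≤ 1 := basisNorm_one_le b
  set B : ℝ := 1 + ν ((a : 𝒪) * β) + ν (β ^ 2) + ν ((a : 𝒪) ^ 2) with hB
  have hB1 : 1 ≤ B := by
    have := apply_nonneg ν ((a : 𝒪) * β)
    have := apply_nonneg ν (β ^ 2)
    have := apply_nonneg ν ((a : 𝒪) ^ 2)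
    linarith
  refine ⟨a, m, K' * (64 * K * B * B), ha0, hm0, ?_, fun r e hr he hη => ?_⟩
  · have h1 : 1 ≤ K * B := one_le_mul_of_one_le_of_one_le hK hB1
    have h2 : 1 ≤ (K * B) * B := one_le_mul_of_one_le_of_one_le h1 hB1
    have : 1 ≤ 64 * K * B * B := by nlinarith
    exact one_le_mul_of_one_le_of_one_le hK' this
  set D := ∑ h, r h with hD
  set N : RingSeminorm (MvPolynomial (Fin m × Fin 3) 𝒪) :=
    mvNorm ν (fun _ => 1) (fun _ => zero_le_one) with hN
  have hN1 : N 1 ≤ 1 := by rw [hN, mvNorm_one]; exact hν1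
  set M : (Fin m → Fin 3 → ℕ) → MvPolynomial (Fin m × Fin 3) 𝒪 :=
    fun j => ∏ x, blockSubst m (a : 𝒪) β x ^ j x.1 x.2 with hM
  have hMN : ∀ j ∈ blockExp r, N (M j) ≤ B ^ D := by
    intro j hj
    refine (N.prod_le' hN1 _ _).trans ?_
    calc ∏ x : Fin m × Fin 3, N (blockSubst m (a : 𝒪) β x ^ j x.1 x.2)
        ≤ ∏ x : Fin m × Fin 3, B ^ j x.1 x.2 :=
          prod_le_prod (fun _ _ => apply_nonneg _ _) fun x _ => (N.pow_le' hN1 _ _).trans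
            (pow_le_pow_left₀ (apply_nonneg _ _) (mvNorm_blockSubst_le ν hν1 m _ _ x) _)
      _ = B ^ D := by
        rw [prod_pow_eq_pow_sum, Fintype.sum_prod_type, hD]
        congr 1
        exact sum_congr rfl fun h _ => mem_blockExp.1 hj h
  have hMhom : ∀ j ∈ blockExp r, (M j).IsWeightedHomogeneous (blockWeight m) r := by
    intro j hj
    have h1 := MvPolynomial.IsWeightedHomogeneous.prod univ
      (fun x => blockSubst m (a : 𝒪) β x ^ j x.1 x.2)
      (fun x => j x.1 x.2 • blockWeight m x) (w := blockWeight m)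
      fun x _ => (blockSubst_isWeightedHomogeneous m (a : 𝒪) β x).pow _
    have h2 : ∑ x, j x.1 x.2 • blockWeight m x = r := by
      have h3 : ∑ x, j x.1 x.2 • blockWeight m x =
          Finsupp.weight (blockWeight m) (blockFinsupp j) := by
        rw [Finsupp.weight_apply, Finsupp.sum_fintype _ _ (by simp)]
        rfl
      rw [h3]
      ext h
      rw [weight_blockWeight]
      exact mem_blockExp.1 hj h
    rwa [h2] at h1
  set bad := (blockExp r).filter fun j => -(m * η / 6) < blockWt r e j with hbad
  have hbadcard : 2 * (d * Fintype.card bad) ≤ Fintype.card (blockExp r) := by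
    rw [Fintype.card_coe, Fintype.card_coe]
    have h1 := card_blockWt_gt_le hr hη0 hη1 he hη
    have hd' : (0 : ℝ) < d := by exact_mod_cast hd
    have h2 : ((blockExp r).card : ℝ) * Real.exp (-(m * η ^ 2 / 576)) ≤
        (blockExp r).card * (1 / (2 * d)) := by gcongr
    have h3 : (2 * (d * bad.card) : ℝ) ≤ (blockExp r).card := by
      have h4 := h1.trans h2
      rw [mul_one_div, le_div_iff₀ (by positivity)] at h4
      linarith
    exact_mod_cast h3
  have hne : Nonempty (blockExp r) := by
    obtain ⟨x, hx⟩ := card_pos.1 (card_blockExp_pos r)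
    exact ⟨⟨x, hx⟩⟩
  obtain ⟨t, ht0, hteq, htle⟩ := exists_int_solution_of_basis b hK hKb
    (fun (k : bad) (c : blockExp r) => (M c).coeff (blockFinsupp k))
    (one_le_pow₀ hB1 : 1 ≤ B ^ D) (fun k c => by
      have := coeff_le_mvNorm ν (fun _ => 1) (fun _ => zero_le_one) (M c) (blockFinsupp k)
      rw [show expWt (fun _ : Fin m × Fin 3 => (1 : ℝ)) (blockFinsupp (k : Fin m → Fin 3 → ℕ)) = 1
        from expWt_one _, mul_one] at this
      exact this.trans (hMN c c.2)) hbadcard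
  set P : MvPolynomial (Fin m × Fin 3) ℤ :=
    ∑ c : blockExp r, MvPolynomial.monomial (blockFinsupp (c : Fin m → Fin 3 → ℕ)) (t c) with hP
  have hPcoeff : ∀ c : blockExp r, P.coeff (blockFinsupp (c : Fin m → Fin 3 → ℕ)) = t c := by
    intro c
    simp only [hP, MvPolynomial.coeff_sum, MvPolynomial.coeff_monomial]
    rw [sum_eq_single c]
    · simp
    · intro c' _ hc'
      exact if_neg fun h => hc' (Subtype.ext (blockFinsupp_injective h))
    · simp
  have hPsupp : ∀ c ∈ P.support, ∃ j : blockExp r, blockFinsupp (j : Fin m → Fin 3 → ℕ) = c := by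
    intro c hc
    rw [MvPolynomial.mem_support_iff] at hc
    by_contra! h
    apply hc
    simp only [hP, MvPolynomial.coeff_sum, MvPolynomial.coeff_monomial]
    exact sum_eq_zero fun j _ => if_neg (h j)
  have hcard8 : (Fintype.card (blockExp r) : ℝ) ≤ 8 ^ D := by
    rw [Fintype.card_coe]
    exact_mod_cast card_blockExp_le r
  have hsum_t : ∑ c : blockExp r, |(t c : ℝ)| ≤ (64 * K * B) ^ D := by
    calc ∑ c : blockExp r, |(t c : ℝ)|
        ≤ ∑ c : blockExp r, Fintype.card (blockExp r) * (K * B ^ D) :=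
          sum_le_sum fun c _ => htle c
      _ = Fintype.card (blockExp r) * (Fintype.card (blockExp r) * (K * B ^ D)) := by
        rw [sum_const, nsmul_eq_mul, card_univ]
      _ ≤ 8 ^ D * (8 ^ D * (K ^ D * B ^ D)) := by
        have hDpos : D ≠ 0 := by
          have h1 := single_le_sum (f := r) (fun _ _ => Nat.zero_le _) (mem_univ ⟨0, hm0⟩)
          have := hr ⟨0, hm0⟩
          omega
        have := le_self_pow₀ hK hDpos
        gcongr
      _ = (64 * K * B) ^ D := by
        rw [mul_pow, mul_pow, show (64 : ℝ) = 8 * 8 by norm_num, mul_pow]; ring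
  have hQ : MvPolynomial.aeval (blockSubst m (a : 𝒪) β) P =
      ∑ c : blockExp r, ((t c : ℤ) : MvPolynomial (Fin m × Fin 3) 𝒪) * M c := by
    rw [hP, map_sum]
    refine sum_congr rfl fun c _ => ?_
    rw [MvPolynomial.aeval_monomial, Finsupp.prod_fintype _ _ (by simp)]
    simp [hM]
  have hC1 : ∀ x : ℝ, 1 ≤ x → 64 * K * B ≤ 64 * K * B * x := by
    intro x hx
    have : 0 ≤ 64 * K * B := by positivity
    nlinarith
  refine ⟨P, MvPolynomial.map (algebraMap 𝒪 ℝ) (MvPolynomial.aeval (blockSubst m (a : 𝒪) β) P),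
    ?_, ?_, ?_, ?_, ?_, ?_⟩
  · rintro h
    apply ht0
    ext c
    rw [← hPcoeff c, h, MvPolynomial.coeff_zero, Pi.zero_apply]
  · intro c hc h
    obtain ⟨j, rfl⟩ := hPsupp c hc
    exact mem_blockExp.1 j.2 h
  · calc lone P ≤ ∑ c : blockExp r, |(t c : ℝ)| := by
          unfold lone
          rw [hP]
          refine (RingSeminorm.sum_le' _ _ _).trans (sum_le_sum fun c _ => ?_)
          rw [mvNorm_monomial, intAbs_apply, expWt_one, mul_one]
      _ ≤ _ := hsum_t
      _ ≤ _ := by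
        refine pow_le_pow_left₀ (by positivity) ?_ D
        refine (hC1 B hB1).trans ?_
        exact le_mul_of_one_le_left (by positivity) hK'
  · have h1 := RingSeminorm.map_le_of_le ν (normRingSeminorm ℝ) (algebraMap 𝒪 ℝ) (K := K')
      (fun x => hKb' x) (fun _ : Fin m × Fin 3 => 1) (fun _ => zero_le_one)
      (MvPolynomial.aeval (blockSubst m (a : 𝒪) β) P)
    refine h1.trans ?_
    have h2 : N (MvPolynomial.aeval (blockSubst m (a : 𝒪) β) P) ≤ (64 * K * B) ^ D * B ^ D := by
      rw [hQ]
      refine (RingSeminorm.sum_le' _ _ _).trans ?_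
      calc ∑ c : blockExp r, N (((t c : ℤ) : MvPolynomial (Fin m × Fin 3) 𝒪) * M c)
          ≤ ∑ c : blockExp r, |(t c : ℝ)| * B ^ D := by
            refine sum_le_sum fun c _ => (map_mul_le_mul _ _ _).trans ?_
            exact mul_le_mul (N.intCast_le hN1 _) (hMN c c.2) (apply_nonneg _ _) (abs_nonneg _)
        _ ≤ _ := by
          rw [← sum_mul]
          gcongr
    have hDpos : D ≠ 0 := by
      have h1 := single_le_sum (f := r) (fun _ _ => Nat.zero_le _) (mem_univ ⟨0, hm0⟩)
      have := hr ⟨0, hm0⟩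
      omega
    rw [mul_pow, mul_pow _ B]
    have := le_self_pow₀ hK' hDpos
    gcongr
  · intro c hc
    have hc' := MvPolynomial.support_map_subset _ _ hc
    have hblock : ∀ h, ∑ k, c (h, k) = r h := by
      intro h
      have h1 : (MvPolynomial.aeval (blockSubst m (a : 𝒪) β) P).IsWeightedHomogeneous
          (blockWeight m) r := by
        rw [hQ]
        refine MvPolynomial.IsWeightedHomogeneous.sum _ _ _ fun c _ => ?_
        have := (hMhom c c.2).C_mul (t c : 𝒪)
        simpa using this
      have h2 := h1 (MvPolynomial.mem_support_iff.1 hc')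
      rw [← weight_blockWeight, h2]
    refine ⟨hblock, ?_⟩
    by_contra! hlt
    have hmem : (fun h k => c (h, k)) ∈ bad := mem_filter.2 ⟨mem_blockExp.2 hblock, hlt⟩
    have h3 := hteq ⟨_, hmem⟩
    apply MvPolynomial.mem_support_iff.1 hc'
    rw [hQ, MvPolynomial.coeff_sum, ← h3]
    refine sum_congr rfl fun c' _ => ?_
    have : ((t c' : ℤ) : MvPolynomial (Fin m × Fin 3) 𝒪) = MvPolynomial.C ((t c' : ℤ) : 𝒪) := by
      simp
    rw [this, MvPolynomial.coeff_C_mul, blockFinsupp_curry]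
  · intro A _ _ Y
    have := aeval_blockSubst (a : 𝒪) β (α := α) (by simp [hβ]) Y P
    simpa using this

theorem contP_pos {a : ℕ → ℕ} (ha : ∀ k, 0 < a k) : ∀ k, 0 < contP a k
  | 0 => one_pos
  | 1 => by simpa [contP] using ha 0
  | k + 2 => by
    have h1 := contP_pos ha k
    have h2 := contP_pos ha (k + 1)
    have h3 : (0 : ℤ) < a (k + 1) := by exact_mod_cast ha (k + 1)
    simp only [contP]
    positivity

theorem contQ_succ_pos {a : ℕ → ℕ} (ha : ∀ k, 0 < a k) : ∀ k, 0 < contQ a (k + 1)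
  | 0 => one_pos
  | 1 => by
    have h3 : (0 : ℤ) < a 1 := by exact_mod_cast ha 1
    simpa [contQ] using h3
  | k + 2 => by
    have h1 := contQ_succ_pos ha k
    have h2 := contQ_succ_pos ha (k + 1)
    have h3 : (0 : ℤ) < a (k + 2) := by exact_mod_cast ha (k + 2)
    rw [contQ]
    positivity

theorem contQ_nonneg {a : ℕ → ℕ} (ha : ∀ k, 0 < a k) : ∀ k, 0 ≤ contQ a k
  | 0 => le_rfl
  | k + 1 => (contQ_succ_pos ha k).le

theorem contQ_le_succ {a : ℕ → ℕ} (ha : ∀ k, 0 < a k) : ∀ k, contQ a k ≤ contQ a (k + 1)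
  | 0 => zero_le_one
  | k + 1 => by
    have h1 := contQ_nonneg ha k
    have h2 := contQ_succ_pos ha k
    have h3 : (1 : ℤ) ≤ a (k + 1) := by exact_mod_cast ha (k + 1)
    rw [contQ]
    nlinarith

theorem le_contQ_add_one {a : ℕ → ℕ} (ha : ∀ k, 0 < a k) : ∀ k : ℕ, (k : ℤ) ≤ contQ a k + 1
  | 0 => by simp [contQ]
  | 1 => by simp [contQ]
  | 2 => by
    have := contQ_succ_pos ha 1
    push_cast
    linarith
  | k + 3 => by
    have h1 := contQ_succ_pos ha k
    have h2 := contQ_succ_pos ha (k + 1)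
    have h3 : (1 : ℤ) ≤ a (k + 2) := by exact_mod_cast ha (k + 2)
    have h4 := le_contQ_add_one ha (k + 2)
    rw [contQ]
    push_cast at h4 ⊢
    nlinarith

theorem contP_shift (a : ℕ → ℕ) : ∀ k,
    contP a (k + 1) = a 0 * contP (fun n => a (n + 1)) k + contQ (fun n => a (n + 1)) k
  | 0 => by simp [contP, contQ]
  | 1 => by simp [contP, contQ]; ring
  | k + 2 => by
    rw [contP, contP_shift a (k + 1), contP_shift a k, contP, contQ]
    ring

theorem contQ_shift (a : ℕ → ℕ) : ∀ k, contQ a (k + 1) = contP (fun n => a (n + 1)) k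
  | 0 => by simp [contP, contQ]
  | 1 => by simp [contP, contQ]
  | k + 2 => by
    rw [contQ, contQ_shift a (k + 1), contQ_shift a k, contP]

theorem contP_mul_contQ_sub (a : ℕ → ℕ) : ∀ k,
    contP a (k + 1) * contQ a k - contP a k * contQ a (k + 1) = (-1) ^ (k + 1)
  | 0 => by simp [contP, contQ]
  | k + 1 => by
    have h := contP_mul_contQ_sub a k
    rw [contP, contQ, pow_succ, ← h]
    ring

theorem cfPrefix_succ (a : ℕ → ℕ) (i : ℕ) :
    cfPrefix a (i + 1) = a 0 :: cfPrefix (fun n => a (n + 1)) i := by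
  rw [cfPrefix, List.range_succ_eq_map, List.map_cons, List.map_map]
  rfl

theorem cfVal_cfPrefix {a : ℕ → ℕ} (ha : ∀ k, 0 < a k) (i : ℕ) :
    cfVal (cfPrefix a i) = (contP a (i + 1) : ℝ) / contQ a (i + 1) := by
  induction i generalizing a with
  | zero => simp [cfPrefix, cfVal, contP, contQ]
  | succ i ih =>
    have ha' : ∀ k, 0 < a (k + 1) := fun k => ha _
    have hP : (0 : ℝ) < contP (fun n => a (n + 1)) (i + 1) := by exact_mod_cast contP_pos ha' _
    have h : cfVal (cfPrefix a (i + 1)) =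
        a 0 + 1 / cfVal (cfPrefix (fun n => a (n + 1)) i) := by
      rw [cfPrefix_succ]
      cases i with
      | zero => rfl
      | succ i => rw [cfPrefix_succ]; rfl
    rw [h, ih ha', contP_shift a (i + 1), contQ_shift a (i + 1)]
    push_cast
    field_simp

theorem cfVal_reverse_cfPrefix {a : ℕ → ℕ} (ha : ∀ k, 0 < a k) (i : ℕ) :
    cfVal (cfPrefix a i).reverse = (contP a (i + 1) : ℝ) / contP a i := by
  induction i with
  | zero => simp [cfPrefix, cfVal, contP]
  | succ i ih =>
    have hP : (0 : ℝ) < contP a (i + 1) := by exact_mod_cast contP_pos ha _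
    have hr : ∀ j, (cfPrefix a (j + 1)).reverse = a (j + 1) :: (cfPrefix a j).reverse := by
      intro j
      rw [cfPrefix, List.range_succ, List.map_append, List.reverse_append]
      rfl
    have h : cfVal (cfPrefix a (i + 1)).reverse =
        a (i + 1) + 1 / cfVal (cfPrefix a i).reverse := by
      rw [hr]
      cases i with
      | zero => rfl
      | succ i => rw [hr]; rfl
    rw [h, ih, contP]
    push_cast
    field_simp

theorem abs_contQ_mul_sub_contP_le {a : ℕ → ℕ} (ha : ∀ k, 0 < a k) {α : ℝ}
    (hα : Filter.Tendsto (fun i => cfVal (cfPrefix a i)) Filter.atTop (nhds α)) (k : ℕ) :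
    |(contQ a k : ℝ) * α - contP a k| ≤ 1 / contQ a (k + 1) := by
  have key : ∀ n, |contP a (k + n) * contQ a k - contP a k * contQ a (k + n)| *
        contQ a (k + 1) ≤ contQ a (k + n) := by
    intro n
    induction n using Nat.twoStepInduction with
    | zero =>
      rw [add_zero, sub_self]
      simpa using contQ_nonneg ha k
    | one =>
      rw [contP_mul_contQ_sub]
      simp
    | more n h1 h2 =>
      have e : contP a (k + (n + 2)) * contQ a k - contP a k * contQ a (k + (n + 2)) =
          a (k + n + 1) * (contP a (k + (n + 1)) * contQ a k - contP a k * contQ a (k + (n + 1)))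
          + (contP a (k + n) * contQ a k - contP a k * contQ a (k + n)) := by
        rw [← add_assoc k n 2, ← add_assoc k n 1, contP, contQ]
        ring
      have e2 : contQ a (k + (n + 2)) =
          a (k + n + 1) * contQ a (k + (n + 1)) + contQ a (k + n) := by
        rw [← add_assoc k n 2, ← add_assoc k n 1, contQ]
      rw [e, e2]
      have h3 : (0 : ℤ) < contQ a (k + 1) := contQ_succ_pos ha k
      have h4 := abs_add_le
        (a (k + n + 1) * (contP a (k + (n + 1)) * contQ a k - contP a k * contQ a (k + (n + 1))))
        (contP a (k + n) * contQ a k - contP a k * contQ a (k + n))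
      rw [abs_mul, Nat.abs_cast] at h4
      have h5 : (0 : ℤ) ≤ a (k + n + 1) := by positivity
      nlinarith [mul_le_mul_of_nonneg_left h2 h5, mul_le_mul_of_nonneg_right h4 h3.le]
  have hlim : Filter.Tendsto
      (fun i => |(contQ a k : ℝ) * cfVal (cfPrefix a i) - contP a k|) Filter.atTop
      (nhds |(contQ a k : ℝ) * α - contP a k|) :=
    ((hα.const_mul _).sub_const _).abs
  refine le_of_tendsto hlim ?_
  filter_upwards [Filter.eventually_ge_atTop k] with i hi
  obtain ⟨n, rfl⟩ := Nat.exists_eq_add_of_le hi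
  have h := key (n + 1)
  rw [← add_assoc] at h
  have h3 : (0 : ℝ) < contQ a (k + 1) := by exact_mod_cast contQ_succ_pos ha k
  have h4 : (0 : ℝ) < contQ a (k + n + 1) := by exact_mod_cast contQ_succ_pos ha _
  have h' : |(contP a (k + n + 1) : ℝ) * contQ a k - contP a k * contQ a (k + n + 1)| *
        contQ a (k + 1) ≤ contQ a (k + n + 1) := by exact_mod_cast h
  rw [cfVal_cfPrefix ha, le_div_iff₀ h3]
  have e : (contQ a k : ℝ) * (contP a (k + n + 1) / contQ a (k + n + 1)) - contP a k =
      (contP a (k + n + 1) * contQ a k - contP a k * contQ a (k + n + 1)) /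
        contQ a (k + n + 1) := by
    field_simp
  rw [e, abs_div, abs_of_pos h4, div_mul_eq_mul_div, div_le_one h4]
  exact h'

theorem exists_symmetric_approximation {a : ℕ → ℕ} (ha : ∀ k, 0 < a k) {α : ℝ}
    (hα : Filter.Tendsto (fun i => cfVal (cfPrefix a i)) Filter.atTop (nhds α))
    (hpal : {i : ℕ | IsMPal 1 (cfPrefix a i)}.Infinite) (N : ℕ) :
    ∃ q p r : ℤ, (N : ℤ) ≤ q ∧ 0 < q ∧ |p ^ 2 - q * r| = 1 ∧ |(q : ℝ) * α - p| ≤ 1 / q ∧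
      |(p : ℝ) * α - r| ≤ 1 / q := by
  obtain ⟨i, hi, hNi⟩ := hpal.exists_gt (N + 1)
  have hi' : cfVal (cfPrefix a i) = ((1 : ℕ) : ℝ) * cfVal (cfPrefix a i).reverse := hi
  rw [cfVal_cfPrefix ha, cfVal_reverse_cfPrefix ha, Nat.cast_one, one_mul] at hi'
  have hP1 : (0 : ℝ) < contP a (i + 1) := by exact_mod_cast contP_pos ha _
  have hP0 : (0 : ℝ) < contP a i := by exact_mod_cast contP_pos ha _
  have hQ1 : (0 : ℝ) < contQ a (i + 1) := by exact_mod_cast contQ_succ_pos ha _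
  have hsym : contQ a (i + 1) = contP a i := by
    rw [div_eq_div_iff hQ1.ne' hP0.ne'] at hi'
    exact_mod_cast (mul_left_cancel₀ hP1.ne' hi').symm
  have hN := le_contQ_add_one ha i
  have hq : (0 : ℤ) < contQ a i := by
    have : (N : ℤ) + 1 < i := by exact_mod_cast hNi
    have := Int.natCast_nonneg N
    linarith
  have hqR : (0 : ℝ) < contQ a i := by exact_mod_cast hq
  have h01 : (contQ a i : ℝ) ≤ contQ a (i + 1) := by exact_mod_cast contQ_le_succ ha i
  have h12 : (contQ a (i + 1) : ℝ) ≤ contQ a (i + 2) := by exact_mod_cast contQ_le_succ ha _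
  refine ⟨contQ a i, contP a i, contP a (i + 1), ?_, hq, ?_, ?_, ?_⟩
  · have : (N : ℤ) + 1 < i := by exact_mod_cast hNi
    linarith
  · have h := contP_mul_contQ_sub a i
    rw [hsym] at h
    rw [show contP a i ^ 2 - contQ a i * contP a (i + 1) =
      -(contP a (i + 1) * contQ a i - contP a i * contP a i) by ring, h]
    simp
  · exact (abs_contQ_mul_sub_contP_le ha hα i).trans (one_div_le_one_div_of_le hqR h01)
  · rw [← hsym]
    exact (abs_contQ_mul_sub_contP_le ha hα (i + 1)).trans
      (one_div_le_one_div_of_le hqR (h01.trans h12))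

theorem liouville_quadratic_form {α : ℝ} (hα : IsAlgebraic ℚ α)
    (hdeg : ∀ Y : Fin 3 → ℤ, Y ≠ 0 → (Y 0 : ℝ) + α * Y 1 + α ^ 2 * Y 2 ≠ 0) :
    ∃ (d : ℕ) (c : ℝ), 0 < c ∧ ∀ (Y : Fin 3 → ℤ) (H : ℝ), Y ≠ 0 → 1 ≤ H →
      (∀ k, |(Y k : ℝ)| ≤ H) → c ≤ |(Y 0 : ℝ) + α * Y 1 + α ^ 2 * Y 2| * H ^ d := by
  classical
  obtain ⟨a, ha0, haα⟩ : ∃ a : ℤ, a ≠ 0 ∧ IsIntegral ℤ (a • α) := by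
    have h1 : IsAlgebraic ℤ α := (IsFractionRing.isAlgebraic_iff ℤ ℚ ℝ).2 hα
    obtain ⟨a, ha, h⟩ := h1.exists_integral_multiple
    exact ⟨a, ha, h⟩
  let K := IntermediateField.adjoin ℚ {α}
  have : FiniteDimensional ℚ K :=
    IntermediateField.adjoin.finiteDimensional (isAlgebraic_iff_isIntegral.1 hα)
  let g : K := IntermediateField.AdjoinSimple.gen ℚ α
  have hg : (g : ℝ) = α := IntermediateField.AdjoinSimple.coe_gen ℚ α
  have hag : IsIntegral ℤ (a • g) := by
    have h : IsIntegral ℤ ((algebraMap K ℝ) (a • g)) := by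
      have e : (algebraMap K ℝ) (a • g) = a • α := by rw [map_zsmul, ← hg]; rfl
      rw [e]
      exact haα
    exact (isIntegral_algebraMap_iff (algebraMap K ℝ).injective).1 h
  let σ₀ : K →ₐ[ℚ] ℂ := (Complex.ofRealAm.restrictScalars ℚ).comp K.val
  have hσ₀ : ∀ x : K, σ₀ x = ((x : ℝ) : ℂ) := fun x => rfl
  set B : ℝ := 1 + ∑ σ : K →ₐ[ℚ] ℂ, (a : ℝ) ^ 2 * (1 + ‖σ g‖ + ‖σ g‖ ^ 2) with hB
  have hBσ : ∀ σ : K →ₐ[ℚ] ℂ, (a : ℝ) ^ 2 * (1 + ‖σ g‖ + ‖σ g‖ ^ 2) ≤ B := by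
    intro σ
    have := single_le_sum (f := fun σ : K →ₐ[ℚ] ℂ => (a : ℝ) ^ 2 * (1 + ‖σ g‖ + ‖σ g‖ ^ 2))
      (fun i _ => by positivity) (mem_univ σ)
    rw [hB]
    linarith
  have hB1 : 1 ≤ B := by
    rw [hB]
    have : 0 ≤ ∑ σ : K →ₐ[ℚ] ℂ, (a : ℝ) ^ 2 * (1 + ‖σ g‖ + ‖σ g‖ ^ 2) :=
      sum_nonneg fun i _ => by positivity
    linarith
  set d := (univ.erase σ₀).card with hd
  have haR : (0 : ℝ) < (a : ℝ) ^ 2 := by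
    have : (a : ℝ) ≠ 0 := by exact_mod_cast ha0
    positivity
  refine ⟨d, 1 / ((a : ℝ) ^ 2 * B ^ d), by positivity, fun Y H hY hH1 hH => ?_⟩
  set ρ : K := (a : K) ^ 2 * (Y 0 + g * Y 1 + g ^ 2 * Y 2) with hρ
  have hint : IsIntegral ℤ ρ := by
    have hz : ∀ z : ℤ, IsIntegral ℤ (z : K) := fun z => isIntegral_algebraMap (R := ℤ) (x := z)
    have : ρ = (a : K) ^ 2 * Y 0 + a * (a • g) * Y 1 + (a • g) ^ 2 * Y 2 := by
      rw [hρ, zsmul_eq_mul]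
      ring
    rw [this]
    exact ((((hz a).pow 2).mul (hz _)).add (((hz a).mul hag).mul (hz _))).add
      ((hag.pow 2).mul (hz _))
  have hρR : (ρ : ℝ) = (a : ℝ) ^ 2 * ((Y 0 : ℝ) + α * Y 1 + α ^ 2 * Y 2) := by
    rw [hρ, ← hg]
    push_cast
    ring
  have hρ0 : ρ ≠ 0 := by
    intro h
    have h1 : (ρ : ℝ) = 0 := by rw [h]; rfl
    rw [hρR] at h1
    exact hdeg Y hY ((mul_eq_zero.1 h1).resolve_left haR.ne')
  obtain ⟨z, hz⟩ := IsIntegrallyClosed.isIntegral_iff.1 (Algebra.isIntegral_norm ℚ hint)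
  have hz0 : z ≠ 0 := by
    rintro rfl
    rw [map_zero] at hz
    exact hρ0 (Algebra.norm_eq_zero_iff.1 hz.symm)
  have hprod := Algebra.norm_eq_prod_embeddings ℚ ℂ ρ
  rw [← hz] at hprod
  have h1 : (1 : ℝ) ≤ ∏ σ : K →ₐ[ℚ] ℂ, ‖σ ρ‖ := by
    rw [← norm_prod, ← hprod]
    simp only [algebraMap_int_eq, eq_intCast, map_intCast, Complex.norm_intCast]
    exact_mod_cast Int.one_le_abs hz0
  have hσ : ∀ σ : K →ₐ[ℚ] ℂ, ‖σ ρ‖ ≤ B * H := by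
    intro σ
    have e : σ ρ = (a : ℂ) ^ 2 * (Y 0 + σ g * Y 1 + σ g ^ 2 * Y 2) := by
      rw [hρ]
      simp only [map_mul, map_add, map_pow, map_intCast]
    have hk : ∀ k, ‖(Y k : ℂ)‖ ≤ H := fun k => by rw [Complex.norm_intCast]; exact hH k
    have h2 : ‖(Y 0 + σ g * Y 1 + σ g ^ 2 * Y 2 : ℂ)‖ ≤ (1 + ‖σ g‖ + ‖σ g‖ ^ 2) * H := by
      refine (norm_add₃_le).trans ?_
      rw [norm_mul, norm_mul, norm_pow]
      have := mul_le_mul_of_nonneg_left (hk 1) (norm_nonneg (σ g))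
      have := mul_le_mul_of_nonneg_left (hk 2) (sq_nonneg ‖σ g‖)
      linarith [hk 0]
    rw [e, norm_mul, norm_pow, Complex.norm_intCast, sq_abs]
    calc (a : ℝ) ^ 2 * _ ≤ (a : ℝ) ^ 2 * ((1 + ‖σ g‖ + ‖σ g‖ ^ 2) * H) :=
          mul_le_mul_of_nonneg_left h2 haR.le
      _ = (a : ℝ) ^ 2 * (1 + ‖σ g‖ + ‖σ g‖ ^ 2) * H := by ring
      _ ≤ B * H := mul_le_mul_of_nonneg_right (hBσ σ) (zero_le_one.trans hH1)
  have h2 : ‖σ₀ ρ‖ = (a : ℝ) ^ 2 * |(Y 0 : ℝ) + α * Y 1 + α ^ 2 * Y 2| := by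
    rw [hσ₀, Complex.norm_real, hρR, norm_mul, Real.norm_eq_abs, Real.norm_eq_abs,
      abs_of_pos haR]
  rw [← mul_prod_erase univ _ (mem_univ σ₀), h2] at h1
  have h3 : ∏ σ ∈ univ.erase σ₀, ‖σ ρ‖ ≤ (B * H) ^ d := by
    rw [hd, ← prod_const]
    exact prod_le_prod (fun _ _ => norm_nonneg _) fun σ _ => hσ σ
  have hB0 : (0 : ℝ) < (a : ℝ) ^ 2 * B ^ d := mul_pos haR (pow_pos (zero_lt_one.trans_le hB1) d)
  rw [div_le_iff₀ hB0]
  refine h1.trans ((mul_le_mul_of_nonneg_left h3 (mul_nonneg haR.le (abs_nonneg _))).trans_eq ?_)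
  rw [mul_pow]
  ring

theorem exists_orthogonal_vector {q p r : ℤ} (hq : 0 < q) (hdet : |p ^ 2 - q * r| = 1) {n : ℕ}
    (hn : 0 < n) : ∃ Y : Fin 3 → ℤ, 0 < Y 2 ∧ Y 2 ≤ n ∧ q * Y 0 + p * Y 1 + r * Y 2 = 0 ∧
      |(Y 1 : ℝ)| ≤ q / (n + 1) := by
  have hqR : (0 : ℝ) < q := by exact_mod_cast hq
  set ε := p ^ 2 - q * r with hε
  have hεε : ε * ε = 1 := by rw [← abs_mul_abs_self, hdet, one_mul]
  obtain ⟨j, k, hk0, hkn, h⟩ := Real.exists_int_int_abs_mul_sub_le (((-(ε * p * r) : ℤ) : ℝ) / q) hn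
  refine ⟨![ε * r ^ 2 * k + p * j, -(ε * p * r) * k - j * q, k], by simpa, by simpa, ?_, ?_⟩
  · simp only [Matrix.cons_val_zero, Matrix.cons_val_one, Matrix.cons_val]
    linear_combination (- (r * k)) * hεε - ε * r * k * hε
  · simp only [Matrix.cons_val_one]
    have e : ((-(ε * p * r) * k - j * q : ℤ) : ℝ) =
        q * (k * (((-(ε * p * r) : ℤ) : ℝ) / q) - j) := by
      push_cast
      field_simp
    rw [Matrix.cons_val_zero, e, abs_mul, abs_of_pos hqR]
    calc (q : ℝ) * _ ≤ q * (1 / (n + 1)) := mul_le_mul_of_nonneg_left h hqR.le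
      _ = _ := by ring

theorem exists_minimal_pair {q p r : ℤ} (hq : 0 < q) (hdet : |p ^ 2 - q * r| = 1) {A : ℝ}
    (hA : 1 ≤ A) : ∃ y : Fin 3 → ℤ, q * y 0 + p * y 1 + r * y 2 = 0 ∧
      (y 1 ≠ 0 ∨ y 2 ≠ 0) ∧ |(y 2 : ℝ)| ≤ A ∧ |(y 1 : ℝ)| ≤ q / A ∧
      (y 1 ≠ 0 → ∃ z : Fin 3 → ℤ, q * z 0 + p * z 1 + r * z 2 = 0 ∧
        y 1 * z 2 - y 2 * z 1 ≠ 0 ∧ |(z 1 : ℝ)| ≤ |(y 1 : ℝ)| ∧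
        |(z 2 : ℝ)| ≤ q / |(y 1 : ℝ)|) := by
  classical
  have hqR : (0 : ℝ) < q := by exact_mod_cast hq
  have hA0 : 0 < A := zero_lt_one.trans_le hA
  let S : ℕ → Prop := fun n => ∃ Y : Fin 3 → ℤ, q * Y 0 + p * Y 1 + r * Y 2 = 0 ∧
    (Y 1 ≠ 0 ∨ Y 2 ≠ 0) ∧ |(Y 2 : ℝ)| ≤ A ∧ (Y 1).natAbs = n
  have hfl : 0 < ⌊A⌋₊ := Nat.floor_pos.2 hA
  obtain ⟨Y, hY0, hYn, hYx, hY1⟩ := exists_orthogonal_vector hq hdet hfl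
  have hYS : S (Y 1).natAbs := by
    refine ⟨Y, hYx, Or.inr hY0.ne', ?_, rfl⟩
    have h1 : (Y 2 : ℝ) ≤ ⌊A⌋₊ := by exact_mod_cast hYn
    have h2 : (0 : ℝ) < Y 2 := by exact_mod_cast hY0
    rw [abs_of_pos h2]
    exact h1.trans (Nat.floor_le hA0.le)
  have hS : ∃ n, S n := ⟨_, hYS⟩
  obtain ⟨y, hyx, hy0, hyA, hyn⟩ := Nat.find_spec hS
  have hcast : ∀ z : ℤ, |(z : ℝ)| = (z.natAbs : ℝ) := fun z => by
    rw [Nat.cast_natAbs, Int.cast_abs]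
  refine ⟨y, hyx, hy0, hyA, ?_, fun hy1 => ?_⟩
  · have h1 : (y 1).natAbs ≤ (Y 1).natAbs := hyn ▸ Nat.find_min' hS hYS
    calc |(y 1 : ℝ)| = ((y 1).natAbs : ℝ) := hcast _
      _ ≤ (Y 1).natAbs := by exact_mod_cast h1
      _ = |(Y 1 : ℝ)| := (hcast _).symm
      _ ≤ _ := hY1
      _ ≤ q / A := div_le_div_of_nonneg_left hqR.le hA0 (Nat.lt_floor_add_one A).le
  · have hs0 : (0 : ℝ) < |(y 1 : ℝ)| := abs_pos.2 (by exact_mod_cast hy1)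
    have hsq : |(y 1 : ℝ)| ≤ q := by
      have h1 : (y 1).natAbs ≤ q.natAbs := by
        rw [hyn]
        refine Nat.find_min' hS ⟨![-p, q, 0], ?_, Or.inl ?_, ?_, ?_⟩
        · simp; ring
        · simpa using hq.ne'
        · simpa using hA0.le
        · simp
      calc |(y 1 : ℝ)| = ((y 1).natAbs : ℝ) := hcast _
        _ ≤ q.natAbs := by exact_mod_cast h1
        _ = |(q : ℝ)| := (hcast _).symm
        _ = q := abs_of_pos hqR
    have hn : 0 < ⌊(q : ℝ) / |(y 1 : ℝ)|⌋₊ := Nat.floor_pos.2 ((one_le_div hs0).2 hsq)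
    obtain ⟨z, hz0, hzn, hzx, hz1⟩ := exists_orthogonal_vector hq hdet hn
    have hz2R : (0 : ℝ) < z 2 := by exact_mod_cast hz0
    have hlt : |(z 1 : ℝ)| < |(y 1 : ℝ)| := by
      refine hz1.trans_lt ?_
      rw [div_lt_iff₀ (by positivity), ← div_lt_iff₀' hs0]
      exact Nat.lt_floor_add_one _
    have hzA : A < |(z 2 : ℝ)| := by
      by_contra! hcon
      have h1 : S (z 1).natAbs := ⟨z, hzx, Or.inr hz0.ne', hcon, rfl⟩
      have h2 : (y 1).natAbs ≤ (z 1).natAbs := hyn ▸ Nat.find_min' hS h1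
      rw [hcast, hcast] at hlt
      exact absurd h2 (not_le.2 (by exact_mod_cast hlt))
    refine ⟨z, hzx, ?_, hlt.le, ?_⟩
    · intro h
      have h1 : (y 1 : ℝ) * z 2 = y 2 * z 1 := by exact_mod_cast sub_eq_zero.1 h
      have h2 : |(y 1 : ℝ)| * |(z 2 : ℝ)| = |(y 2 : ℝ)| * |(z 1 : ℝ)| := by
        rw [← abs_mul, ← abs_mul, h1]
      have h3 : |(y 2 : ℝ)| * |(z 1 : ℝ)| ≤ A * |(y 1 : ℝ)| :=
        mul_le_mul hyA hlt.le (abs_nonneg _) hA0.le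
      nlinarith
    · rw [abs_of_pos hz2R]
      have h1 : (z 2 : ℝ) ≤ (⌊(q : ℝ) / |(y 1 : ℝ)|⌋₊ : ℝ) := by exact_mod_cast hzn
      exact h1.trans (Nat.floor_le (by positivity))

/-- The linear forms `Y₀ + αY₁ + α²Y₂`, `Y₁`, `Y₂`. -/
def linForm (α : ℝ) (Y : Fin 3 → ℤ) : Fin 3 → ℝ :=
  ![(Y 0 : ℝ) + α * Y 1 + α ^ 2 * Y 2, Y 1, Y 2]

theorem abs_linForm_zero_le {α : ℝ} {q p r : ℤ} (hq : 0 < q) (h1 : |(q : ℝ) * α - p| ≤ 1 / q)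
    (h2 : |(p : ℝ) * α - r| ≤ 1 / q) {Y : Fin 3 → ℤ} (hY : q * Y 0 + p * Y 1 + r * Y 2 = 0) :
    |linForm α Y 0| ≤ (|α| + 1) * (|(Y 1 : ℝ)| + |(Y 2 : ℝ)|) / (q : ℝ) ^ 2 := by
  have hqR : (0 : ℝ) < q := by exact_mod_cast hq
  have hYR : (q : ℝ) * Y 0 + p * Y 1 + r * Y 2 = 0 := by exact_mod_cast hY
  have h3 : |(q : ℝ) * α ^ 2 - r| ≤ (|α| + 1) / q := by
    have e : (q : ℝ) * α ^ 2 - r = α * (q * α - p) + (p * α - r) := by ring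
    rw [e]
    refine (abs_add_le _ _).trans ?_
    rw [abs_mul]
    calc _ ≤ |α| * (1 / q) + 1 / q :=
          add_le_add (mul_le_mul_of_nonneg_left h1 (abs_nonneg _)) h2
      _ = _ := by ring
  have e : linForm α Y 0 = ((q * α - p) * Y 1 + (q * α ^ 2 - r) * Y 2) / q := by
    rw [linForm, Matrix.cons_val_zero, eq_div_iff hqR.ne']
    linear_combination hYR
  rw [e, abs_div, abs_of_pos hqR, div_le_div_iff₀ hqR (by positivity)]
  have h4 : |((q : ℝ) * α - p) * Y 1 + (q * α ^ 2 - r) * Y 2| ≤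
      (|α| + 1) / q * (|(Y 1 : ℝ)| + |(Y 2 : ℝ)|) := by
    refine (abs_add_le _ _).trans ?_
    rw [abs_mul, abs_mul, mul_add]
    refine add_le_add (mul_le_mul_of_nonneg_right (h1.trans ?_) (abs_nonneg _))
      (mul_le_mul_of_nonneg_right h3 (abs_nonneg _))
    gcongr
    linarith [abs_nonneg α]
  calc _ ≤ (|α| + 1) / q * (|(Y 1 : ℝ)| + |(Y 2 : ℝ)|) * (q : ℝ) ^ 2 := by gcongr
    _ = _ := by field_simp

theorem exists_small_vectors {α : ℝ} (hα : IsAlgebraic ℚ α)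
    (hdeg : ∀ Y : Fin 3 → ℤ, Y ≠ 0 → (Y 0 : ℝ) + α * Y 1 + α ^ 2 * Y 2 ≠ 0) :
    ∃ η : ℝ, 0 < η ∧ η ≤ 1 ∧ ∃ N : ℝ, ∀ q p r : ℤ, 0 < q → N ≤ q → |p ^ 2 - q * r| = 1 →
      |(q : ℝ) * α - p| ≤ 1 / q → |(p : ℝ) * α - r| ≤ 1 / q →
      ∃ (y z : Fin 3 → ℤ) (e : Fin 3 → ℝ), (∀ k, |e k| ≤ 2) ∧ ∑ k, e k ≤ -η ∧
        q * y 0 + p * y 1 + r * y 2 = 0 ∧ q * z 0 + p * z 1 + r * z 2 = 0 ∧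
        y 1 * z 2 - y 2 * z 1 ≠ 0 ∧
        (∀ k, |linForm α y k| ≤ (q : ℝ) ^ e k) ∧ (∀ k, |linForm α z k| ≤ (q : ℝ) ^ e k) ∧
        ∀ k, |linForm α ![-r, p, 0] k| ≤ (q : ℝ) ^ (e k + 4) := by
  obtain ⟨d, c, hc, hL⟩ := liouville_quadratic_form hα hdeg
  set δ : ℝ := 1 / (d + 2) with hδ
  have hδ0 : 0 < δ := by positivity
  have hδ1 : δ ≤ 1 / 2 := by
    rw [hδ]
    exact one_div_le_one_div_of_le (by norm_num) (by linarith [Nat.cast_nonneg (α := ℝ) d])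
  set B : ℝ := |α| + 1 with hB
  have hB1 : 1 ≤ B := by linarith [abs_nonneg α]
  set K : ℝ := 2 * B + |α| + |α| ^ 2 with hK
  have hK1 : 1 ≤ K := by nlinarith [abs_nonneg α]
  refine ⟨δ / 2, by positivity, by linarith, max (2 * B) (max (2 * B * K ^ d / c + 1)
    ((2 * B) ^ (2 / δ))), fun q p r hq hN hdet h1 h2 => ?_⟩
  have hN1 : 2 * B ≤ q := (le_max_left _ _).trans hN
  have hN2 : 2 * B * K ^ d / c + 1 ≤ q := (le_max_left _ _).trans ((le_max_right _ _).trans hN)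
  have hN3 : (2 * B) ^ (2 / δ) ≤ (q : ℝ) := (le_max_right _ _).trans ((le_max_right _ _).trans hN)
  set Q : ℝ := (q : ℝ) with hQ
  have hQ1 : 1 ≤ Q := by linarith
  have hQ0 : 0 < Q := by linarith
  set A : ℝ := Q ^ δ with hA
  have hA1 : 1 ≤ A := Real.one_le_rpow hQ1 hδ0.le
  have hA0 : 0 < A := by linarith
  have hBA : 2 * B ≤ Q ^ (δ / 2) := by
    calc 2 * B = ((2 * B) ^ (2 / δ)) ^ (δ / 2) := by
          rw [← Real.rpow_mul (by linarith), div_mul_div_comm, mul_comm 2 δ, div_self (by positivity),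
            Real.rpow_one]
      _ ≤ _ := Real.rpow_le_rpow (by positivity) hN3 (by positivity)
  have hAd : A ^ (d + 1) ≤ Q := by
    rw [hA, ← Real.rpow_natCast, ← Real.rpow_mul hQ0.le]
    calc Q ^ (δ * ((d + 1 : ℕ) : ℝ)) ≤ Q ^ (1 : ℝ) := by
          refine Real.rpow_le_rpow_of_exponent_le hQ1 ?_
          rw [hδ, one_div_mul_eq_div, div_le_one (by positivity)]
          push_cast
          linarith
      _ = Q := Real.rpow_one Q
  obtain ⟨y, hyx, hy0, hy2, hy1, hz⟩ := exists_minimal_pair hq hdet hA1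
  have hAy : A < |(y 1 : ℝ)| := by
    by_contra! hcon
    have h3 := abs_linForm_zero_le hq h1 h2 hyx
    have h4 : |linForm α y 0| ≤ 2 * B * A / Q ^ 2 := by
      refine h3.trans ?_
      refine div_le_div_of_nonneg_right ?_ (by positivity)
      nlinarith
    have h5 : |linForm α y 0| ≤ 2 * B * A := by
      refine h4.trans (div_le_self (by positivity) (one_le_pow₀ hQ1))
    have h6 : |(y 0 : ℝ)| ≤ K * A := by
      have e : (y 0 : ℝ) = linForm α y 0 - α * y 1 - α ^ 2 * y 2 := by
        rw [linForm, Matrix.cons_val_zero]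
        ring
      rw [e]
      refine (abs_sub _ _).trans ((add_le_add_left (abs_sub _ _) _).trans ?_)
      rw [abs_mul, abs_mul, abs_pow]
      have := mul_le_mul_of_nonneg_left hcon (abs_nonneg α)
      have := mul_le_mul_of_nonneg_left hy2 (sq_nonneg |α|)
      rw [hK]
      nlinarith
    have hKA : A ≤ K * A := le_mul_of_one_le_left hA0.le hK1
    have h7 := hL y (K * A) (by rintro rfl; simp at hy0) (hA1.trans hKA) (by
      intro k
      fin_cases k
      · exact h6
      · exact hcon.trans hKA
      · exact hy2.trans hKA)
    have h8 : c ≤ 2 * B * K ^ d / Q := by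
      calc c ≤ |linForm α y 0| * (K * A) ^ d := h7
        _ ≤ 2 * B * A / Q ^ 2 * (K * A) ^ d := by gcongr
        _ = 2 * B * K ^ d * A ^ (d + 1) / Q ^ 2 := by rw [mul_pow, pow_succ]; ring
        _ ≤ 2 * B * K ^ d * Q / Q ^ 2 := by gcongr
        _ = _ := by field_simp
    rw [le_div_iff₀ hQ0] at h8
    have h9 : 2 * B * K ^ d / c < Q := by linarith
    rw [div_lt_iff₀ hc] at h9
    linarith
  have hs0 : 0 < |(y 1 : ℝ)| := hA0.trans hAy
  obtain ⟨z, hzx, hyz, hz1, hz2⟩ := hz (by simpa using hs0)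
  set s : ℝ := |(y 1 : ℝ)| with hs
  set l : ℝ := Real.logb Q s with hl
  have hQne : 1 < Q := by linarith
  have hQl : Q ^ l = s := Real.rpow_logb hQ0 hQne.ne' hs0
  have hQl' : Q ^ (1 - l) = Q / s := by rw [Real.rpow_sub hQ0, Real.rpow_one, hQl]
  have hsQ : s ≤ Q := hy1.trans (div_le_self hQ0.le hA1)
  have hl0 : 0 ≤ l := Real.logb_nonneg hQne (hA1.trans hAy.le)
  have hl1 : l ≤ 1 := by
    rw [hl, Real.logb_le_iff_le_rpow hQne hs0, Real.rpow_one]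
    exact hsQ
  have hy2' : |(y 2 : ℝ)| ≤ Q / s := by
    refine hy2.trans ?_
    rw [le_div_iff₀ hs0, mul_comm, ← le_div_iff₀ hA0]
    exact hy1
  have hQA : Q / s ≤ Q / A := div_le_div_of_nonneg_left hQ0.le hA0 hAy.le
  have hzero : ∀ Y : Fin 3 → ℤ, q * Y 0 + p * Y 1 + r * Y 2 = 0 → |(Y 1 : ℝ)| ≤ s →
      |(Y 2 : ℝ)| ≤ Q / s → |linForm α Y 0| ≤ Q ^ (-1 - δ / 2) := by
    intro Y hY hY1 hY2
    refine (abs_linForm_zero_le hq h1 h2 hY).trans ?_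
    have e : Q ^ (-1 - δ / 2) = Q ^ (δ / 2) / (Q * A) := by
      rw [hA, ← Real.rpow_one_add' hQ0.le (by positivity), ← Real.rpow_sub hQ0]
      congr 1
      ring
    rw [e]
    calc B * (|(Y 1 : ℝ)| + |(Y 2 : ℝ)|) / Q ^ 2 ≤ B * (Q / A + Q / A) / Q ^ 2 := by
          have := hY1.trans hy1
          have := hY2.trans hQA
          gcongr
      _ = 2 * B / (Q * A) := by
          rw [div_eq_div_iff (by positivity) (by positivity)]; field_simp; norm_num
      _ ≤ _ := by gcongr
  refine ⟨y, z, ![-1 - δ / 2, l, 1 - l], ?_, ?_, hyx, hzx, hyz, ?_, ?_, ?_⟩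
  · intro k
    fin_cases k
    · simp only [Fin.zero_eta, Matrix.cons_val_zero]
      rw [abs_le]; constructor <;> linarith
    · simp only [Fin.mk_one, Matrix.cons_val_one, Matrix.cons_val_zero]
      rw [abs_le]; constructor <;> linarith
    · simp only [Fin.reduceFinMk, Matrix.cons_val]
      rw [abs_le]; constructor <;> linarith
  · rw [Fin.sum_univ_three]
    simp only [Matrix.cons_val_zero, Matrix.cons_val_one, Matrix.cons_val]
    linarith
  · intro k
    fin_cases k
    · exact hzero y hyx le_rfl hy2'
    · exact hQl.ge
    · exact hy2'.trans hQl'.ge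
  · intro k
    fin_cases k
    · exact hzero z hzx hz1 hz2
    · exact hz1.trans hQl.ge
    · exact hz2.trans hQl'.ge
  · intro k
    fin_cases k
    · have e : linForm α ![-r, p, 0] 0 = p * α - r := by
        simp [linForm]
        ring_nf
      change |linForm α ![-r, p, 0] 0| ≤ Q ^ (-1 - δ / 2 + 4)
      rw [e]
      calc |(p : ℝ) * α - r| ≤ 1 / Q := h2
        _ ≤ 1 := (div_le_one hQ0).2 hQ1
        _ ≤ _ := Real.one_le_rpow hQ1 (by linarith)
    · have e : linForm α ![-r, p, 0] 1 = p := by simp [linForm]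
      change |linForm α ![-r, p, 0] 1| ≤ Q ^ (l + 4)
      rw [e]
      have h3 : |(p : ℝ)| ≤ Q ^ 2 := by
        have e : (p : ℝ) = Q * α - (Q * α - p) := by ring
        rw [e]
        refine (abs_sub _ _).trans ?_
        rw [abs_mul, abs_of_pos hQ0]
        have : (1 : ℝ) / Q ≤ 1 := (div_le_one hQ0).2 hQ1
        nlinarith
      refine h3.trans ?_
      rw [← Real.rpow_natCast]
      refine Real.rpow_le_rpow_of_exponent_le hQ1 ?_
      push_cast
      linarith
    · have e : linForm α ![-r, p, 0] 2 = 0 := by simp [linForm]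
      change |linForm α ![-r, p, 0] 2| ≤ Q ^ (1 - l + 4)
      rw [e, abs_zero]
      positivity

/-- The polynomial obtained from `P` by writing the variables of each block in terms of the
vectors `v h 0`, `v h 1`, `v h 2` and scaling by `a ^ 2`. -/
noncomputable def blockChange {m : ℕ} (a : ℤ) (v : Fin m → Fin 3 → Fin 3 → ℤ)
    (P : MvPolynomial (Fin m × Fin 3) ℤ) : MvPolynomial (Fin m × Fin 3) ℤ :=
  MvPolynomial.aeval (fun x => MvPolynomial.C (a ^ 2) *
    ∑ i, MvPolynomial.C (v x.1 i x.2) * MvPolynomial.X (x.1, i)) P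

lemma sum_mul_sum_le {m : ℕ} {r : Fin m → ℕ} (hr : ∀ h, 0 < r h) {e : Fin m → Fin 3 → ℝ}
    {η R : ℝ} (hR : 0 < R) {l : Fin m → ℝ} (hl1 : ∀ h, R ≤ r h * l h)
    (hl2 : ∀ h, r h * l h ≤ (1 + η / 24) * R) (he : ∀ h k, |e h k| ≤ 2)
    {c : Fin m → Fin 3 → ℕ} (hc : ∀ h, ∑ k, c h k = r h)
    (hcw : blockWt r e c ≤ -(m * η / 6)) :
    ∑ h, ∑ k, l h * e h k * c h k ≤ -(m * R * η / 12) := by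
  have h1 : ∀ h, ∑ k, l h * e h k * c h k = r h * l h * ∑ k, e h k * (c h k / r h) := by
    intro h
    have hrh : (r h : ℝ) ≠ 0 := by exact_mod_cast (hr h).ne'
    rw [mul_sum]
    refine sum_congr rfl fun k _ => ?_
    field_simp
  have h2 : ∀ h, r h * l h * ∑ k, e h k * (c h k / r h) ≤
      R * ∑ k, e h k * ((c h k : ℝ) / r h) + η / 12 * R := by
    intro h
    have h3 := abs_le.1 (abs_sum_div_le (hr h) (he h) (hc h))
    have h4 := hl1 h
    have h5 := hl2 h
    nlinarith
  calc ∑ h, ∑ k, l h * e h k * c h k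
      ≤ ∑ h, (R * ∑ k, e h k * ((c h k : ℝ) / r h) + η / 12 * R) :=
        sum_le_sum fun h _ => (h1 h).trans_le (h2 h)
    _ = R * blockWt r e c + m * (η / 12 * R) := by
        rw [sum_add_distrib, ← mul_sum, sum_const, card_univ, Fintype.card_fin, nsmul_eq_mul,
          blockWt]
    _ ≤ R * (-(m * η / 6)) + m * (η / 12 * R) := by gcongr
    _ = _ := by ring

theorem blockChange_coeff_eq_zero {m : ℕ} {α η R C : ℝ} {a : ℤ} (ha : a ≠ 0) (hm : 0 < m)
    (hη : 0 < η) (hη1 : η ≤ 1) (hR : 0 < R) (hC : 1 ≤ C) {r : Fin m → ℕ} (hr : ∀ h, 0 < r h)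
    {e : Fin m → Fin 3 → ℝ} (he : ∀ h k, |e h k| ≤ 2) {q : Fin m → ℝ} (hq : ∀ h, 0 < q h)
    (hl1 : ∀ h, R ≤ r h * Real.log (q h))
    (hl2 : ∀ h, r h * Real.log (q h) ≤ (1 + η / 24) * R)
    (hD : (∑ h, (r h : ℝ)) * Real.log (3 * (a : ℝ) ^ 2 * C) ≤ m * R * η / 48)
    {v : Fin m → Fin 3 → Fin 3 → ℤ}
    (hv : ∀ h i k, |linForm α (v h i) k| ≤ q h ^ (e h k + if i = 2 then 4 else 0))
    {P : MvPolynomial (Fin m × Fin 3) ℤ} {Q : MvPolynomial (Fin m × Fin 3) ℝ}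
    (hQ : mvNorm (normRingSeminorm ℝ) (fun _ => 1) (fun _ => zero_le_one) Q ≤ C ^ ∑ h, r h)
    (hQs : ∀ c ∈ Q.support, (∀ h, ∑ k, c (h, k) = r h) ∧
      blockWt r e (fun h k => c (h, k)) ≤ -(m * η / 6))
    (hPQ : ∀ (A : Type) [CommRing A] [Algebra ℝ A] (Y : Fin m × Fin 3 → A),
      MvPolynomial.aeval (fun x => algebraMap ℝ A ((a : ℝ) ^ 2) * Y x) P =
        MvPolynomial.aeval (fun x => if x.2 = 0 then algebraMap ℝ A ((a : ℝ) ^ 2) *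
          (Y (x.1, 0) + algebraMap ℝ A α * Y (x.1, 1) + algebraMap ℝ A (α ^ 2) * Y (x.1, 2))
          else Y x) Q)
    {n : Fin m × Fin 3 →₀ ℕ} (hn : ∑ h, (n (h, 2) : ℝ) / r h < m * η / 256) :
    (blockChange a v P).coeff n = 0 := by
  classical
  have haR : (1 : ℝ) ≤ (a : ℝ) ^ 2 := by
    have : 1 ≤ a ^ 2 := by have := pow_pos (abs_pos.2 ha) 2; rwa [sq_abs] at this
    exact_mod_cast this
  set ω : Fin m × Fin 3 → ℝ := fun x => if x.2 = 2 then q x.1 ^ (-4 : ℝ) else 1 with hω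
  have hω0 : ∀ x, 0 ≤ ω x := fun x => by
    rw [hω]; dsimp only; split_ifs
    · exact (Real.rpow_pos_of_pos (hq _) _).le
    · exact zero_le_one
  set μ := mvNorm (normRingSeminorm ℝ) ω hω0 with hμ
  have hμC : ∀ b : ℝ, μ (MvPolynomial.C b) = |b| := fun b => by
    rw [hμ, mvNorm_C]; rfl
  have hμ1 : μ 1 ≤ 1 := by
    rw [← MvPolynomial.C_1, hμC, abs_one]
  have hμX : ∀ x, μ (MvPolynomial.X x) = ω x := fun x => by
    rw [hμ, mvNorm_X]
    change ‖(1 : ℝ)‖ * _ = _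
    rw [norm_one, one_mul]
  set Y : Fin m × Fin 3 → MvPolynomial (Fin m × Fin 3) ℝ := fun x =>
    ∑ i, MvPolynomial.C (v x.1 i x.2 : ℝ) * MvPolynomial.X (x.1, i) with hY
  set g : Fin m × Fin 3 → MvPolynomial (Fin m × Fin 3) ℝ := fun x =>
    if x.2 = 0 then algebraMap ℝ (MvPolynomial (Fin m × Fin 3) ℝ) ((a : ℝ) ^ 2) *
          (Y (x.1, 0) + algebraMap ℝ _ α * Y (x.1, 1) + algebraMap ℝ _ (α ^ 2) * Y (x.1, 2))
          else Y x with hg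
  have hG : (blockChange a v P).map (Int.castRingHom ℝ) = MvPolynomial.aeval g Q := by
    rw [hg, ← hPQ _ Y, blockChange]
    have h1 := MvPolynomial.comp_aeval_apply (R := ℤ)
      (f := fun x : Fin m × Fin 3 => MvPolynomial.C (a ^ 2) *
        ∑ i, MvPolynomial.C (v x.1 i x.2) * MvPolynomial.X (x.1, i))
      (MvPolynomial.map (σ := Fin m × Fin 3) (Int.castRingHom ℝ)).toIntAlgHom P
    refine h1.trans ?_
    refine congrArg (fun f => MvPolynomial.aeval f P) (funext fun x => ?_)
    simp [hY, MvPolynomial.algebraMap_eq]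
  have hlin : ∀ h k, μ (∑ i, MvPolynomial.C (linForm α (v h i) k) * MvPolynomial.X (h, i)) ≤
      3 * q h ^ e h k := by
    intro h k
    refine (μ.sum_le' _ _).trans ?_
    calc _ ≤ ∑ i : Fin 3, q h ^ e h k := by
          refine sum_le_sum fun i _ => (map_mul_le_mul μ _ _).trans ?_
          rw [hμC, hμX]
          refine (mul_le_mul_of_nonneg_right (hv h i k) (hω0 _)).trans_eq ?_
          rw [hω]
          dsimp only
          split_ifs
          · rw [← Real.rpow_add (hq h)]
            congr 1
            ring
          · rw [add_zero, mul_one]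
      _ = _ := by simp
  have hgB : ∀ x, μ (g x) ≤ 3 * (a : ℝ) ^ 2 * q x.1 ^ e x.1 x.2 := by
    rintro ⟨h, k⟩
    have hqe : 0 ≤ q h ^ e h k := (Real.rpow_pos_of_pos (hq h) _).le
    by_cases hk : k = 0
    · subst hk
      have e1 : g (h, 0) = MvPolynomial.C ((a : ℝ) ^ 2) *
          ∑ i, MvPolynomial.C (linForm α (v h i) 0) * MvPolynomial.X (h, i) := by
        simp only [hg, if_true, MvPolynomial.algebraMap_eq, hY, mul_sum, ← sum_add_distrib]
        refine sum_congr rfl fun i _ => ?_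
        simp only [linForm, Matrix.cons_val_zero, map_add, map_mul]
        ring
      rw [e1]
      refine (map_mul_le_mul μ _ _).trans ?_
      rw [hμC, abs_of_nonneg (by positivity)]
      refine (mul_le_mul_of_nonneg_left (hlin h 0) (by positivity)).trans_eq ?_
      ring
    · have e1 : g (h, k) = ∑ i, MvPolynomial.C (linForm α (v h i) k) * MvPolynomial.X (h, i) := by
        simp only [hg, hk, if_false, hY]
        refine sum_congr rfl fun i _ => ?_
        congr 2
        fin_cases k
        · exact absurd rfl hk
        · rfl
        · rfl
      rw [e1]
      refine (hlin h k).trans ?_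
      have : 0 ≤ (a ^ 2 - 1) * q h ^ e h k := mul_nonneg (by linarith) hqe
      nlinarith
  set D := ∑ h, r h with hDdef
  have hexp : ∀ c ∈ Q.support, expWt (fun x => μ (g x)) c ≤
      (3 * (a : ℝ) ^ 2) ^ D * Real.exp (-(m * R * η / 12)) := by
    intro c hc
    obtain ⟨hc1, hc2⟩ := hQs c hc
    refine (expWt_mono (fun x => apply_nonneg μ _) hgB c).trans ?_
    rw [expWt_eq_prod]
    simp only [mul_pow (3 * (a : ℝ) ^ 2)]
    rw [prod_mul_distrib, prod_pow_eq_pow_sum, Fintype.sum_prod_type]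
    have e1 : ∑ h, ∑ k, c (h, k) = D := sum_congr rfl fun h _ => hc1 h
    rw [e1]
    refine mul_le_mul_of_nonneg_left ?_ (by positivity)
    have e2 : ∏ x : Fin m × Fin 3, (q x.1 ^ e x.1 x.2) ^ c x =
        Real.exp (∑ h, ∑ k, Real.log (q h) * e h k * c (h, k)) := by
      rw [← Fintype.sum_prod_type' (f := fun h k => Real.log (q h) * e h k * c (h, k)),
        Real.exp_sum]
      refine prod_congr rfl fun x _ => ?_
      rw [mul_comm (_ * _), Real.exp_nat_mul, Real.rpow_def_of_pos (hq _)]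
    rw [e2]
    exact Real.exp_le_exp.2 (sum_mul_sum_le hr hR hl1 hl2 he hc1 hc2)
  have hμG : μ (MvPolynomial.aeval g Q) ≤ Real.exp (-(m * R * η / 16)) := by
    refine (μ.eval₂_le hμ1 (algebraMap ℝ _) g Q).trans ?_
    calc _ ≤ ∑ c ∈ Q.support, ‖Q.coeff c‖ *
            ((3 * (a : ℝ) ^ 2) ^ D * Real.exp (-(m * R * η / 12))) := by
          refine sum_le_sum fun c hc => ?_
          rw [MvPolynomial.algebraMap_eq, hμC]
          exact mul_le_mul_of_nonneg_left (hexp c hc) (abs_nonneg _)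
      _ = mvNorm (normRingSeminorm ℝ) (fun _ => 1) (fun _ => zero_le_one) Q *
            ((3 * (a : ℝ) ^ 2) ^ D * Real.exp (-(m * R * η / 12))) := by
          rw [← sum_mul, mvNorm_apply]
          congr 1
          refine sum_congr rfl fun c _ => ?_
          rw [expWt_one, mul_one]
          rfl
      _ ≤ C ^ D * ((3 * (a : ℝ) ^ 2) ^ D * Real.exp (-(m * R * η / 12))) := by
          gcongr
      _ = Real.exp (D * Real.log (3 * (a : ℝ) ^ 2 * C)) * Real.exp (-(m * R * η / 12)) := by
          rw [Real.exp_nat_mul, Real.exp_log (by positivity), mul_pow (3 * (a : ℝ) ^ 2) C]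
          ring
      _ ≤ Real.exp (m * R * η / 48) * Real.exp (-(m * R * η / 12)) := by
          gcongr
          rw [hDdef]
          push_cast
          exact hD
      _ = _ := by
          rw [← Real.exp_add]
          congr 1
          ring
  have hcoef := (coeff_le_mvNorm (normRingSeminorm ℝ) ω hω0 (MvPolynomial.aeval g Q) n).trans hμG
  rw [← hG, MvPolynomial.coeff_map] at hcoef
  have hexpn : Real.exp (-(m * R * η / 32)) ≤ expWt ω n := by
    rw [expWt_eq_prod, Fintype.prod_prod_type]
    have e1 : ∀ h, ∏ k, ω (h, k) ^ n (h, k) = Real.exp (-(4 * Real.log (q h) * n (h, 2))) := by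
      intro h
      rw [Fin.prod_univ_three]
      simp only [hω, Fin.isValue, Fin.reduceEq, if_false, if_true, one_pow, one_mul]
      rw [Real.rpow_def_of_pos (hq h), ← Real.exp_nat_mul]
      congr 1
      ring
    simp only [e1]
    rw [← Real.exp_sum]
    refine Real.exp_le_exp.2 ?_
    rw [sum_neg_distrib]
    refine neg_le_neg ?_
    calc ∑ h, 4 * Real.log (q h) * n (h, 2) ≤ ∑ h, 8 * R * ((n (h, 2) : ℝ) / r h) := by
          refine sum_le_sum fun h _ => ?_
          have hrh : (0 : ℝ) < r h := by exact_mod_cast hr h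
          have h1 : Real.log (q h) ≤ 2 * R / r h := by
            rw [le_div_iff₀ hrh]
            have := hl2 h
            nlinarith
          calc 4 * Real.log (q h) * n (h, 2) ≤ 4 * (2 * R / r h) * n (h, 2) := by gcongr
            _ = _ := by ring
      _ = 8 * R * ∑ h, (n (h, 2) : ℝ) / r h := by rw [mul_sum]
      _ ≤ 8 * R * (m * η / 256) := by gcongr
      _ = _ := by ring
  have hlt : |(((blockChange a v P).coeff n : ℤ) : ℝ)| < 1 := by
    by_contra! hcon
    have h1 : Real.exp (-(m * R * η / 32)) ≤ Real.exp (-(m * R * η / 16)) := by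
      refine le_trans ?_ hcoef
      calc Real.exp (-(m * R * η / 32)) = 1 * Real.exp (-(m * R * η / 32)) := (one_mul _).symm
        _ ≤ _ := mul_le_mul hcon hexpn (Real.exp_pos _).le (abs_nonneg _)
    have h2 := Real.exp_le_exp.1 h1
    have h3 : 0 < (m : ℝ) * R * η := by positivity
    linarith
  have : |(blockChange a v P).coeff n| < 1 := by exact_mod_cast hlt
  exact Int.abs_lt_one_iff.1 this

/-- The ideal spanned by the monomials of index at least `ε` with respect to `r`. -/
noncomputable def indexIdeal {m : ℕ} (r : Fin m → ℕ) (ε : ℝ) : Ideal (MvPolynomial (Fin m) ℚ) :=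
  Ideal.span ((fun a => MvPolynomial.monomial a 1) '' {a | ε ≤ ∑ h, (a h : ℝ) / r h})

lemma le_of_mem_indexIdeal {m : ℕ} {r : Fin m → ℕ} {ε : ℝ} {f : MvPolynomial (Fin m) ℚ}
    (hf : f ∈ indexIdeal r ε) {a : Fin m →₀ ℕ} (ha : a ∈ f.support) :
    ε ≤ ∑ h, (a h : ℝ) / r h := by
  obtain ⟨b, hb, hba⟩ := MvPolynomial.mem_ideal_span_monomial_image.1 hf a ha
  refine le_trans hb (sum_le_sum fun h _ => ?_)
  have : (b h : ℝ) ≤ a h := by exact_mod_cast hba h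
  gcongr

lemma exists_coordinates {B : Type*} [CommRing B] {q p r y0 y1 y2 z0 z1 z2 δ i b D q' : B}
    (hq : q' * q = 1) (hy : q * y0 + p * y1 + r * y2 = 0) (hz : q * z0 + p * z1 + r * z2 = 0)
    (hδ : δ * δ = 1) (hδ' : p ^ 2 - q * r = δ) (hi : i * b = 1)
    (hD : D * (y1 * z2 - y2 * z1) = 1) (T0 T1 T2 : B) :
    ∃ u w : B, T0 = b * (u * y0 + w * z0 + i * δ * (q * T0 + p * T1 + r * T2) * -r) ∧
      T1 = b * (u * y1 + w * z1 + i * δ * (q * T0 + p * T1 + r * T2) * p) ∧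
      T2 = b * (u * y2 + w * z2) := by
  set S := δ * (q * T0 + p * T1 + r * T2) with hS
  set T' := T1 - p * S with hT'
  set U := D * (T' * z2 - T2 * z1) with hU
  set W := D * (y1 * T2 - y2 * T') with hW
  have h1 : U * y1 + W * z1 = T' := by rw [hU, hW]; linear_combination T' * hD
  have h2 : U * y2 + W * z2 = T2 := by rw [hU, hW]; linear_combination T2 * hD
  have hδS : (p ^ 2 - q * r) * S = q * T0 + p * T1 + r * T2 := by
    rw [hδ', hS]
    linear_combination (q * T0 + p * T1 + r * T2) * hδ
  have h0 : U * y0 + W * z0 - r * S = T0 := by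
    have : q * (U * y0 + W * z0 - r * S) = q * T0 := by
      linear_combination U * hy + W * hz - p * h1 - r * h2 - p * hT' + hδS
    linear_combination q' * this + (T0 - (U * y0 + W * z0 - r * S)) * hq
  refine ⟨i * U, i * W, ?_, ?_, ?_⟩
  · linear_combination -(b * i) * h0 - T0 * hi - r * b * i * hS
  · linear_combination -(b * i) * (h1 + hT') - T1 * hi + p * b * i * hS
  · linear_combination -(b * i) * h2 - T2 * hi

theorem aeval_mem_map_indexIdeal {m : ℕ} {r : Fin m → ℕ} {ε : ℝ} {a : ℤ}
    {v : Fin m → Fin 3 → Fin 3 → ℤ} {P : MvPolynomial (Fin m × Fin 3) ℤ}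
    (hG : ∀ n ∈ (blockChange a v P).support, ε ≤ ∑ h, (n (h, 2) : ℝ) / r h)
    {T : Fin m × Fin 3 → MvPolynomial (Fin m) (MvPolynomial (Fin m) ℚ)}
    (U : Fin m → Fin 3 → MvPolynomial (Fin m) (MvPolynomial (Fin m) ℚ))
    (hU : ∀ h, MvPolynomial.C (MvPolynomial.X h) ∣ U h 2)
    (hT : ∀ h k, T (h, k) = (a : MvPolynomial (Fin m) (MvPolynomial (Fin m) ℚ)) ^ 2 *
      ∑ i, (v h i k : MvPolynomial (Fin m) (MvPolynomial (Fin m) ℚ)) * U h i) :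
    MvPolynomial.aeval T P ∈ (indexIdeal r ε).map MvPolynomial.C := by
  classical
  have h1 : MvPolynomial.aeval T P =
      MvPolynomial.aeval (fun x => U x.1 x.2) (blockChange a v P) := by
    rw [blockChange, MvPolynomial.comp_aeval_apply]
    refine congrArg (fun f => MvPolynomial.aeval f P) (funext fun x => ?_)
    rw [hT]
    simp [map_sum]
  rw [h1, MvPolynomial.aeval_def, MvPolynomial.eval₂_eq']
  refine Ideal.sum_mem _ fun n hn => Ideal.mul_mem_left _ _ ?_
  rw [Fintype.prod_prod_type]
  have h2 : MvPolynomial.C (MvPolynomial.monomial (Finsupp.equivFunOnFinite.symm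
      fun h => n (h, 2)) 1) ∣ ∏ h, ∏ k, U h k ^ n (h, k) := by
    rw [MvPolynomial.monomial_eq, MvPolynomial.C_1, one_mul, Finsupp.prod_fintype _ _ (by simp),
      map_prod]
    refine prod_dvd_prod_of_dvd _ _ fun h _ => ?_
    rw [map_pow]
    exact (pow_dvd_pow_of_dvd (hU h) _).trans (dvd_prod_of_mem (fun k => U h k ^ n (h, k))
      (mem_univ 2))
  refine Ideal.mem_of_dvd _ h2 (Ideal.mem_map_of_mem _ (Ideal.subset_span ⟨_, ?_, rfl⟩))
  exact hG n hn

/-- Set the middle variable of each block to `1` and collect the powers of the last one. -/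
noncomputable def dehomogenize {m : ℕ} (P : MvPolynomial (Fin m × Fin 3) ℤ) :
    MvPolynomial (Fin m) (MvPolynomial (Fin m) ℤ) :=
  MvPolynomial.aeval (fun x => if x.2 = 0 then MvPolynomial.C (MvPolynomial.X x.1)
    else if x.2 = 1 then 1 else MvPolynomial.X x.1) P

/-- The exponent of block degree `r` with first components `a` and last components `e`. -/
noncomputable def blockExponent {m : ℕ} (r : Fin m → ℕ) (e a : Fin m →₀ ℕ) :
    Fin m × Fin 3 →₀ ℕ :=
  Finsupp.equivFunOnFinite.symm fun x =>
    if x.2 = 0 then a x.1 else if x.2 = 1 then r x.1 - a x.1 - e x.1 else e x.1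

lemma coeff_coeff_dehomogenize {m : ℕ} {P : MvPolynomial (Fin m × Fin 3) ℤ} {r : Fin m → ℕ}
    (hP : ∀ c ∈ P.support, ∀ h, ∑ k, c (h, k) = r h) (e a : Fin m →₀ ℕ) :
    ((dehomogenize P).coeff e).coeff a = P.coeff (blockExponent r e a) := by
  classical
  have hmon : ∀ c : Fin m × Fin 3 →₀ ℕ, (∏ x, (if x.2 = 0 then
        (MvPolynomial.C (MvPolynomial.X x.1) : MvPolynomial (Fin m) (MvPolynomial (Fin m) ℤ))
        else if x.2 = 1 then 1 else MvPolynomial.X x.1) ^ c x) =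
      MvPolynomial.monomial (Finsupp.equivFunOnFinite.symm fun h => c (h, 2))
        (MvPolynomial.monomial (Finsupp.equivFunOnFinite.symm fun h => c (h, 0)) 1) := by
    intro c
    rw [MvPolynomial.monomial_eq, MvPolynomial.monomial_eq, Finsupp.prod_fintype _ _ (by simp),
      Finsupp.prod_fintype _ _ (by simp), Fintype.prod_prod_type, MvPolynomial.C_1, one_mul,
      map_prod, ← prod_mul_distrib]
    refine prod_congr rfl fun h _ => ?_
    rw [Fin.prod_univ_three]
    simp
  have hiff : ∀ c ∈ P.support, (((Finsupp.equivFunOnFinite.symm fun h => c (h, 2)) = e ∧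
      (Finsupp.equivFunOnFinite.symm fun h => c (h, 0)) = a) ↔ c = blockExponent r e a) := by
    intro c hc
    constructor
    · rintro ⟨rfl, rfl⟩
      ext ⟨h, k⟩
      have := hP c hc h
      rw [Fin.sum_univ_three] at this
      fin_cases k
      · simp [blockExponent]
      · simp [blockExponent]
        omega
      · simp [blockExponent]
    · intro hce
      constructor
      · ext h
        simp [hce, blockExponent]
      · ext h
        simp [hce, blockExponent]
  rw [dehomogenize, MvPolynomial.aeval_def, MvPolynomial.eval₂_eq', MvPolynomial.coeff_sum,
    MvPolynomial.coeff_sum]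
  have hterm : ∀ c ∈ P.support, (((algebraMap ℤ (MvPolynomial (Fin m) (MvPolynomial (Fin m) ℤ))
      (P.coeff c) * ∏ x, (if x.2 = 0 then
        (MvPolynomial.C (MvPolynomial.X x.1) : MvPolynomial (Fin m) (MvPolynomial (Fin m) ℤ))
        else if x.2 = 1 then 1 else MvPolynomial.X x.1) ^ c x).coeff e).coeff a) =
      if c = blockExponent r e a then P.coeff c else 0 := by
    intro c hc
    have hC : algebraMap ℤ (MvPolynomial (Fin m) (MvPolynomial (Fin m) ℤ)) (P.coeff c) =
        MvPolynomial.C (MvPolynomial.C (P.coeff c)) := by simp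
    rw [hmon, hC, MvPolynomial.coeff_C_mul, MvPolynomial.coeff_monomial]
    by_cases h1 : (Finsupp.equivFunOnFinite.symm fun h => c (h, 2)) = e
    · rw [if_pos h1, MvPolynomial.coeff_C_mul, MvPolynomial.coeff_monomial]
      by_cases h2 : (Finsupp.equivFunOnFinite.symm fun h => c (h, 0)) = a
      · rw [if_pos h2, if_pos ((hiff c hc).1 ⟨h1, h2⟩)]
        simp
      · rw [if_neg h2, if_neg fun h => h2 ((hiff c hc).2 h).2, mul_zero]
    · rw [if_neg h1, if_neg fun h => h1 ((hiff c hc).2 h).1, mul_zero, MvPolynomial.coeff_zero]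
  rw [sum_congr rfl hterm, sum_ite_eq']
  split_ifs with h
  · rfl
  · exact (MvPolynomial.notMem_support_iff.1 h).symm

lemma exists_minimal_coeff {m : ℕ} {R : Type*} [CommSemiring R] {F : MvPolynomial (Fin m) R}
    (hF : F ≠ 0) : ∃ e, F.coeff e ≠ 0 ∧ ∀ e', e' ≤ e → e' ≠ e → F.coeff e' = 0 := by
  obtain ⟨e, he, hmin⟩ := exists_min_image F.support Finsupp.degree
    (MvPolynomial.support_nonempty.2 hF)
  refine ⟨e, MvPolynomial.mem_support_iff.1 he, fun e' hle hne => ?_⟩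
  by_contra hcon
  have h1 := hmin e' (MvPolynomial.mem_support_iff.2 hcon)
  have h2 : e' + (e - e') = e := add_tsub_cancel_of_le hle
  have h3 : Finsupp.degree e = Finsupp.degree e' + Finsupp.degree (e - e') := by
    rw [← map_add, h2]
  have h4 : Finsupp.degree (e - e') = 0 := by omega
  rw [Finsupp.degree_eq_zero_iff] at h4
  rw [h4, add_zero] at h2
  exact hne h2

theorem coeff_aeval_eq_mvShift {m : ℕ} (P : MvPolynomial (Fin m × Fin 3) ℤ) {e : Fin m →₀ ℕ}
    (he : ∀ e', e' ≤ e → e' ≠ e → (dehomogenize P).coeff e' = 0) (ξ t : Fin m → ℚ)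
    {T : Fin m × Fin 3 → MvPolynomial (Fin m) (MvPolynomial (Fin m) ℚ)}
    (hT0 : ∀ h, T (h, 0) = MvPolynomial.C (MvPolynomial.X h + MvPolynomial.C (ξ h)) +
      MvPolynomial.C (MvPolynomial.C (t h)) * MvPolynomial.X h)
    (hT1 : ∀ h, T (h, 1) = 1) (hT2 : ∀ h, T (h, 2) = MvPolynomial.X h) :
    (MvPolynomial.aeval T P).coeff e =
      mvShift (Int.castRingHom ℚ) ξ ((dehomogenize P).coeff e) := by
  classical
  let ψ : MvPolynomial (Fin m) ℤ →+* MvPolynomial (Fin m) (MvPolynomial (Fin m) ℚ) :=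
    MvPolynomial.eval₂Hom (Int.castRingHom _) fun h => T (h, 0)
  have h1 : MvPolynomial.aeval T P =
      MvPolynomial.eval₂Hom ψ MvPolynomial.X (dehomogenize P) := by
    have h2 : (MvPolynomial.aeval T).toRingHom =
        (MvPolynomial.eval₂Hom ψ MvPolynomial.X).comp
        (MvPolynomial.aeval (R := ℤ) (fun x : Fin m × Fin 3 => if x.2 = 0 then
          (MvPolynomial.C (MvPolynomial.X x.1) : MvPolynomial (Fin m) (MvPolynomial (Fin m) ℤ))
          else if x.2 = 1 then 1 else MvPolynomial.X x.1)).toRingHom := by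
      refine MvPolynomial.ringHom_ext (fun c => by simp) fun x => ?_
      obtain ⟨h, k⟩ := x
      fin_cases k
      · simp [ψ]
      · simp [hT1]
      · simp [hT2]
    exact congrArg (fun φ => φ P) h2
  have h3 : ∀ f, (ψ f).coeff 0 = mvShift (Int.castRingHom ℚ) ξ f := by
    intro f
    have h4 : (MvPolynomial.constantCoeff).comp ψ = mvShift (Int.castRingHom ℚ) ξ := by
      refine MvPolynomial.ringHom_ext (fun c => by simp) fun h => ?_
      simp [ψ, mvShift, hT0]
    exact congrArg (fun φ => φ f) h4
  rw [h1, MvPolynomial.coe_eval₂Hom, MvPolynomial.eval₂_eq, MvPolynomial.coeff_sum]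
  have hterm : ∀ e' ∈ (dehomogenize P).support,
      (ψ ((dehomogenize P).coeff e') * ∏ i ∈ e'.support, MvPolynomial.X i ^ e' i).coeff e =
      if e' = e then mvShift (Int.castRingHom ℚ) ξ ((dehomogenize P).coeff e') else 0 := by
    intro e' he'
    have hm : ∏ i ∈ e'.support, (MvPolynomial.X i : MvPolynomial (Fin m) (MvPolynomial (Fin m) ℚ))
        ^ e' i = MvPolynomial.monomial e' 1 := by
      rw [MvPolynomial.monomial_eq, MvPolynomial.C_1, one_mul]
      rfl
    rw [hm, MvPolynomial.coeff_mul_monomial', mul_one]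
    by_cases h : e' = e
    · subst h
      rw [if_pos le_rfl, if_pos rfl, tsub_self, h3]
    · rw [if_neg h, if_neg]
      intro hle
      exact MvPolynomial.mem_support_iff.1 he' (he e' hle h)
  rw [sum_congr rfl hterm, sum_ite_eq']
  split_ifs with h
  · rfl
  · rw [MvPolynomial.notMem_support_iff.1 h, map_zero]

theorem exists_mvShift_index_ge {m : ℕ} {P : MvPolynomial (Fin m × Fin 3) ℤ} {r : Fin m → ℕ}
    {ε : ℝ} {a : ℤ} (ha : a ≠ 0) (hP0 : P ≠ 0) (hP : ∀ c ∈ P.support, ∀ h, ∑ k, c (h, k) = r h)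
    {q p s : Fin m → ℤ} (hq : ∀ h, q h ≠ 0) (hdet : ∀ h, |p h ^ 2 - q h * s h| = 1)
    {y z : Fin m → Fin 3 → ℤ} (hy : ∀ h, q h * y h 0 + p h * y h 1 + s h * y h 2 = 0)
    (hz : ∀ h, q h * z h 0 + p h * z h 1 + s h * z h 2 = 0)
    (hyz : ∀ h, y h 1 * z h 2 - y h 2 * z h 1 ≠ 0)
    (hG : ∀ n ∈ (blockChange a (fun h => ![y h, z h, ![-s h, p h, 0]]) P).support,
      ε ≤ ∑ h, (n (h, 2) : ℝ) / r h) :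
    ∃ f : MvPolynomial (Fin m) ℤ, f ≠ 0 ∧ lone f ≤ lone P ∧
      (∀ b ∈ f.support, ∀ h, b h ≤ r h) ∧
      ∀ b ∈ (mvShift (Int.castRingHom ℚ) (fun h => ((-p h : ℤ) : ℚ) / q h) f).support,
        ε ≤ ∑ h, (b h : ℝ) / r h := by
  classical
  have hF : dehomogenize P ≠ 0 := by
    obtain ⟨c, hc⟩ := MvPolynomial.support_nonempty.2 hP0
    intro h0
    have h1 := coeff_coeff_dehomogenize hP (Finsupp.equivFunOnFinite.symm fun h => c (h, 2))
      (Finsupp.equivFunOnFinite.symm fun h => c (h, 0))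
    have h2 : blockExponent r (Finsupp.equivFunOnFinite.symm fun h => c (h, 2))
        (Finsupp.equivFunOnFinite.symm fun h => c (h, 0)) = c := by
      ext ⟨h, k⟩
      have := hP c hc h
      rw [Fin.sum_univ_three] at this
      fin_cases k
      · simp [blockExponent]
      · simp [blockExponent]
        omega
      · simp [blockExponent]
    rw [h0, h2] at h1
    exact MvPolynomial.mem_support_iff.1 hc (by simpa using h1.symm)
  obtain ⟨e, he0, hemin⟩ := exists_minimal_coeff hF
  refine ⟨(dehomogenize P).coeff e, he0, ?_, ?_, ?_⟩
  · refine lone_le_of_coeff _ _ (blockExponent r e) (fun b b' hbb => ?_) fun b _ =>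
      coeff_coeff_dehomogenize hP e b
    ext h
    have := DFunLike.congr_fun hbb (h, 0)
    simpa [blockExponent] using this
  · intro b hb h
    rw [MvPolynomial.mem_support_iff, coeff_coeff_dehomogenize hP] at hb
    have := hP _ (MvPolynomial.mem_support_iff.2 hb) h
    rw [← this, Fin.sum_univ_three]
    simp [blockExponent]
    omega
  · set T : Fin m × Fin 3 → MvPolynomial (Fin m) (MvPolynomial (Fin m) ℚ) := fun x =>
      if x.2 = 0 then MvPolynomial.C (MvPolynomial.X x.1 +
          MvPolynomial.C (((-p x.1 : ℤ) : ℚ) / q x.1)) +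
        MvPolynomial.C (MvPolynomial.C (((-s x.1 : ℤ) : ℚ) / q x.1)) * MvPolynomial.X x.1
      else if x.2 = 1 then 1 else MvPolynomial.X x.1 with hT
    let φ : ℚ →+* MvPolynomial (Fin m) (MvPolynomial (Fin m) ℚ) :=
      MvPolynomial.C.comp MvPolynomial.C
    have hinv : ∀ n : ℤ, n ≠ 0 → φ (1 / n) * n = 1 := by
      intro n hn
      have hn' : (n : ℚ) ≠ 0 := by exact_mod_cast hn
      rw [← map_intCast φ, ← map_mul, one_div_mul_cancel hn', map_one]
    have hdiv : ∀ h (n : ℤ), (q h : MvPolynomial (Fin m) (MvPolynomial (Fin m) ℚ)) *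
        φ ((n : ℚ) / q h) = n := by
      intro h n
      have hn' : (q h : ℚ) ≠ 0 := by exact_mod_cast hq h
      rw [← map_intCast φ, ← map_mul, mul_div_cancel₀ _ hn', map_intCast]
    have hcoord : ∀ h, ∃ u w : MvPolynomial (Fin m) (MvPolynomial (Fin m) ℚ), _ :=
      fun h => exists_coordinates
        (B := MvPolynomial (Fin m) (MvPolynomial (Fin m) ℚ)) (q := (q h : ℤ)) (p := (p h : ℤ))
        (r := (s h : ℤ)) (y0 := (y h 0 : ℤ)) (y1 := (y h 1 : ℤ)) (y2 := (y h 2 : ℤ))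
        (z0 := (z h 0 : ℤ)) (z1 := (z h 1 : ℤ)) (z2 := (z h 2 : ℤ))
        (δ := ((p h ^ 2 - q h * s h : ℤ))) (i := φ (1 / (a ^ 2 : ℤ))) (b := ((a ^ 2 : ℤ)))
        (D := φ (1 / (y h 1 * z h 2 - y h 2 * z h 1 : ℤ))) (q' := φ (1 / (q h : ℤ)))
        (hinv _ (hq h)) (by exact_mod_cast hy h) (by exact_mod_cast hz h)
        (by
          have : (p h ^ 2 - q h * s h) * (p h ^ 2 - q h * s h) = 1 := by
            rw [← abs_mul_abs_self, hdet, one_mul]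
          exact_mod_cast this)
        (by push_cast; ring) (hinv _ (pow_ne_zero 2 ha))
        (by exact_mod_cast hinv _ (hyz h)) (T (h, 0)) (T (h, 1)) (T (h, 2))
    choose u w h0 h1 h2 using hcoord
    have hmem := aeval_mem_map_indexIdeal (T := T) hG (fun h => ![u h, w h,
      φ (1 / (a ^ 2 : ℤ)) * ((p h ^ 2 - q h * s h : ℤ)) * ((q h : ℤ) * T (h, 0) +
        (p h : ℤ) * T (h, 1) + (s h : ℤ) * T (h, 2))]) (fun h => ?_) (fun h k => ?_)
    · rw [MvPolynomial.mem_map_C_iff] at hmem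
      intro b hb
      refine le_of_mem_indexIdeal (hmem e) ?_
      rw [coeff_aeval_eq_mvShift P hemin (fun h => ((-p h : ℤ) : ℚ) / q h)
        (fun h => ((-s h : ℤ) : ℚ) / q h) (T := T) (fun h => by simp [hT]) (fun h => by simp [hT])
        (fun h => by simp [hT])]
      exact hb
    · have hp := hdiv h (-p h)
      have hs := hdiv h (-s h)
      have e1 : ((q h : ℤ) : MvPolynomial (Fin m) (MvPolynomial (Fin m) ℚ)) * T (h, 0) +
          ((p h : ℤ) : MvPolynomial (Fin m) (MvPolynomial (Fin m) ℚ)) * T (h, 1) +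
          ((s h : ℤ) : MvPolynomial (Fin m) (MvPolynomial (Fin m) ℚ)) * T (h, 2) =
            MvPolynomial.C (MvPolynomial.X h) *
              ((q h : ℤ) : MvPolynomial (Fin m) (MvPolynomial (Fin m) ℚ)) := by
        have e0 : T (h, 0) = MvPolynomial.C (MvPolynomial.X h) + φ (((-p h : ℤ) : ℚ) / q h) +
          φ (((-s h : ℤ) : ℚ) / q h) * MvPolynomial.X h := by
          simp only [hT, if_true, map_add, φ, RingHom.comp_apply]
        have e2 : T (h, 1) = 1 := by simp [hT]
        have e3 : T (h, 2) = MvPolynomial.X h := by simp [hT]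
        rw [e0, e2, e3]
        push_cast at hp hs ⊢
        linear_combination hp + MvPolynomial.X h * hs
      simp only [Matrix.cons_val]
      rw [e1]
      exact (dvd_mul_right _ _).mul_left _
    · rw [Fin.sum_univ_three]
      fin_cases k
      · refine (h0 h).trans ?_
        simp [-mul_eq_mul_left_iff, mul_comm]
      · refine (h1 h).trans ?_
        simp [-mul_eq_mul_left_iff, mul_comm]
      · refine (h2 h).trans ?_
        simp [-mul_eq_mul_left_iff, mul_comm]

theorem exists_lacunary {X : Type*} (f : X → ℝ) (hf : ∀ B, ∃ x, B ≤ f x) (K B : ℝ) (m : ℕ) :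
    ∃ x : Fin m → X, (∀ h, B ≤ f (x h)) ∧ ∀ i j, i < j → K * f (x j) ≤ f (x i) := by
  induction m with
  | zero => exact ⟨Fin.elim0, fun h => h.elim0, fun i => i.elim0⟩
  | succ m ih =>
    obtain ⟨x, hB, hK⟩ := ih
    obtain ⟨x0, hx0⟩ := hf (|B| + ∑ j, |K * f (x j)|)
    have h1 : 0 ≤ ∑ j, |K * f (x j)| := sum_nonneg fun j _ => abs_nonneg _
    refine ⟨Fin.cons x0 x, fun h => ?_, fun i j hij => ?_⟩
    · refine Fin.cases ?_ (fun h => ?_) h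
      · simpa using (le_abs_self B).trans (by linarith)
      · simpa using hB h
    · obtain ⟨j, rfl⟩ := Fin.exists_succ_eq.2 (Fin.ne_zero_of_lt hij)
      revert hij
      refine Fin.cases (fun _ => ?_) (fun i hij => ?_) i
      · have h2 : |K * f (x j)| ≤ ∑ j, |K * f (x j)| :=
          single_le_sum (f := fun j => |K * f (x j)|) (fun j _ => abs_nonneg _) (mem_univ j)
        simp only [Fin.cons_zero, Fin.cons_succ]
        linarith [le_abs_self (K * f (x j)), abs_nonneg B]
      · simpa using hK i j (Fin.succ_lt_succ_iff.1 hij)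

theorem den_neg_div_eq {p q s : ℤ} (hq : 0 < q) (h : |p ^ 2 - q * s| = 1) :
    ((((-p : ℤ) : ℚ) / q).den : ℤ) = q := by
  refine Rat.den_div_eq_of_coprime hq (Int.isCoprime_iff_nat_coprime.1 ?_)
  rcases (abs_eq zero_le_one).1 h with h | h
  · exact ⟨-p, -s, by linarith⟩
  · exact ⟨p, s, by linarith⟩

/-- An algebraic number with arbitrarily good simultaneous approximations `α ≈ p / q`, `α ≈ r / p`
such that `p ^ 2 - q * r = ±1` has degree at most two. -/
theorem exists_quadratic_relation_of_approximations {α : ℝ} (hα : IsAlgebraic ℚ α)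
    (happ : ∀ N : ℕ, ∃ q p r : ℤ, (N : ℤ) ≤ q ∧ 0 < q ∧ |p ^ 2 - q * r| = 1 ∧
      |(q : ℝ) * α - p| ≤ 1 / q ∧ |(p : ℝ) * α - r| ≤ 1 / q) :
    ∃ Y : Fin 3 → ℤ, Y ≠ 0 ∧ (Y 0 : ℝ) + α * Y 1 + α ^ 2 * Y 2 = 0 := by
  by_contra! hdeg
  obtain ⟨η, hη, hη1, N, hN⟩ := exists_small_vectors hα hdeg
  obtain ⟨a, m, C, ha, hm, hC, haux⟩ := exists_auxiliary_polynomial hα hη hη1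
  have hm' : (0 : ℝ) < m := by exact_mod_cast hm
  obtain ⟨σ, hσ, hroth⟩ := roth_lemma m (m * η / 256) (by positivity)
  let X := {t : ℤ × ℤ × ℤ // 0 < t.1 ∧ N ≤ t.1 ∧ |t.2.1 ^ 2 - t.1 * t.2.2| = 1 ∧
    |(t.1 : ℝ) * α - t.2.1| ≤ 1 / t.1 ∧ |(t.2.1 : ℝ) * α - t.2.2| ≤ 1 / t.1}
  have hf : ∀ B : ℝ, ∃ x : X, B ≤ Real.log x.1.1 := by
    intro B
    obtain ⟨M, hM⟩ := exists_nat_ge (max N (Real.exp B))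
    obtain ⟨q, p, s, h1, h2, h3, h4, h5⟩ := happ M
    have h6 : (M : ℝ) ≤ q := by exact_mod_cast h1
    refine ⟨⟨(q, p, s), h2, (le_max_left _ _).trans (hM.trans h6), h3, h4, h5⟩, ?_⟩
    rw [Real.le_log_iff_exp_le (by exact_mod_cast h2)]
    exact (le_max_right _ _).trans (hM.trans h6)
  set L := Real.log (3 * (a : ℝ) ^ 2 * C)
  set ℓ : ℝ := max 1 (max (96 * L / η) ((Real.log C + 1) * (2 * m) / σ))
  obtain ⟨x, hℓ, hK⟩ := exists_lacunary (fun x : X => Real.log x.1.1) hf (2 / σ) ℓ m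
  have hℓ1 : 1 ≤ ℓ := le_max_left _ _
  have hℓL : 96 * L ≤ ℓ * η := (div_le_iff₀ hη).1 ((le_max_left _ _).trans (le_max_right _ _))
  have hℓC : (Real.log C + 1) * (2 * m) ≤ ℓ * σ :=
    (div_le_iff₀ hσ).1 ((le_max_right _ _).trans (le_max_right _ _))
  choose y z e he hes hy hz hyz hly hlz hls using fun h =>
    hN (x h).1.1 (x h).1.2.1 (x h).1.2.2 (x h).2.1 (x h).2.2.1 (x h).2.2.2.1 (x h).2.2.2.2.1
      (x h).2.2.2.2.2
  have hq0 : ∀ h, 0 < (x h).1.1 := fun h => (x h).2.1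
  have hdet : ∀ h, |(x h).1.2.1 ^ 2 - (x h).1.1 * (x h).1.2.2| = 1 := fun h => (x h).2.2.2.1
  have hlog : ∀ h, 1 ≤ Real.log (x h).1.1 := fun h => hℓ1.trans (hℓ h)
  set R : ℝ := 1 + 24 / η * ∑ h, Real.log (x h).1.1
  have hlogR : ∀ h, Real.log (x h).1.1 ≤ η / 24 * R := by
    intro h
    have h1 : Real.log (x h).1.1 ≤ ∑ h, Real.log (x h).1.1 :=
      single_le_sum (f := fun h => Real.log (x h).1.1)
        (fun h _ => zero_le_one.trans (hlog h)) (mem_univ h)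
    have h2 : η / 24 * R = η / 24 + ∑ h, Real.log (x h).1.1 := by
      simp only [R]; field_simp
    linarith
  have hR : 0 < R := by
    have : 0 ≤ ∑ h, Real.log (x h).1.1 := sum_nonneg fun h _ => zero_le_one.trans (hlog h)
    positivity
  set r : Fin m → ℕ := fun h => ⌈R / Real.log (x h).1.1⌉₊
  have hlog0 : ∀ h, 0 < Real.log (x h).1.1 := fun h => zero_lt_one.trans_le (hlog h)
  have hr : ∀ h, 0 < r h := fun h => Nat.ceil_pos.2 (div_pos hR (hlog0 h))
  have hl1 : ∀ h, R ≤ r h * Real.log (x h).1.1 := fun h =>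
    (div_le_iff₀ (hlog0 h)).1 (Nat.le_ceil _)
  have hl2 : ∀ h, r h * Real.log (x h).1.1 ≤ (1 + η / 24) * R := by
    intro h
    have h1 := (Nat.ceil_lt_add_one (div_nonneg hR.le (hlog0 h).le)).le
    have h2 := mul_le_mul_of_nonneg_right h1 (hlog0 h).le
    rw [add_mul, div_mul_cancel₀ _ (hlog0 h).ne'] at h2
    linarith [hlogR h]
  have hl3 : ∀ h, r h * Real.log (x h).1.1 ≤ 2 * R := fun h =>
    (hl2 h).trans (mul_le_mul_of_nonneg_right (by linarith) hR.le)
  have hD : (∑ h, (r h : ℝ)) * ℓ ≤ 2 * m * R := by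
    rw [sum_mul]
    refine (sum_le_card_nsmul univ _ (2 * R) fun h _ => ?_).trans_eq ?_
    · exact (mul_le_mul_of_nonneg_left (hℓ h) (Nat.cast_nonneg _)).trans (hl3 h)
    · simp; ring
  have hD0 : (0 : ℝ) ≤ ∑ h, (r h : ℝ) := sum_nonneg fun h _ => Nat.cast_nonneg _
  obtain ⟨P, Q, hP0, hP, hPC, hQ, hQs, hPQ⟩ := haux r e hr he hes
  have hvan := fun n => blockChange_coeff_eq_zero (n := n) (q := fun h => ((x h).1.1 : ℝ))
    (v := fun h => ![y h, z h, ![-(x h).1.2.2, (x h).1.2.1, 0]]) ha hm hη hη1 hR hC hr he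
    (fun h => by exact_mod_cast hq0 h) hl1 hl2 (by nlinarith) (fun h i k => by
      fin_cases i
      · simpa using hly h k
      · simpa using hlz h k
      · simpa using hls h k) hQ hQs hPQ
  obtain ⟨f, hf0, hfP, hfr, hfind⟩ := exists_mvShift_index_ge (ε := m * η / 256) ha hP0 hP
    (fun h => (hq0 h).ne') hdet hy hz hyz fun n hn => by
      by_contra! hlt
      exact MvPolynomial.mem_support_iff.1 hn (hvan n hlt)
  have hden : ∀ h, (((((-(x h).1.2.1 : ℤ) : ℚ) / (x h).1.1).den : ℕ) : ℝ) = (x h).1.1 := by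
    intro h
    exact_mod_cast den_neg_div_eq (hq0 h) (hdet h)
  have hratio : ∀ i j, i < j → (r i : ℝ) ≤ σ * r j := by
    intro i j hij
    have h1 := hK i j hij
    have h2 : r i * (2 / σ * Real.log (x j).1.1) ≤ 2 * (r j * Real.log (x j).1.1) :=
      (mul_le_mul_of_nonneg_left h1 (Nat.cast_nonneg _)).trans
        ((hl3 i).trans (by linarith [hl1 j]))
    have h3 : (r i : ℝ) * (2 / σ) ≤ 2 * r j := by
      refine le_of_mul_le_mul_right ?_ (hlog0 j)
      linarith
    rw [mul_div_assoc', div_le_iff₀ hσ] at h3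
    linarith
  have hheight : Real.log (lone f) + ∑ h, (r h : ℝ) ≤ σ * R := by
    have h1 : Real.log (lone f) ≤ (∑ h, (r h : ℝ)) * Real.log C := by
      have h2 := Real.log_le_log (zero_lt_one.trans_le (one_le_lone f hf0)) (hfP.trans hPC)
      rwa [Real.log_pow, Nat.cast_sum] at h2
    have h3 : (∑ h, (r h : ℝ)) * ((Real.log C + 1) * (2 * m)) ≤ 2 * m * R * σ := by
      refine (mul_le_mul_of_nonneg_left hℓC hD0).trans ?_
      rw [← mul_assoc]
      exact mul_le_mul_of_nonneg_right hD hσ.le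
    have h4 : (∑ h, (r h : ℝ)) * (Real.log C + 1) ≤ σ * R := by
      refine le_of_mul_le_mul_right ?_ (show (0 : ℝ) < 2 * m by positivity)
      linarith
    linarith
  obtain ⟨b, hb, hbε⟩ := hroth r (fun h => ((-(x h).1.2.1 : ℤ) : ℚ) / (x h).1.1) R f hf0 hr hratio
    (fun h => by rw [hden]; exact hl1 h) hfr hheight
  exact absurd hbε (hfind b hb).not_gt

theorem palindromic_transcendental_or_quadratic
    (a : ℕ → ℕ) (ha : ∀ k, 0 < a k) (α : ℝ)
    (hα : Filter.Tendsto (fun i => cfVal (cfPrefix a i)) Filter.atTop (nhds α))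
    (hirr : Irrational α)
    (hpal : {i : ℕ | IsMPal 1 (cfPrefix a i)}.Infinite) :
    Transcendental ℚ α ∨ IsQuadraticIrrational α := by
  refine or_iff_not_imp_left.2 fun hT => ⟨hirr, ?_⟩
  obtain ⟨Y, hY0, hY⟩ := exists_quadratic_relation_of_approximations (not_not.1 hT)
    (exists_symmetric_approximation ha hα hpal)
  refine ⟨Y 2, Y 1, Y 0, fun h2 => ?_, by linarith⟩
  have h1 : Y 1 = 0 := by
    by_contra h1
    refine hirr.intCast_mul h1 |>.ne_int (-Y 0) ?_
    rw [h2] at hY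
    push_cast
    push_cast at hY
    linarith
  refine hY0 (funext fun k => ?_)
  have h0 : Y 0 = 0 := by
    rw [h1, h2] at hY
    simpa using hY
  fin_cases k <;> assumption
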